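/- Let N ≥ 2 and consider the nonautonomous linear control system ẋ(t) = A(t)x(t) + B(t)u(t), x(0) = 0, with A : [0,∞) → ℝ^{N×N}, B : [0,∞) → ℝ^{N×M} measurable and bounded, 1 ≤ M ≤ N, and measurable controls u with values in [−1,1]^M. Assume that for every column b(·) of B(·) and every unit vector ζ ∈ ℝ^N, the switching functions g(t) = ⟨ζ, M^⊤(τ,t) b(t)⟩ and g_0(t) = ⟨ζ, M_0^⊤(τ,t) b(0)⟩ satisfy: (i) rank[b(0), A(0)b(0), …, A(0)^{N−1}b(0)] = N; (ii) g is N−2 times differentiable with g^{(N−2)} absolutely continuous; (iii) |g^{(i)}(t) − g_0^{(i)}(t)| ≤ K t for 0 ≤ t ≤ 𝒯′ and i = 0, …, N−1, with K and 𝒯′ independent of ζ and of the horizon τ. Then there exist a time 𝒯 > 0 and constants γ > 0 and γ′ > 0, depending only on A, B, N, such that for every 0 < τ ≤ 𝒯: (1) for every x, y in the reachable set 𝓡^τ and every ζ ∈ N_{𝓡^τ}(x), ⟨ζ, y − x⟩ ≤ −γ ‖ζ‖ ‖y − x‖^N; and (2) the closed ball B(0, γ′ τ^N) is contained in 𝓡^τ.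 -/

import Mathlib

noncomputable section
open MeasureTheory

/-- Euclidean norm on `ℝ^N`. -/
def euNorm {N : ℕ} (x : Fin N → ℝ) : ℝ := Real.sqrt (∑ i, x i ^ 2)

/-- Euclidean inner product on `ℝ^N`. -/
def euDot {N : ℕ} (x y : Fin N → ℝ) : ℝ := ∑ i, x i * y i

/-- The Kalman matrix, whose columns are `b, Ab, …, A^{N-1}b`. -/
def kalman {N : ℕ} (A : Matrix (Fin N) (Fin N) ℝ) (b : Fin N → ℝ) :
    Matrix (Fin N) (Fin N) ℝ :=
  Matrix.of fun i j => ((A ^ (j : ℕ)).mulVec b) i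

/-- `X` is the transition "matrix solution" of `∂ₜ X(t,s) = X(t,s) A(t)`,
`X(s,s) = 𝕀`, in integral (entrywise) form. -/
def IsTransition {N : ℕ} (A : ℝ → Matrix (Fin N) (Fin N) ℝ)
    (X : ℝ → ℝ → Matrix (Fin N) (Fin N) ℝ) : Prop :=
  ∀ s t : ℝ, X t s = 1 + Matrix.of fun i j => ∫ r in s..t, (X r s * A r) i j

/-- An admissible control: measurable with values in the cube `[-1,1]^M`. -/
def IsAdmissible (M : ℕ) (u : ℝ → Fin M → ℝ) : Prop :=
  Measurable u ∧ ∀ t i, u t i ∈ Set.Icc (-1 : ℝ) 1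

/-- A trajectory (Carathéodory solution, in integral form) of the
nonautonomous system `ẋ = A(t)x + B(t)u`, `x(0) = 0`, on `[0,τ]`. -/
def IsLinNATraj (N M : ℕ) (A : ℝ → Matrix (Fin N) (Fin N) ℝ)
    (B : ℝ → Matrix (Fin N) (Fin M) ℝ) (τ : ℝ) (u : ℝ → Fin M → ℝ)
    (x : ℝ → Fin N → ℝ) : Prop :=
  Continuous x ∧ ∀ t ∈ Set.Icc (0 : ℝ) τ,
    x t = ∫ r in (0:ℝ)..t, ((A r).mulVec (x r) + (B r).mulVec (u r))

/-- The reachable set from the origin at time `τ`. -/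
def linNAReach (N M : ℕ) (A : ℝ → Matrix (Fin N) (Fin N) ℝ)
    (B : ℝ → Matrix (Fin N) (Fin M) ℝ) (τ : ℝ) : Set (Fin N → ℝ) :=
  {p | ∃ u x, IsAdmissible M u ∧ IsLinNATraj N M A B τ u x ∧ p = x τ}

/-- `f` is absolutely continuous on `[a,b]`. -/
def AbsContOn (f : ℝ → ℝ) (a b : ℝ) : Prop :=
  ∃ f' : ℝ → ℝ, IntervalIntegrable f' volume a b ∧
    ∀ t ∈ Set.Icc a b, f t = f a + ∫ r in a..t, f' r

/-- The proximal normal cone to `K` at `x`. -/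
def proxNormalCone {N : ℕ} (K : Set (Fin N → ℝ)) (x : Fin N → ℝ) : Set (Fin N → ℝ) :=
  {v | ∃ σ : ℝ, 0 ≤ σ ∧ ∀ y ∈ K, euDot v (y - x) ≤ σ * euNorm (y - x) ^ 2}

/-- The switching function `t ↦ ⟨ζ, X(τ,t) b(t)⟩` of column `j` of `B`. -/
def swFun {N M : ℕ} (B : ℝ → Matrix (Fin N) (Fin M) ℝ)
    (X : ℝ → ℝ → Matrix (Fin N) (Fin N) ℝ) (j : Fin M) (ζ : Fin N → ℝ) (τ : ℝ) :
    ℝ → ℝ :=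
  fun t => euDot ζ ((X τ t).mulVec fun i => B t i j)

namespace ReachableSet

open Filter Topology

/-! ### Primitives of integrable functions, up to null sets -/

/-- On `(s, T]` the function `f` agrees almost everywhere with the primitive of `φ` that takes the
value `c` at `s`. -/
def PrimOn (s T : ℝ) (f φ : ℝ → ℝ) (c : ℝ) : Prop :=
  IntervalIntegrable φ volume s T ∧
    f =ᵐ[volume.restrict (Set.Ioc s T)] fun t => c + ∫ r in s..t, φ r

section Prim

variable {s T c d : ℝ} {f g φ ψ : ℝ → ℝ}

theorem absCont_primitive (h : IntervalIntegrable φ volume s T) (c : ℝ) :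
    AbsolutelyContinuousOnInterval (fun t => c + ∫ r in s..t, φ r) s T :=
  (LipschitzOnWith.absolutelyContinuousOnInterval (K := 0)
    (LipschitzWith.const c).lipschitzOnWith).fun_add
    (h.absolutelyContinuousOnInterval_intervalIntegral (by simp))

theorem ae_hasDerivAt_primitive (h : IntervalIntegrable φ volume s T) (c : ℝ) :
    ∀ᵐ t, t ∈ Set.uIcc s T → HasDerivAt (fun t => c + ∫ r in s..t, φ r) (φ t) t := by
  filter_upwards [h.ae_hasDerivAt_integral] with t ht h1
  simpa using (ht h1 s (by simp)).const_add c

/-- The fundamental theorem of calculus for absolutely continuous functions. -/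
theorem eq_primitive_of_ae_hasDerivAt (hF : AbsolutelyContinuousOnInterval f s T)
    (hd : ∀ᵐ t, t ∈ Set.uIcc s T → HasDerivAt f (φ t) t) :
    IntervalIntegrable φ volume s T ∧ ∀ t ∈ Set.uIcc s T, f t = f s + ∫ r in s..t, φ r := by
  have hde : ∀ᵐ t, t ∈ Set.uIcc s T → deriv f t = φ t := by
    filter_upwards [hd] with t ht h1 using (ht h1).deriv
  refine ⟨hF.intervalIntegrable_deriv.congr_ae ?_, fun t ht => ?_⟩
  · rw [EventuallyEq, ae_restrict_iff' measurableSet_uIoc]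
    filter_upwards [hde] with t h1 h2 using h1 (Set.uIoc_subset_uIcc h2)
  · have hsub : Set.uIcc s t ⊆ Set.uIcc s T := Set.uIcc_subset_uIcc_left ht
    have h1 := (hF.mono hsub).integral_deriv_eq_sub
    rw [intervalIntegral.integral_congr_ae (g := φ)] at h1
    · linarith
    · filter_upwards [hde] with r h1 h2 using h1 (hsub (Set.uIoc_subset_uIcc h2))

theorem PrimOn.congr (h : PrimOn s T f φ c) (hf : g =ᵐ[volume.restrict (Set.Ioc s T)] f) :
    PrimOn s T g φ c :=
  ⟨h.1, hf.trans h.2⟩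

theorem PrimOn.congr_deriv (hsT : s ≤ T) (h : PrimOn s T f φ c)
    (hφ : ψ =ᵐ[volume.restrict (Set.Ioc s T)] φ) : PrimOn s T f ψ c := by
  refine ⟨h.1.congr_ae (by rw [Set.uIoc_of_le hsT]; exact hφ.symm), ?_⟩
  filter_upwards [h.2, ae_restrict_mem measurableSet_Ioc] with t h1 h2
  rw [h1]
  congr 1
  refine intervalIntegral.integral_congr_ae ?_
  rw [ae_restrict_eq measurableSet_Ioc] at hφ
  rw [EventuallyEq, eventually_inf_principal] at hφ
  filter_upwards [hφ] with r hr hr2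
  rw [Set.uIoc_of_le h2.1.le] at hr2
  exact (hr ⟨hr2.1, hr2.2.trans h2.2⟩).symm

theorem PrimOn.mono {T' : ℝ} (hs : s ≤ T') (hT : T' ≤ T) (h : PrimOn s T f φ c) :
    PrimOn s T' f φ c :=
  ⟨h.1.mono_set (by
    rw [Set.uIcc_of_le hs, Set.uIcc_of_le (hs.trans hT)]; exact Set.Icc_subset_Icc_right hT),
    ae_mono (Measure.restrict_mono (Set.Ioc_subset_Ioc_right hT) le_rfl) h.2⟩

theorem primOn_of_eq (hφ : IntervalIntegrable φ volume s T)
    (h : ∀ t ∈ Set.Icc s T, f t = c + ∫ r in s..t, φ r) : PrimOn s T f φ c := by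
  refine ⟨hφ, ?_⟩
  filter_upwards [ae_restrict_mem measurableSet_Ioc] with t ht using h t ⟨ht.1.le, ht.2⟩

theorem primOn_const (s T c : ℝ) : PrimOn s T (fun _ => c) (fun _ => 0) c :=
  ⟨by simp, by simp [EventuallyEq]⟩

theorem PrimOn.add (hsT : s ≤ T) (hf : PrimOn s T f φ c) (hg : PrimOn s T g ψ d) :
    PrimOn s T (fun t => f t + g t) (fun t => φ t + ψ t) (c + d) := by
  refine ⟨hf.1.add hg.1, ?_⟩
  filter_upwards [hf.2, hg.2, ae_restrict_mem measurableSet_Ioc] with t h1 h2 h3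
  have hsub : Set.uIcc s t ⊆ Set.uIcc s T := by
    rw [Set.uIcc_of_le h3.1.le, Set.uIcc_of_le hsT]; exact Set.Icc_subset_Icc_right h3.2
  rw [intervalIntegral.integral_add (hf.1.mono_set hsub) (hg.1.mono_set hsub), h1, h2]
  ring

theorem PrimOn.mul (hsT : s ≤ T) (hf : PrimOn s T f φ c) (hg : PrimOn s T g ψ d) :
    PrimOn s T (fun t => f t * g t) (fun t => φ t * g t + f t * ψ t) (c * d) := by
  have hF := absCont_primitive hf.1 c
  have hG := absCont_primitive hg.1 d
  have key := eq_primitive_of_ae_hasDerivAt (hF.fun_mul hG)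
    (φ := fun t => φ t * (d + ∫ r in s..t, ψ r) + (c + ∫ r in s..t, φ r) * ψ t) (by
      filter_upwards [ae_hasDerivAt_primitive hf.1 c, ae_hasDerivAt_primitive hg.1 d]
        with t h1 h2 h3 using (h1 h3).mul (h2 h3))
  refine PrimOn.congr_deriv hsT (φ := fun t => φ t * (d + ∫ r in s..t, ψ r) +
    (c + ∫ r in s..t, φ r) * ψ t) (PrimOn.congr (primOn_of_eq key.1 (f := fun t =>
      (c + ∫ r in s..t, φ r) * (d + ∫ r in s..t, ψ r)) fun t ht => ?_) ?_) ?_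
  · have := key.2 t (by rwa [Set.uIcc_of_le hsT])
    simpa using this
  · filter_upwards [hf.2, hg.2] with t h1 h2
    rw [h1, h2]
  · filter_upwards [hf.2, hg.2] with t h1 h2
    rw [h1, h2]

theorem PrimOn.const_mul (hsT : s ≤ T) (a : ℝ) (hf : PrimOn s T f φ c) :
    PrimOn s T (fun t => a * f t) (fun t => a * φ t) (a * c) := by
  simpa using (primOn_const s T a).mul hsT hf

theorem PrimOn.sum {ι : Type*} (I : Finset ι) {f φ : ι → ℝ → ℝ} {c : ι → ℝ} (hsT : s ≤ T)
    (h : ∀ i ∈ I, PrimOn s T (f i) (φ i) (c i)) :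
    PrimOn s T (fun t => ∑ i ∈ I, f i t) (fun t => ∑ i ∈ I, φ i t) (∑ i ∈ I, c i) := by
  classical
  induction I using Finset.induction_on with
  | empty => simpa using primOn_const s T 0
  | insert a I ha ih =>
    simp only [Finset.sum_insert ha]
    exact (h a (by simp)).add hsT (ih fun i hi => h i (by simp [hi]))

theorem PrimOn.sub (hsT : s ≤ T) (hf : PrimOn s T f φ c) (hg : PrimOn s T g ψ d) :
    PrimOn s T (fun t => f t - g t) (fun t => φ t - ψ t) (c - d) := by
  simpa [sub_eq_add_neg] using hf.add hsT (hg.const_mul hsT (-1))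

theorem continuousOn_primitive (hsT : s ≤ T) (h : IntervalIntegrable φ volume s T) (c : ℝ) :
    ContinuousOn (fun t => c + ∫ r in s..t, φ r) (Set.Icc s T) := by
  have := (absCont_primitive h c).continuousOn
  rwa [Set.uIcc_of_le hsT] at this

theorem eqOn_of_ae_eq_of_continuousOn (hsT : s < T) (hf : ContinuousOn f (Set.Icc s T))
    (hg : ContinuousOn g (Set.Icc s T)) (h : f =ᵐ[volume.restrict (Set.Ioc s T)] g) :
    Set.EqOn f g (Set.Icc s T) := by
  refine Measure.eqOn_Icc_of_ae_eq volume hsT.ne ?_ hf hg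
  rw [← restrict_Ioc_eq_restrict_Icc]
  exact h

theorem PrimOn.unique (hsT : s < T) (hf : PrimOn s T f φ c) (hg : PrimOn s T f ψ d) :
    c = d ∧ φ =ᵐ[volume.restrict (Set.Ioc s T)] ψ := by
  have he := eqOn_of_ae_eq_of_continuousOn hsT (continuousOn_primitive hsT.le hf.1 c)
    (continuousOn_primitive hsT.le hg.1 d) (hf.2.symm.trans hg.2)
  refine ⟨by simpa using he (Set.left_mem_Icc.2 hsT.le), ?_⟩
  rw [← restrict_Ioo_eq_restrict_Ioc, EventuallyEq, ae_restrict_iff' measurableSet_Ioo]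
  filter_upwards [ae_hasDerivAt_primitive hf.1 c, ae_hasDerivAt_primitive hg.1 d] with t h1 h2 h3
  have hm : t ∈ Set.uIcc s T := by
    rw [Set.uIcc_of_le hsT.le]; exact Set.Ioo_subset_Icc_self h3
  refine (h1 hm).unique ((h2 hm).congr_of_eventuallyEq ?_)
  filter_upwards [Ioo_mem_nhds h3.1 h3.2] with r hr using he (Set.Ioo_subset_Icc_self hr)

/-- A continuous function with vanishing weak derivative keeps its initial value. -/
theorem PrimOn.eq_of_deriv_zero (hsT : s < T) (hf : PrimOn s T f φ c)
    (hφ : φ =ᵐ[volume.restrict (Set.Ioc s T)] 0) (hc : ContinuousOn f (Set.Icc s T)) :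
    ∀ t ∈ Set.Icc s T, f t = c := by
  have h1 := (hf.congr_deriv hsT.le hφ.symm).2
  have h2 : f =ᵐ[volume.restrict (Set.Ioc s T)] fun _ => c := by
    filter_upwards [h1] with t ht
    simpa using ht
  exact eqOn_of_ae_eq_of_continuousOn hsT hc continuousOn_const h2

end Prim

/-! ### Sobolev-type classes of functions on `(0, T]` -/

/-- Functions on `(0, T]` with `k` weak derivatives, the last of which is bounded. -/
def Wk (T : ℝ) : ℕ → (ℝ → ℝ) → Prop
  | 0, f => AEStronglyMeasurable f (volume.restrict (Set.Ioc 0 T)) ∧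
      ∃ C : ℝ, ∀ᵐ t ∂(volume.restrict (Set.Ioc 0 T)), |f t| ≤ C
  | k + 1, f => ∃ φ c, Wk T k φ ∧ PrimOn 0 T f φ c

/-- Functions on `(0, T]` with `k` weak derivatives, all of which, up to order `k`, are `O(t)`. -/
def Zk (T : ℝ) : ℕ → (ℝ → ℝ) → Prop
  | 0, f => AEStronglyMeasurable f (volume.restrict (Set.Ioc 0 T)) ∧
      ∃ C : ℝ, ∀ᵐ t ∂(volume.restrict (Set.Ioc 0 T)), |f t| ≤ C * t
  | k + 1, f => ∃ φ, Zk T k φ ∧ PrimOn 0 T f φ 0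

section Classes

variable {T c : ℝ} {f g φ : ℝ → ℝ} {k : ℕ}

theorem Wk.congr : ∀ {k : ℕ} {f g : ℝ → ℝ}, Wk T k f →
    g =ᵐ[volume.restrict (Set.Ioc 0 T)] f → Wk T k g
  | 0, _, _, h, e => by
    obtain ⟨h1, C, h2⟩ := h
    refine ⟨h1.congr e.symm, C, ?_⟩
    filter_upwards [h2, e] with t ht1 ht2
    rwa [ht2]
  | _ + 1, _, _, ⟨φ, c, h1, h2⟩, e => ⟨φ, c, h1, h2.congr e⟩

theorem Zk.congr : ∀ {k : ℕ} {f g : ℝ → ℝ}, Zk T k f →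
    g =ᵐ[volume.restrict (Set.Ioc 0 T)] f → Zk T k g
  | 0, _, _, h, e => by
    obtain ⟨h1, C, h2⟩ := h
    refine ⟨h1.congr e.symm, C, ?_⟩
    filter_upwards [h2, e] with t ht1 ht2
    rwa [ht2]
  | _ + 1, _, _, ⟨φ, h1, h2⟩, e => ⟨φ, h1, h2.congr e⟩

theorem Wk.mono {T' : ℝ} (h0 : 0 ≤ T') (hT : T' ≤ T) : ∀ {k : ℕ} {f : ℝ → ℝ}, Wk T k f → Wk T' k f
  | 0, _, ⟨h1, C, h2⟩ => ⟨h1.mono_measure (Measure.restrict_mono (Set.Ioc_subset_Ioc_right hT)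
      le_rfl), C, ae_mono (Measure.restrict_mono (Set.Ioc_subset_Ioc_right hT) le_rfl) h2⟩
  | _ + 1, _, ⟨φ, c, h1, h2⟩ => ⟨φ, c, h1.mono h0 hT, h2.mono h0 hT⟩

theorem Zk.mono {T' : ℝ} (h0 : 0 ≤ T') (hT : T' ≤ T) : ∀ {k : ℕ} {f : ℝ → ℝ}, Zk T k f → Zk T' k f
  | 0, _, ⟨h1, C, h2⟩ => ⟨h1.mono_measure (Measure.restrict_mono (Set.Ioc_subset_Ioc_right hT)
      le_rfl), C, ae_mono (Measure.restrict_mono (Set.Ioc_subset_Ioc_right hT) le_rfl) h2⟩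
  | _ + 1, _, ⟨φ, h1, h2⟩ => ⟨φ, h1.mono h0 hT, h2.mono h0 hT⟩

theorem abs_primitive_le (hb : ∃ C : ℝ, ∀ᵐ t ∂(volume.restrict (Set.Ioc 0 T)), |φ t| ≤ C) :
    ∃ C : ℝ, ∀ t ∈ Set.Icc 0 T, |∫ r in (0 : ℝ)..t, φ r| ≤ C * t := by
  obtain ⟨C, hC⟩ := hb
  refine ⟨C, fun t ht => ?_⟩
  have := intervalIntegral.norm_integral_le_of_norm_le_const_ae (a := 0) (b := t) (f := φ)
    (C := C) (by
      rw [ae_restrict_iff' measurableSet_Ioc] at hC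
      filter_upwards [hC] with r h1 h2
      rw [Set.uIoc_of_le ht.1] at h2
      exact h1 ⟨h2.1, h2.2.trans ht.2⟩)
  simpa [abs_of_nonneg ht.1] using this

theorem Zk.wk_zero (h : Zk T 0 f) : Wk T 0 f := by
  obtain ⟨h1, C, h2⟩ := h
  refine ⟨h1, |C| * T, ?_⟩
  filter_upwards [h2, ae_restrict_mem measurableSet_Ioc] with t h3 h4
  calc |f t| ≤ C * t := h3
    _ ≤ |C| * t := mul_le_mul_of_nonneg_right (le_abs_self C) h4.1.le
    _ ≤ |C| * T := mul_le_mul_of_nonneg_left h4.2 (abs_nonneg C)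

theorem Zk.wk : ∀ {k : ℕ} {f : ℝ → ℝ}, Zk T k f → Wk T k f
  | 0, _, h => h.wk_zero
  | _ + 1, _, ⟨φ, h1, h2⟩ => ⟨φ, 0, h1.wk, h2⟩

theorem zk_zero_of_primOn (hT : 0 ≤ T) (hφ : Wk T 0 φ) (h : PrimOn 0 T f φ 0) : Zk T 0 f := by
  obtain ⟨C, hC⟩ := abs_primitive_le hφ.2
  refine ⟨AEStronglyMeasurable.congr ?_ h.2.symm, C, ?_⟩
  · exact ((continuousOn_primitive hT h.1 0).mono Set.Ioc_subset_Icc_self).aestronglyMeasurable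
      measurableSet_Ioc
  · filter_upwards [h.2, ae_restrict_mem measurableSet_Ioc] with t h3 h4
    rw [h3]
    simpa using hC t ⟨h4.1.le, h4.2⟩

theorem wk_const (k : ℕ) (c : ℝ) : Wk T k fun _ => c := by
  induction k generalizing c with
  | zero => exact ⟨aestronglyMeasurable_const, |c|, by simp⟩
  | succ k ih => exact ⟨fun _ => 0, c, ih 0, primOn_const 0 T c⟩

theorem zk_zero (k : ℕ) : Zk T k fun _ => 0 := by
  induction k with
  | zero => exact ⟨aestronglyMeasurable_const, 0, by simp⟩
  | succ k ih => exact ⟨fun _ => 0, ih, primOn_const 0 T 0⟩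

theorem Wk.add (hT : 0 ≤ T) : ∀ {k : ℕ} {f g : ℝ → ℝ}, Wk T k f → Wk T k g →
    Wk T k fun t => f t + g t
  | 0, _, _, ⟨h1, C, h2⟩, ⟨h3, D, h4⟩ => by
    refine ⟨h1.add h3, C + D, ?_⟩
    filter_upwards [h2, h4] with t ht1 ht2
    exact (abs_add_le _ _).trans (add_le_add ht1 ht2)
  | _ + 1, _, _, ⟨φ, c, h1, h2⟩, ⟨ψ, d, h3, h4⟩ =>
    ⟨fun t => φ t + ψ t, c + d, h1.add hT h3, h2.add hT h4⟩

theorem Zk.add (hT : 0 ≤ T) : ∀ {k : ℕ} {f g : ℝ → ℝ}, Zk T k f → Zk T k g →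
    Zk T k fun t => f t + g t
  | 0, _, _, ⟨h1, C, h2⟩, ⟨h3, D, h4⟩ => by
    refine ⟨h1.add h3, C + D, ?_⟩
    filter_upwards [h2, h4] with t ht1 ht2
    rw [add_mul]
    exact (abs_add_le _ _).trans (add_le_add ht1 ht2)
  | _ + 1, _, _, ⟨φ, h1, h2⟩, ⟨ψ, h3, h4⟩ =>
    ⟨fun t => φ t + ψ t, h1.add hT h3, by simpa using h2.add hT h4⟩

theorem Wk.pred (hT : 0 ≤ T) : ∀ {k : ℕ} {f : ℝ → ℝ}, Wk T (k + 1) f → Wk T k f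
  | 0, _, ⟨φ, c, h1, h2⟩ => by
    refine (((wk_const 0 c).add hT (zk_zero_of_primOn hT h1 (f := fun t => ∫ r in (0 : ℝ)..t, φ r)
      ⟨h2.1, by simp [EventuallyEq]⟩).wk).congr h2.2)
  | _ + 1, _, ⟨φ, c, h1, h2⟩ => ⟨φ, c, h1.pred hT, h2⟩

theorem Zk.pred (hT : 0 ≤ T) : ∀ {k : ℕ} {f : ℝ → ℝ}, Zk T (k + 1) f → Zk T k f
  | 0, _, ⟨_, h1, h2⟩ => zk_zero_of_primOn hT h1.wk h2
  | _ + 1, _, ⟨φ, h1, h2⟩ => ⟨φ, h1.pred hT, h2⟩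

theorem Wk.le (hT : 0 ≤ T) {l : ℕ} (hl : l ≤ k) (h : Wk T k f) : Wk T l f := by
  induction k, hl using Nat.le_induction with
  | base => exact h
  | succ k _ ih => exact ih (h.pred hT)

theorem Zk.le (hT : 0 ≤ T) {l : ℕ} (hl : l ≤ k) (h : Zk T k f) : Zk T l f := by
  induction k, hl using Nat.le_induction with
  | base => exact h
  | succ k _ ih => exact ih (h.pred hT)

theorem Wk.mul (hT : 0 ≤ T) : ∀ {k : ℕ} {f g : ℝ → ℝ}, Wk T k f → Wk T k g →
    Wk T k fun t => f t * g t
  | 0, _, _, ⟨h1, C, h2⟩, ⟨h3, D, h4⟩ => by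
    refine ⟨h1.mul h3, C * D, ?_⟩
    filter_upwards [h2, h4] with t ht1 ht2
    rw [abs_mul]
    exact mul_le_mul ht1 ht2 (abs_nonneg _) ((abs_nonneg _).trans ht1)
  | k + 1, f, g, hf, hg => by
    have hf' := hf.pred hT
    have hg' := hg.pred hT
    obtain ⟨φ, c, h1, h2⟩ := hf
    obtain ⟨ψ, d, h3, h4⟩ := hg
    exact ⟨_, c * d, (h1.mul hT hg').add hT (hf'.mul hT h3), h2.mul hT h4⟩

theorem Zk.mul (hT : 0 ≤ T) : ∀ {k : ℕ} {f g : ℝ → ℝ}, Zk T k f → Wk T k g →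
    Zk T k fun t => f t * g t
  | 0, _, _, ⟨h1, C, h2⟩, ⟨h3, D, h4⟩ => by
    refine ⟨h1.mul h3, C * D, ?_⟩
    filter_upwards [h2, h4] with t ht1 ht2
    rw [abs_mul, mul_right_comm]
    exact mul_le_mul ht1 ht2 (abs_nonneg _) ((abs_nonneg _).trans ht1)
  | k + 1, f, g, hf, hg => by
    have hf' := hf.pred hT
    have hg' := hg.pred hT
    obtain ⟨φ, h1, h2⟩ := hf
    obtain ⟨ψ, d, h3, h4⟩ := hg
    refine ⟨_, (h1.mul hT hg').add hT (hf'.mul hT h3), ?_⟩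
    simpa using h2.mul hT h4

theorem Zk.mul' (hT : 0 ≤ T) (hf : Wk T k f) (hg : Zk T k g) : Zk T k fun t => f t * g t := by
  simpa only [mul_comm] using hg.mul hT hf

theorem Wk.const_mul (hT : 0 ≤ T) (a : ℝ) (hf : Wk T k f) : Wk T k fun t => a * f t :=
  (wk_const k a).mul hT hf

theorem Zk.const_mul (hT : 0 ≤ T) (a : ℝ) (hf : Zk T k f) : Zk T k fun t => a * f t :=
  Zk.mul' hT (wk_const k a) hf

theorem Wk.neg (hT : 0 ≤ T) (hf : Wk T k f) : Wk T k fun t => -f t := by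
  simpa using hf.const_mul hT (-1)

theorem Zk.neg (hT : 0 ≤ T) (hf : Zk T k f) : Zk T k fun t => -f t := by
  simpa using hf.const_mul hT (-1)

theorem Wk.sub (hT : 0 ≤ T) (hf : Wk T k f) (hg : Wk T k g) : Wk T k fun t => f t - g t := by
  simpa [sub_eq_add_neg] using hf.add hT (hg.neg hT)

theorem Zk.sub (hT : 0 ≤ T) (hf : Zk T k f) (hg : Zk T k g) : Zk T k fun t => f t - g t := by
  simpa [sub_eq_add_neg] using hf.add hT (hg.neg hT)

theorem Wk.sum {ι : Type*} (I : Finset ι) {f : ι → ℝ → ℝ} (hT : 0 ≤ T)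
    (h : ∀ i ∈ I, Wk T k (f i)) : Wk T k fun t => ∑ i ∈ I, f i t := by
  classical
  induction I using Finset.induction_on with
  | empty => simpa using wk_const k 0
  | insert a I ha ih =>
    simp only [Finset.sum_insert ha]
    exact (h a (by simp)).add hT (ih fun i hi => h i (by simp [hi]))

theorem Zk.sum {ι : Type*} (I : Finset ι) {f : ι → ℝ → ℝ} (hT : 0 ≤ T)
    (h : ∀ i ∈ I, Zk T k (f i)) : Zk T k fun t => ∑ i ∈ I, f i t := by
  classical
  induction I using Finset.induction_on with
  | empty => simpa using zk_zero k
  | insert a I ha ih =>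
    simp only [Finset.sum_insert ha]
    exact (h a (by simp)).add hT (ih fun i hi => h i (by simp [hi]))

theorem Wk.prod {ι : Type*} (I : Finset ι) {f : ι → ℝ → ℝ} (hT : 0 ≤ T)
    (h : ∀ i ∈ I, Wk T k (f i)) : Wk T k fun t => ∏ i ∈ I, f i t := by
  classical
  induction I using Finset.induction_on with
  | empty => simpa using wk_const k 1
  | insert a I ha ih =>
    simp only [Finset.prod_insert ha]
    exact (h a (by simp)).mul hT (ih fun i hi => h i (by simp [hi]))

theorem PrimOn.wk_succ {k : ℕ} (h : PrimOn 0 T f φ c) (hφ : Wk T k φ) : Wk T (k + 1) f :=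
  ⟨φ, c, hφ, h⟩

theorem PrimOn.sub_zk_zero (hT : 0 ≤ T) (h : PrimOn 0 T f φ c) (hφ : Wk T 0 φ) :
    Zk T 0 fun t => f t - c := by
  refine zk_zero_of_primOn hT hφ ?_
  simpa using h.sub hT (primOn_const 0 T c)

/-- A function which is `O(t)` is small near `0`. -/
theorem Zk.eventually_small (hT : 0 < T) (h : Zk T 0 f) {ε : ℝ} (hε : 0 < ε) :
    ∃ T' : ℝ, 0 < T' ∧ T' ≤ T ∧ ∀ᵐ t ∂(volume.restrict (Set.Ioc 0 T')), |f t| ≤ ε := by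
  obtain ⟨_, C, hC⟩ := h
  refine ⟨min T (ε / (|C| + 1)), lt_min hT (by positivity), min_le_left _ _, ?_⟩
  filter_upwards [ae_mono (Measure.restrict_mono
    (Set.Ioc_subset_Ioc_right (min_le_left T _)) le_rfl) hC,
    ae_restrict_mem measurableSet_Ioc] with t h1 h2
  have h6 : t ≤ ε / (|C| + 1) := h2.2.trans (min_le_right _ _)
  rw [le_div_iff₀ (by positivity)] at h6
  have h7 : C * t ≤ |C| * t := mul_le_mul_of_nonneg_right (le_abs_self _) h2.1.le
  nlinarith [h2.1]

theorem PrimOn.inv (hT : 0 < T) (h : PrimOn 0 T f φ c) {ε : ℝ} (hε : 0 < ε)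
    (hf : ∀ᵐ t ∂(volume.restrict (Set.Ioc 0 T)), ε ≤ f t) :
    PrimOn 0 T (fun t => (f t)⁻¹) (fun t => -(φ t) * ((f t)⁻¹ * (f t)⁻¹)) c⁻¹ := by
  have hF := absCont_primitive h.1 c
  have hcont := continuousOn_primitive hT.le h.1 c
  have hpos : ∀ t ∈ Set.Icc 0 T, ε ≤ c + ∫ r in (0 : ℝ)..t, φ r := by
    have h1 : (fun t => max ε (c + ∫ r in (0 : ℝ)..t, φ r))
        =ᵐ[volume.restrict (Set.Ioc 0 T)] fun t => c + ∫ r in (0 : ℝ)..t, φ r := by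
      filter_upwards [h.2, hf] with t h2 h3
      exact max_eq_right (h2 ▸ h3)
    intro t ht
    have := eqOn_of_ae_eq_of_continuousOn hT (continuousOn_const.sup hcont) hcont h1 ht
    exact max_eq_right_iff.1 this
  have hlip : LipschitzOnWith (Real.toNNReal (ε⁻¹ * ε⁻¹)) (fun x : ℝ => x⁻¹) (Set.Ici ε) := by
    refine LipschitzOnWith.of_dist_le_mul fun x hx y hy => ?_
    have hx0 : 0 < x := hε.trans_le hx
    have hy0 : 0 < y := hε.trans_le hy
    rw [Real.coe_toNNReal _ (by positivity), dist_inv_inv₀ hx0.ne' hy0.ne', Real.norm_eq_abs,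
      Real.norm_eq_abs, abs_of_pos hx0, abs_of_pos hy0, div_eq_mul_inv, mul_comm, mul_inv]
    have h1 : x⁻¹ ≤ ε⁻¹ := inv_anti₀ hε hx
    have h2 : y⁻¹ ≤ ε⁻¹ := inv_anti₀ hε hy
    gcongr
  have hAC : AbsolutelyContinuousOnInterval (fun t => (c + ∫ r in (0 : ℝ)..t, φ r)⁻¹) 0 T := by
    rw [absolutelyContinuousOnInterval_iff] at hF ⊢
    intro η hη
    obtain ⟨δ, hδ, hδ'⟩ := hF (η / (ε⁻¹ * ε⁻¹)) (by positivity)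
    refine ⟨δ, hδ, fun E hE hE' => ?_⟩
    have h1 := hδ' E hE hE'
    rw [lt_div_iff₀ (by positivity), mul_comm, Finset.mul_sum] at h1
    refine (Finset.sum_le_sum fun i hi => ?_).trans_lt h1
    have h2 := hE.1 i hi
    rw [Set.uIcc_of_le hT.le] at h2
    have h3 := hlip.dist_le_mul _ (hpos _ h2.1) _ (hpos _ h2.2)
    rwa [Real.coe_toNNReal _ (by positivity)] at h3
  have key := eq_primitive_of_ae_hasDerivAt hAC (φ := fun t => -(φ t) *
    ((c + ∫ r in (0 : ℝ)..t, φ r)⁻¹ * (c + ∫ r in (0 : ℝ)..t, φ r)⁻¹)) (by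
      filter_upwards [ae_hasDerivAt_primitive h.1 c] with t h1 h2
      have h3 := hpos t (by rwa [Set.uIcc_of_le hT.le] at h2)
      have h4 := (h1 h2).inv (hε.trans_le h3).ne'
      convert! h4 using 1
      field_simp)
  rw [Set.uIcc_of_le hT.le] at key
  have key2 := primOn_of_eq (c := c⁻¹) key.1 (f := fun t => (c + ∫ r in (0 : ℝ)..t, φ r)⁻¹)
    fun t ht => by simpa using key.2 t ht
  refine (key2.congr ?_).congr_deriv hT.le ?_
  · filter_upwards [h.2] with t h1
    rw [h1]
  · filter_upwards [h.2] with t h1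
    rw [h1]

theorem Wk.inv (hT : 0 < T) {ε : ℝ} (hε : 0 < ε) : ∀ {k : ℕ} {f : ℝ → ℝ}, Wk T k f →
    (∀ᵐ t ∂(volume.restrict (Set.Ioc 0 T)), ε ≤ f t) → Wk T k fun t => (f t)⁻¹
  | 0, f, ⟨h1, _, _⟩, h => by
    refine ⟨h1.aemeasurable.inv.aestronglyMeasurable, ε⁻¹, ?_⟩
    filter_upwards [h] with t ht
    rw [abs_of_nonneg (inv_nonneg.2 (hε.le.trans ht))]
    exact inv_anti₀ hε ht
  | k + 1, f, hf, h => by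
    have hi := (hf.pred hT.le).inv hT hε h
    obtain ⟨φ, c, h1, h2⟩ := hf
    exact ⟨_, c⁻¹, (h1.neg hT.le).mul hT.le (hi.mul hT.le hi), h2.inv hT hε h⟩

end Classes

/-! ### Matrix-valued functions -/

section MatrixValued

open Matrix

variable {l m n : Type*} {s T : ℝ} {k : ℕ}

/-- Entrywise version of `PrimOn`. -/
def PrimM (s T : ℝ) (F Φ : ℝ → Matrix m n ℝ) (C : Matrix m n ℝ) : Prop :=
  ∀ i j, PrimOn s T (fun t => F t i j) (fun t => Φ t i j) (C i j)

/-- Entrywise version of `Wk`. -/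
def WkM (T : ℝ) (k : ℕ) (F : ℝ → Matrix m n ℝ) : Prop := ∀ i j, Wk T k fun t => F t i j

/-- Entrywise version of `Zk`. -/
def ZkM (T : ℝ) (k : ℕ) (F : ℝ → Matrix m n ℝ) : Prop := ∀ i j, Zk T k fun t => F t i j

variable {F Φ : ℝ → Matrix l m ℝ} {G Ψ : ℝ → Matrix m n ℝ} {C : Matrix l m ℝ} {D : Matrix m n ℝ}
  {F' : ℝ → Matrix l m ℝ}

theorem PrimM.mul [Fintype m] (hsT : s ≤ T) (hF : PrimM s T F Φ C) (hG : PrimM s T G Ψ D) :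
    PrimM s T (fun t => F t * G t) (fun t => Φ t * G t + F t * Ψ t) (C * D) := by
  intro i j
  simp only [Matrix.mul_apply, Matrix.add_apply, ← Finset.sum_add_distrib]
  exact PrimOn.sum _ hsT fun k _ => (hF i k).mul hsT (hG k j)

theorem primM_const (s T : ℝ) (C : Matrix l m ℝ) : PrimM s T (fun _ => C) (fun _ => 0) C :=
  fun i j => primOn_const s T (C i j)

theorem PrimM.congr (h : PrimM s T F Φ C)
    (hf : F' =ᵐ[volume.restrict (Set.Ioc s T)] F) : PrimM s T F' Φ C := fun i j =>
  (h i j).congr (hf.mono fun _ ht => congrFun (congrFun ht i) j)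

theorem PrimM.congr_deriv (hsT : s ≤ T) (h : PrimM s T F Φ C)
    (hf : F' =ᵐ[volume.restrict (Set.Ioc s T)] Φ) : PrimM s T F F' C := fun i j =>
  (h i j).congr_deriv hsT (hf.mono fun _ ht => congrFun (congrFun ht i) j)

theorem PrimM.mono {T' : ℝ} (hs : s ≤ T') (hT : T' ≤ T) (h : PrimM s T F Φ C) :
    PrimM s T' F Φ C := fun i j => (h i j).mono hs hT

theorem PrimM.sub (hsT : s ≤ T) {C' : Matrix l m ℝ} {Φ' : ℝ → Matrix l m ℝ}
    (hF : PrimM s T F Φ C) (hG : PrimM s T F' Φ' C') :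
    PrimM s T (fun t => F t - F' t) (fun t => Φ t - Φ' t) (C - C') :=
  fun i j => (hF i j).sub hsT (hG i j)

theorem PrimM.add (hsT : s ≤ T) {C' : Matrix l m ℝ} {Φ' : ℝ → Matrix l m ℝ}
    (hF : PrimM s T F Φ C) (hG : PrimM s T F' Φ' C') :
    PrimM s T (fun t => F t + F' t) (fun t => Φ t + Φ' t) (C + C') :=
  fun i j => (hF i j).add hsT (hG i j)

theorem PrimM.unique [Finite l] [Finite m] (hsT : s < T) {C' : Matrix l m ℝ}
    (h : PrimM s T F Φ C) (h' : PrimM s T F F' C') :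
    C = C' ∧ Φ =ᵐ[volume.restrict (Set.Ioc s T)] F' := by
  refine ⟨by ext i j; exact ((h i j).unique hsT (h' i j)).1, ?_⟩
  have : ∀ᵐ t ∂(volume.restrict (Set.Ioc s T)), ∀ i j, Φ t i j = F' t i j := by
    rw [ae_all_iff]
    intro i
    rw [ae_all_iff]
    exact fun j => ((h i j).unique hsT (h' i j)).2
  filter_upwards [this] with t ht
  ext i j
  exact ht i j

theorem WkM.congr (h : WkM T k F) (hf : F' =ᵐ[volume.restrict (Set.Ioc 0 T)] F) : WkM T k F' :=
  fun i j => (h i j).congr (hf.mono fun _ ht => congrFun (congrFun ht i) j)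

theorem ZkM.congr (h : ZkM T k F) (hf : F' =ᵐ[volume.restrict (Set.Ioc 0 T)] F) : ZkM T k F' :=
  fun i j => (h i j).congr (hf.mono fun _ ht => congrFun (congrFun ht i) j)

theorem WkM.mono {T' : ℝ} (h0 : 0 ≤ T') (hT : T' ≤ T) (h : WkM T k F) : WkM T' k F :=
  fun i j => (h i j).mono h0 hT

theorem ZkM.mono {T' : ℝ} (h0 : 0 ≤ T') (hT : T' ≤ T) (h : ZkM T k F) : ZkM T' k F :=
  fun i j => (h i j).mono h0 hT

theorem WkM.le (hT : 0 ≤ T) {k' : ℕ} (hl : k' ≤ k) (h : WkM T k F) : WkM T k' F :=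
  fun i j => (h i j).le hT hl

theorem ZkM.le (hT : 0 ≤ T) {k' : ℕ} (hl : k' ≤ k) (h : ZkM T k F) : ZkM T k' F :=
  fun i j => (h i j).le hT hl

theorem ZkM.wkM (h : ZkM T k F) : WkM T k F := fun i j => (h i j).wk

theorem wkM_const (T : ℝ) (k : ℕ) (C : Matrix l m ℝ) : WkM T k fun _ => C :=
  fun i j => wk_const k (C i j)

theorem WkM.add (hT : 0 ≤ T) (h : WkM T k F) (h' : WkM T k F') : WkM T k fun t => F t + F' t :=
  fun i j => (h i j).add hT (h' i j)

theorem ZkM.add (hT : 0 ≤ T) (h : ZkM T k F) (h' : ZkM T k F') : ZkM T k fun t => F t + F' t :=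
  fun i j => (h i j).add hT (h' i j)

theorem WkM.sub (hT : 0 ≤ T) (h : WkM T k F) (h' : WkM T k F') : WkM T k fun t => F t - F' t :=
  fun i j => (h i j).sub hT (h' i j)

theorem ZkM.sub (hT : 0 ≤ T) (h : ZkM T k F) (h' : ZkM T k F') : ZkM T k fun t => F t - F' t :=
  fun i j => (h i j).sub hT (h' i j)

theorem WkM.neg (hT : 0 ≤ T) (h : WkM T k F) : WkM T k fun t => -F t :=
  fun i j => (h i j).neg hT

theorem ZkM.neg (hT : 0 ≤ T) (h : ZkM T k F) : ZkM T k fun t => -F t :=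
  fun i j => (h i j).neg hT

theorem WkM.mul [Fintype m] (hT : 0 ≤ T) (hF : WkM T k F) (hG : WkM T k G) :
    WkM T k fun t => F t * G t := by
  intro i j
  simp only [Matrix.mul_apply]
  exact Wk.sum _ hT fun p _ => (hF i p).mul hT (hG p j)

theorem ZkM.mul [Fintype m] (hT : 0 ≤ T) (hF : ZkM T k F) (hG : WkM T k G) :
    ZkM T k fun t => F t * G t := by
  intro i j
  simp only [Matrix.mul_apply]
  exact Zk.sum _ hT fun p _ => (hF i p).mul hT (hG p j)

theorem ZkM.mul' [Fintype m] (hT : 0 ≤ T) (hF : WkM T k F) (hG : ZkM T k G) :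
    ZkM T k fun t => F t * G t := by
  intro i j
  simp only [Matrix.mul_apply]
  exact Zk.sum _ hT fun p _ => Zk.mul' hT (hF i p) (hG p j)

theorem PrimM.wkM_succ (h : PrimM s T F Φ C) (hs : s = 0) (hΦ : WkM T k Φ) : WkM T (k + 1) F := by
  subst hs
  exact fun i j => (h i j).wk_succ (hΦ i j)

theorem PrimM.sub_zkM_zero (hT : 0 ≤ T) (h : PrimM 0 T F Φ C) (hΦ : WkM T 0 Φ) :
    ZkM T 0 fun t => F t - C := fun i j => (h i j).sub_zk_zero hT (hΦ i j)

/-- If the weak derivative of `F` lies in `ZkM T k` and `F` equals `C` at `0` then `F - C` lies in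
`ZkM T (k + 1)`. -/
theorem PrimM.sub_zkM_succ (hT : 0 < T) (h : PrimM 0 T F Φ C) (hΦ : ZkM T k Φ) :
    ZkM T (k + 1) fun t => F t - C := fun i j => by
  refine ⟨fun t => Φ t i j, hΦ i j, ?_⟩
  simpa using (h i j).sub hT.le (primOn_const 0 T (C i j))

theorem wk_det {n : Type*} [Fintype n] [DecidableEq n] {L : ℝ → Matrix n n ℝ} (hT : 0 ≤ T)
    (hL : WkM T k L) : Wk T k fun t => (L t).det := by
  simp only [Matrix.det_apply']
  exact Wk.sum _ hT fun σ _ => (Wk.prod _ hT fun i _ => hL _ _).const_mul hT _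

/-- A linear system with coefficients in `Wk` that is the identity at `0` can be solved in `Zk`. -/
theorem zk_of_linear_system {ι : Type*} [Fintype ι] [DecidableEq ι] (hT : 0 < T)
    {L : ℝ → Matrix ι ι ℝ} {f : ℝ → ι → ℝ} (hL : WkM T k L)
    (hL1 : ZkM T 0 fun t => L t - 1) (hr : ∀ i, Zk T k fun t => (L t *ᵥ f t) i) :
    ∃ T' : ℝ, 0 < T' ∧ T' ≤ T ∧ ∀ i, Zk T' k fun t => f t i := by
  obtain ⟨δ, hδ, hdet⟩ : ∃ δ > 0, ∀ M : Matrix ι ι ℝ, (∀ i j, |(M - 1) i j| < δ) →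
      1 / 2 ≤ M.det := by
    have hc : Continuous fun M : ι → ι → ℝ => (Matrix.of M).det :=
      Continuous.matrix_det continuous_id
    have h1 : ∀ᶠ M : ι → ι → ℝ in 𝓝 (fun i j => (1 : Matrix ι ι ℝ) i j),
        1 / 2 < (Matrix.of M).det := by
      refine hc.continuousAt.eventually (lt_mem_nhds ?_)
      change 1 / 2 < (1 : Matrix ι ι ℝ).det
      rw [Matrix.det_one]
      norm_num
    obtain ⟨δ, hδ, h2⟩ := Metric.eventually_nhds_iff.1 h1
    refine ⟨δ, hδ, fun M hM => (h2 (y := fun i j => M i j) ?_).le⟩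
    rw [dist_pi_lt_iff hδ]
    intro i
    rw [dist_pi_lt_iff hδ]
    exact fun j => hM i j
  have hsmall : ∀ i j, ∃ T' : ℝ, 0 < T' ∧ T' ≤ T ∧
      ∀ᵐ t ∂(volume.restrict (Set.Ioc 0 T')), |(L t - 1) i j| ≤ δ / 2 :=
    fun i j => (hL1 i j).eventually_small hT (half_pos hδ)
  choose T₁ hT₁ hT₁' hT₁'' using hsmall
  obtain ⟨T', hT', hT'T, hT'1⟩ : ∃ T' : ℝ, 0 < T' ∧ T' ≤ T ∧ ∀ i j, T' ≤ T₁ i j := by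
    obtain ⟨ε, hε', hε⟩ := ((eventually_all.2 fun p : ι × ι => Ioo_mem_nhdsGT
      (hT₁ p.1 p.2)).and (self_mem_nhdsWithin (s := Set.Ioi (0 : ℝ)))).exists
    exact ⟨min ε T, lt_min hε hT, min_le_right _ _,
      fun i j => (min_le_left _ _).trans (hε' (i, j)).2.le⟩
  have hd : ∀ᵐ t ∂(volume.restrict (Set.Ioc 0 T')), 1 / 2 ≤ (L t).det := by
    have : ∀ᵐ t ∂(volume.restrict (Set.Ioc 0 T')), ∀ i j, |(L t - 1) i j| ≤ δ / 2 := by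
      rw [ae_all_iff]
      intro i
      rw [ae_all_iff]
      exact fun j => ae_mono (Measure.restrict_mono (Set.Ioc_subset_Ioc_right (hT'1 i j)) le_rfl)
        (hT₁'' i j)
    filter_upwards [this] with t ht
    exact hdet _ fun i j => (ht i j).trans_lt (half_lt_self hδ)
  have hL' := hL.mono hT'.le hT'T
  have hdi : Wk T' k fun t => ((L t).det)⁻¹ := (wk_det hT'.le hL').inv hT' (by norm_num) hd
  have hadj : WkM T' k fun t => (L t).adjugate := by
    intro i j
    simp only [Matrix.adjugate_apply]
    refine wk_det hT'.le fun p q => ?_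
    simp only [Matrix.updateRow_apply]
    split_ifs
    · exact wk_const _ _
    · exact hL' _ _
  refine ⟨T', hT', hT'T, fun i => Zk.congr (f := fun t => ∑ j,
    (((L t).det)⁻¹ * (L t).adjugate i j) * (L t *ᵥ f t) j) (Zk.sum _ hT'.le fun j _ =>
      Zk.mul' hT'.le (hdi.mul hT'.le (hadj i j)) ((hr j).mono hT'.le hT'T)) ?_⟩
  filter_upwards [hd] with t ht
  have h0 : (L t).det ≠ 0 := by linarith
  have h1 : f t = ((L t).det)⁻¹ • ((L t).adjugate *ᵥ (L t *ᵥ f t)) := by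
    rw [Matrix.mulVec_mulVec, Matrix.adjugate_mul, Matrix.smul_mulVec, Matrix.one_mulVec, smul_smul,
      inv_mul_cancel₀ h0, one_smul]
  conv_lhs => rw [h1]
  simp only [Pi.smul_apply, smul_eq_mul, Matrix.mulVec, dotProduct, Finset.mul_sum, mul_assoc]

end MatrixValued

/-! ### Linear Carathéodory equations -/

section LinearODE

open Matrix

variable {n : Type*} [Fintype n] {s T : ℝ}

/-- A row vector that solves `x' = x A` in integral form does so with integrable right-hand side,
so that the integrals are genuine. -/
theorem intervalIntegrable_of_row_equation {A : ℝ → Matrix n n ℝ} {x : ℝ → n → ℝ} {c : n → ℝ}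
    {CA : ℝ} (hsT : s ≤ T) (hA : ∀ i j, Measurable fun t => A t i j)
    (hCA : ∀ t ∈ Set.Icc s T, ∀ i j, |A t i j| ≤ CA) (hsmall : Fintype.card n * CA * (T - s) ≤ 1 / 2)
    (hCA0 : 0 ≤ CA) (hc : ∀ j, |c j| ≤ 1)
    (hx : ∀ t ∈ Set.Icc s T, ∀ j, x t j = c j + ∫ r in s..t, (x r ᵥ* A r) j) (j : n) :
    IntervalIntegrable (fun r => (x r ᵥ* A r) j) volume s T := by
  have of_bdd : ∀ t ∈ Set.Icc s T, (∀ k, AEStronglyMeasurable (fun r => x r k)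
      (volume.restrict (Set.Ioc s t)) ∧ ∃ C : ℝ, ∀ r ∈ Set.Ioc s t, |x r k| ≤ C) →
      ∀ j, IntervalIntegrable (fun r => (x r ᵥ* A r) j) volume s t := by
    intro t ht h j
    rw [intervalIntegrable_iff_integrableOn_Ioc_of_le ht.1]
    simp only [Matrix.vecMul, dotProduct]
    refine integrable_finsetSum _ fun k _ => ?_
    obtain ⟨h1, C, h2⟩ := h k
    refine Integrable.of_bound (h1.mul (hA k j).aestronglyMeasurable) (C * CA) ?_
    filter_upwards [ae_restrict_mem measurableSet_Ioc] with r hr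
    rw [Real.norm_eq_abs, abs_mul]
    exact mul_le_mul (h2 r hr) (hCA r ⟨hr.1.le, hr.2.trans ht.2⟩ k j) (abs_nonneg _)
      ((abs_nonneg _).trans (h2 r hr))
  have cont : ∀ t ∈ Set.Icc s T, ∀ k, IntervalIntegrable (fun r => (x r ᵥ* A r) k) volume s t →
      ContinuousOn (fun r => x r k) (Set.Icc s t) := fun t ht k h =>
    (continuousOn_primitive ht.1 h (c k)).congr fun r hr => hx r ⟨hr.1, hr.2.trans ht.2⟩ k
  have bdd : ∀ t ∈ Set.Icc s T, (∀ k, IntervalIntegrable (fun r => (x r ᵥ* A r) k) volume s t) →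
      ∀ r ∈ Set.Icc s t, ∀ k, |x r k| ≤ 2 := by
    intro t ht h
    have hc' : ContinuousOn (fun r => ‖x r‖) (Set.Icc s t) :=
      (continuousOn_pi.2 fun k => cont t ht k (h k)).norm
    obtain ⟨r₀, hr₀, hmax⟩ := isCompact_Icc.exists_isMaxOn (Set.nonempty_Icc.2 ht.1) hc'
    have hle : ∀ r ∈ Set.Icc s t, ‖x r‖ ≤ ‖x r₀‖ := fun r hr => hmax hr
    have hb : ‖x r₀‖ ≤ 1 + ‖x r₀‖ / 2 := by
      refine (pi_norm_le_iff_of_nonneg (by positivity)).2 fun k => ?_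
      rw [hx r₀ ⟨hr₀.1, hr₀.2.trans ht.2⟩ k]
      refine (norm_add_le _ _).trans (add_le_add (hc k) ?_)
      have h1 : ∀ r ∈ Set.uIoc s r₀, ‖(x r ᵥ* A r) k‖ ≤ Fintype.card n * (‖x r₀‖ * CA) := by
        intro r hr
        rw [Set.uIoc_of_le hr₀.1] at hr
        simp only [Matrix.vecMul, dotProduct]
        refine (norm_sum_le _ _).trans ?_
        refine (Finset.sum_le_card_nsmul _ _ (‖x r₀‖ * CA) fun l _ => ?_).trans (by simp)
        rw [norm_mul]
        exact mul_le_mul ((norm_le_pi_norm (x r) l).trans (hle r ⟨hr.1.le, hr.2.trans hr₀.2⟩))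
          (hCA r ⟨hr.1.le, hr.2.trans (hr₀.2.trans ht.2)⟩ l k) (abs_nonneg _) (norm_nonneg _)
      refine (intervalIntegral.norm_integral_le_of_norm_le_const h1).trans ?_
      rw [abs_of_nonneg (sub_nonneg.2 hr₀.1)]
      calc _ ≤ Fintype.card n * (‖x r₀‖ * CA) * (T - s) := by
            refine mul_le_mul_of_nonneg_left ?_ (by positivity)
            linarith [hr₀.2, ht.2]
        _ = ‖x r₀‖ * (Fintype.card n * CA * (T - s)) := by ring
        _ ≤ ‖x r₀‖ * (1 / 2) := mul_le_mul_of_nonneg_left hsmall (norm_nonneg _)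
        _ = _ := by ring
    intro r hr k
    have := (norm_le_pi_norm (x r) k).trans (hle r hr)
    rw [Real.norm_eq_abs] at this
    linarith
  set S : Set ℝ := {t ∈ Set.Icc s T | ∀ k, IntervalIntegrable (fun r => (x r ᵥ* A r) k) volume s t}
    with hS
  have hsS : s ∈ S := ⟨Set.left_mem_Icc.2 hsT, fun k => by simp⟩
  have hSb : BddAbove S := ⟨T, fun t ht => ht.1.2⟩
  set t₁ := sSup S with ht₁
  have h1 : t₁ ∈ Set.Icc s T := ⟨le_csSup hSb hsS, csSup_le ⟨s, hsS⟩ fun t ht => ht.1.2⟩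
  have hlt : ∀ r, s ≤ r → r < t₁ → r ∈ S := fun r hr hr' => by
    obtain ⟨t, ht, hrt⟩ := exists_lt_of_lt_csSup ⟨s, hsS⟩ hr'
    refine ⟨⟨hr, hrt.le.trans ht.1.2⟩, fun k => (ht.2 k).mono_set ?_⟩
    rw [Set.uIcc_of_le hr, Set.uIcc_of_le ht.1.1]
    exact Set.Icc_subset_Icc_right hrt.le
  have h1S : ∀ k, IntervalIntegrable (fun r => (x r ᵥ* A r) k) volume s t₁ := by
    refine of_bdd t₁ h1 fun k => ?_
    have hb : ∀ r ∈ Set.Ico s t₁, |x r k| ≤ 2 := fun r hr =>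
      bdd r (hlt r hr.1 hr.2).1 (hlt r hr.1 hr.2).2 r (Set.right_mem_Icc.2 hr.1) k
    have hco : ContinuousOn (fun r => x r k) (Set.Ioo s t₁) := fun r hr => by
      obtain ⟨r', hr', hr''⟩ := exists_between hr.2
      exact ((cont r' (hlt r' (hr.1.trans hr').le hr'').1 k
        ((hlt r' (hr.1.trans hr').le hr'').2 k)).continuousAt
          (Icc_mem_nhds hr.1 hr')).continuousWithinAt
    constructor
    · rw [← restrict_Ioo_eq_restrict_Ioc]
      exact hco.aestronglyMeasurable measurableSet_Ioo
    · refine ⟨max 2 |x t₁ k|, fun r hr => ?_⟩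
      rcases hr.2.lt_or_eq with h | h
      · exact (hb r ⟨hr.1.le, h⟩).trans (le_max_left _ _)
      · rw [h]; exact le_max_right _ _
  rcases h1.2.lt_or_eq with hlt' | heq
  swap
  · rw [← heq]; exact h1S j
  exfalso
  have hk : ∀ k, ∃ t' : ℝ, t₁ < t' ∧ t' ≤ T ∧ AEStronglyMeasurable (fun r => x r k)
      (volume.restrict (Set.Ioc s t')) ∧ ∃ C : ℝ, ∀ r ∈ Set.Ioc s t', |x r k| ≤ C := by
    intro k
    by_cases h : ∃ t', t₁ < t' ∧ t' ≤ T ∧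
        IntervalIntegrable (fun r => (x r ᵥ* A r) k) volume s t'
    · obtain ⟨t', ht', ht'T, hi⟩ := h
      have hc' := cont t' ⟨h1.1.trans ht'.le, ht'T⟩ k hi
      refine ⟨t', ht', ht'T, (hc'.mono Set.Ioc_subset_Icc_self).aestronglyMeasurable
        measurableSet_Ioc, ?_⟩
      obtain ⟨C, hC⟩ := isCompact_Icc.exists_bound_of_continuousOn hc'
      exact ⟨C, fun r hr => hC r ⟨hr.1.le, hr.2⟩⟩
    · have hval : ∀ r ∈ Set.Ioc t₁ T, x r k = c k := fun r hr => by
        rw [hx r ⟨h1.1.trans hr.1.le, hr.2⟩ k, intervalIntegral.integral_undef, add_zero]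
        exact fun hi => h ⟨r, hr.1, hr.2, hi⟩
      refine ⟨T, hlt', le_rfl, ?_, max 2 |c k|, fun r hr => ?_⟩
      · rw [← Set.Ioc_union_Ioc_eq_Ioc h1.1 h1.2, aestronglyMeasurable_union_iff]
        refine ⟨((cont t₁ h1 k (h1S k)).mono Set.Ioc_subset_Icc_self).aestronglyMeasurable
          measurableSet_Ioc, (aestronglyMeasurable_const (b := c k)).congr ?_⟩
        filter_upwards [ae_restrict_mem measurableSet_Ioc] with r hr using (hval r hr).symm
      · rcases le_or_gt r t₁ with h' | h'
        · exact (bdd t₁ h1 h1S r ⟨hr.1.le, h'⟩ k).trans (le_max_left _ _)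
        · rw [hval r ⟨h', hr.2⟩]; exact le_max_right _ _
  choose t' ht' ht'T hmeas hbd using hk
  obtain ⟨t₂, ht₂, ht₂'⟩ := ((eventually_all.2 fun k => Ioo_mem_nhdsGT (ht' k)).and
    (Ioo_mem_nhdsGT hlt')).exists
  have h2 : t₂ ∈ Set.Icc s T := ⟨h1.1.trans ht₂'.1.le, ht₂'.2.le⟩
  have : t₂ ∈ S := by
    refine ⟨h2, of_bdd t₂ h2 fun k => ⟨(hmeas k).mono_measure (Measure.restrict_mono
      (Set.Ioc_subset_Ioc_right (ht₂ k).2.le) le_rfl), ?_⟩⟩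
    obtain ⟨C, hC⟩ := hbd k
    exact ⟨C, fun r hr => hC r ⟨hr.1, hr.2.trans (ht₂ k).2.le⟩⟩
  exact absurd (le_csSup hSb this) (not_le.2 ht₂'.1)

/-- Short-time existence for linear Carathéodory equations with bounded coefficients. -/
theorem exists_linear_solution {L : ℝ → Matrix n n ℝ} {f : ℝ → n → ℝ} {C : ℝ} (hT : 0 ≤ T)
    (hL : ∀ i j, Measurable fun t => L t i j) (hLC : ∀ t ∈ Set.Icc 0 T, ∀ i j, |L t i j| ≤ C)
    (hC : 0 ≤ C) (hsmall : Fintype.card n * C * T ≤ 1 / 2)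
    (hf : ∀ i, IntervalIntegrable (fun t => f t i) volume 0 T) (x₀ : n → ℝ) :
    ∃ x : ℝ → n → ℝ, Continuous x ∧
      (∀ i, IntervalIntegrable (fun r => (L r *ᵥ x r) i + f r i) volume 0 T) ∧
      ∀ t ∈ Set.Icc 0 T, ∀ i, x t i = x₀ i + ∫ r in (0 : ℝ)..t, ((L r *ᵥ x r) i + f r i) := by
  have integ : ∀ (x : ℝ → n → ℝ), Continuous x → ∀ i,
      IntervalIntegrable (fun r => (L r *ᵥ x r) i) volume 0 T := by
    intro x hx i
    rw [intervalIntegrable_iff_integrableOn_Ioc_of_le hT]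
    simp only [Matrix.mulVec, dotProduct]
    refine integrable_finsetSum _ fun k _ => ?_
    obtain ⟨D, hD⟩ := isCompact_Icc.exists_bound_of_continuousOn (s := Set.Icc 0 T)
      ((continuous_apply k).comp hx).continuousOn
    refine Integrable.of_bound ((hL i k).aestronglyMeasurable.mul
      ((continuous_apply k).comp hx).aestronglyMeasurable) (C * D) ?_
    filter_upwards [ae_restrict_mem measurableSet_Ioc] with r hr
    rw [norm_mul]
    exact mul_le_mul (hLC r ⟨hr.1.le, hr.2⟩ i k) (hD r ⟨hr.1.le, hr.2⟩) (norm_nonneg _) hC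
  have hext : ∀ x : C(Set.Icc (0 : ℝ) T, n → ℝ), Continuous (Set.IccExtend hT x) := fun x =>
    x.continuous.Icc_extend'
  let F : C(Set.Icc (0 : ℝ) T, n → ℝ) → C(Set.Icc (0 : ℝ) T, n → ℝ) := fun x =>
    ⟨fun t i => x₀ i + ∫ r in (0 : ℝ)..t, ((L r *ᵥ Set.IccExtend hT x r) i + f r i), by
      refine continuous_pi fun i => ?_
      have := continuousOn_primitive hT ((integ _ (hext x) i).add (hf i)) (x₀ i)
      exact continuousOn_iff_continuous_domRestrict.1 this⟩
  have hF : ContractingWith (1 / 2) F := by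
    refine ⟨by rw [← NNReal.coe_lt_coe]; norm_num, LipschitzWith.of_dist_le_mul fun x y => ?_⟩
    refine (ContinuousMap.dist_le (by positivity)).2 fun t => ?_
    refine (dist_pi_le_iff (by positivity)).2 fun i => ?_
    have hsub : Set.uIcc (0 : ℝ) t ⊆ Set.uIcc 0 T := by
      rw [Set.uIcc_of_le t.2.1, Set.uIcc_of_le hT]; exact Set.Icc_subset_Icc_right t.2.2
    have h1 : F x t i - F y t i = ∫ r in (0 : ℝ)..t,
        (L r *ᵥ (Set.IccExtend hT x r - Set.IccExtend hT y r)) i := by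
      change (x₀ i + _) - (x₀ i + _) = _
      rw [add_sub_add_left_eq_sub, ← intervalIntegral.integral_sub
        (((integ _ (hext x) i).add (hf i)).mono_set hsub)
        (((integ _ (hext y) i).add (hf i)).mono_set hsub)]
      simp [Matrix.mulVec_sub]
    rw [Real.dist_eq, h1, ← Real.norm_eq_abs]
    refine (intervalIntegral.norm_integral_le_of_norm_le_const
      (C := Fintype.card n * (C * dist x y)) fun r hr => ?_).trans ?_
    · rw [Set.uIoc_of_le t.2.1] at hr
      simp only [Matrix.mulVec, dotProduct]
      refine (norm_sum_le _ _).trans ?_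
      refine (Finset.sum_le_card_nsmul _ _ (C * dist x y) fun l _ => ?_).trans (by simp)
      rw [norm_mul]
      refine mul_le_mul (hLC r ⟨hr.1.le, hr.2.trans t.2.2⟩ i l) ?_ (norm_nonneg _) hC
      refine (norm_le_pi_norm (Set.IccExtend hT x r - Set.IccExtend hT y r) l).trans ?_
      rw [← dist_eq_norm]
      exact ContinuousMap.dist_apply_le_dist _
    · rw [sub_zero, abs_of_nonneg t.2.1]
      calc _ ≤ Fintype.card n * (C * dist x y) * T :=
            mul_le_mul_of_nonneg_left t.2.2 (by positivity)
        _ = Fintype.card n * C * T * dist x y := by ring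
        _ ≤ _ := mul_le_mul_of_nonneg_right (by simpa using hsmall) dist_nonneg
  have : Nonempty C(Set.Icc (0 : ℝ) T, n → ℝ) := ⟨0⟩
  set z := hF.fixedPoint with hz
  refine ⟨Set.IccExtend hT z, hext z, fun i => (integ _ (hext z) i).add (hf i), fun t ht i => ?_⟩
  have h1 : F z = z := hF.fixedPoint_isFixedPt
  have h2 : Set.IccExtend hT z t = z ⟨t, ht⟩ := Set.IccExtend_of_mem hT _ ht
  rw [h2]
  conv_lhs => rw [← h1]
  rfl

/-- Short-time existence of the fundamental matrix of `F' = L F`. -/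
theorem exists_fundamental_matrix [DecidableEq n] {L : ℝ → Matrix n n ℝ} {C : ℝ} (hT : 0 ≤ T)
    (hL : ∀ i j, Measurable fun t => L t i j) (hLC : ∀ t ∈ Set.Icc 0 T, ∀ i j, |L t i j| ≤ C)
    (hC : 0 ≤ C) (hsmall : Fintype.card n * C * T ≤ 1 / 2) :
    ∃ F : ℝ → Matrix n n ℝ, (∀ i j, Continuous fun t => F t i j) ∧ F 0 = 1 ∧
      PrimM 0 T F (fun t => L t * F t) 1 := by
  have := fun j => exists_linear_solution hT hL hLC hC hsmall (f := fun _ _ => 0) (by simp)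
    ((1 : Matrix n n ℝ).col j)
  choose x hx hi he using this
  simp only [add_zero] at hi he
  refine ⟨fun t => Matrix.of fun i j => x j t i, fun i j => (continuous_apply i).comp (hx j), ?_,
    fun i j => primOn_of_eq ?_ fun t ht => ?_⟩
  · ext i j
    simpa using he j 0 (Set.left_mem_Icc.2 hT) i
  · exact hi j i
  · exact he j t ht i

end LinearODE

/-! ### Transition matrices -/

section Transition

open Matrix

theorem PrimOn.eq_on {s T c : ℝ} {f φ : ℝ → ℝ} (hsT : s < T) (h : PrimOn s T f φ c)
    (hc : ContinuousOn f (Set.Icc s T)) : ∀ t ∈ Set.Icc s T, f t = c + ∫ r in s..t, φ r :=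
  eqOn_of_ae_eq_of_continuousOn hsT hc (continuousOn_primitive hsT.le h.1 c) h.2

theorem PrimOn.tail {s T c t : ℝ} {f φ : ℝ → ℝ} (hsT : s < T) (h : PrimOn s T f φ c)
    (hc : ContinuousOn f (Set.Icc s T)) (ht : t ∈ Set.Icc s T) : PrimOn t T f φ (f t) := by
  have hsub : Set.uIcc s t ⊆ Set.uIcc s T := by
    rw [Set.uIcc_of_le ht.1, Set.uIcc_of_le hsT.le]; exact Set.Icc_subset_Icc_right ht.2
  have hi : ∀ r ∈ Set.Icc t T, IntervalIntegrable φ volume t r := fun r hr => h.1.mono_set (by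
    rw [Set.uIcc_of_le hr.1, Set.uIcc_of_le hsT.le]; exact Set.Icc_subset_Icc ht.1 hr.2)
  refine primOn_of_eq (hi T (Set.right_mem_Icc.2 ht.2)) fun r hr => ?_
  rw [h.eq_on hsT hc r ⟨ht.1.trans hr.1, hr.2⟩, h.eq_on hsT hc t ht, add_assoc,
    intervalIntegral.integral_add_adjacent_intervals (h.1.mono_set hsub) (hi r hr)]

variable {n : Type*} [Fintype n]

/-- A solution of `Z' = -A Z` inverts every solution of `Y' = Y A`. -/
theorem PrimM.mul_eq_of_inverse {A Y Z : ℝ → Matrix n n ℝ} {C D : Matrix n n ℝ} {s τ : ℝ}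
    (hs : s ≤ τ)
    (hY : PrimM s τ Y (fun t => Y t * A t) C) (hYc : ∀ i j, ContinuousOn (fun t => Y t i j) (Set.Icc s τ))
    (hY0 : Y s = C)
    (hZ : PrimM s τ Z (fun t => -A t * Z t) D) (hZc : ∀ i j, ContinuousOn (fun t => Z t i j) (Set.Icc s τ))
    (hZ0 : Z s = D) :
    ∀ t ∈ Set.Icc s τ, Y t * Z t = C * D := by
  rcases hs.eq_or_lt with h | h
  · intro t ht
    have : t = s := le_antisymm (ht.2.trans h.ge) ht.1
    rw [this, hY0, hZ0]
  intro t ht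
  ext i j
  refine PrimOn.eq_of_deriv_zero h ((hY.mul hs hZ) i j) (Eventually.of_forall fun r => ?_) ?_ t ht
  · simp [Matrix.mul_assoc]
  · simp only [Matrix.mul_apply]
    exact continuousOn_finsetSum _ fun k _ => (hYc i k).mul (hZc k j)

variable [DecidableEq n]

/-- The one-parameter group generated by a matrix. -/
def expM (A : Matrix n n ℝ) (t : ℝ) : Matrix n n ℝ := NormedSpace.exp (t • A)

theorem expM_zero (A : Matrix n n ℝ) : expM A 0 = 1 := by simp [expM]

theorem expM_add (A : Matrix n n ℝ) (s t : ℝ) : expM A (s + t) = expM A s * expM A t := by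
  rw [expM, add_smul, Matrix.exp_add_of_commute _ _ (((Commute.refl A).smul_left s).smul_right t)]
  rfl

theorem expM_mul_neg (A : Matrix n n ℝ) (t : ℝ) : expM A t * expM A (-t) = 1 := by
  rw [← expM_add, add_neg_cancel, expM_zero]

theorem expM_neg (A : Matrix n n ℝ) (t : ℝ) : expM (-A) t = expM A (-t) := by
  simp [expM]

theorem expM_neg_mul (A : Matrix n n ℝ) (t : ℝ) : expM A (-t) * expM A t = 1 := by
  rw [← expM_add, neg_add_cancel, expM_zero]

section

attribute [local instance] Matrix.linftyOpNormedRing Matrix.linftyOpNormedAlgebra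

theorem hasDerivAt_expM (A : Matrix n n ℝ) (t : ℝ) (i j : n) :
    HasDerivAt (fun t => expM A t i j) ((A * expM A t) i j) t := by
  have h := hasDerivAt_exp_smul_const' A t
  have h2 := (LinearMap.toContinuousLinearMap
    (Matrix.entryLinearMap ℝ ℝ i j)).hasFDerivAt.comp_hasDerivAt t h
  exact h2

end

theorem expM_comm (A : Matrix n n ℝ) (t : ℝ) : expM A t * A = A * expM A t :=
  (((Commute.refl A).smul_left t).exp_left).eq

theorem continuous_expM (A : Matrix n n ℝ) (i j : n) : Continuous fun t => expM A t i j :=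
  continuous_iff_continuousAt.2 fun t => (hasDerivAt_expM A t i j).continuousAt

theorem primM_expM (A : Matrix n n ℝ) (s T : ℝ) :
    PrimM s T (expM A) (fun t => A * expM A t) (expM A s) := fun i j => by
  have hc : Continuous fun t => (A * expM A t) i j := by
    simp only [Matrix.mul_apply]
    exact continuous_finsetSum _ fun k _ => (continuous_expM A k j).const_mul _
  refine primOn_of_eq (hc.intervalIntegrable _ _) fun t ht => ?_
  rw [intervalIntegral.integral_eq_sub_of_hasDerivAt (fun r _ => hasDerivAt_expM A r i j)
    (hc.intervalIntegrable _ _)]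
  ring

theorem primM_expM_neg (A : Matrix n n ℝ) (s T : ℝ) :
    PrimM s T (fun t => expM A (-t)) (fun t => -A * expM A (-t)) (expM A (-s)) := by
  simpa only [← expM_neg] using primM_expM (-A) s T

theorem wkM_expM (A : Matrix n n ℝ) {T : ℝ} (hT : 0 ≤ T) (k : ℕ) : WkM T k (expM A) := by
  induction k with
  | zero => exact WkM.le hT (Nat.zero_le 1) ((primM_expM A 0 T).wkM_succ rfl (k := 0) (by
      refine fun i j => ?_
      have hc : Continuous fun t => (A * expM A t) i j := by
        simp only [Matrix.mul_apply]
        exact continuous_finsetSum _ fun k _ => (continuous_expM A k j).const_mul _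
      obtain ⟨C, hC⟩ := isCompact_Icc.exists_bound_of_continuousOn (s := Set.Icc 0 T)
        hc.continuousOn
      refine ⟨hc.aestronglyMeasurable, C, ?_⟩
      filter_upwards [ae_restrict_mem measurableSet_Ioc] with r hr using hC r ⟨hr.1.le, hr.2⟩))
  | succ k ih => exact (primM_expM A 0 T).wkM_succ rfl ((wkM_const T k A).mul hT ih)

variable {N : ℕ} {A : ℝ → Matrix (Fin N) (Fin N) ℝ} {X : ℝ → ℝ → Matrix (Fin N) (Fin N) ℝ}
  {T CA : ℝ}

theorem primM_of_isTransition (hX : IsTransition A X) (hA : ∀ i j, Measurable fun t => A t i j)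
    (hCA : ∀ t, 0 ≤ t → ∀ i j, |A t i j| ≤ CA) (hCA0 : 0 ≤ CA) (hsmall : N * CA * T ≤ 1 / 2)
    {s : ℝ} (hs : 0 ≤ s) (hsT : s ≤ T) :
    PrimM s T (fun t => X t s) (fun t => X t s * A t) 1 ∧
      ∀ i j, ContinuousOn (fun t => X t s i j) (Set.Icc s T) := by
  have heq : ∀ t i j, X t s i j = (1 : Matrix (Fin N) (Fin N) ℝ) i j +
      ∫ r in s..t, (X r s * A r) i j := fun t i j => by
    conv_lhs => rw [hX s t]
    rfl
  have hint : ∀ i j, IntervalIntegrable (fun r => (X r s * A r) i j) volume s T := fun i j => by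
    refine intervalIntegrable_of_row_equation (x := fun r => X r s i) (CA := CA)
      (c := fun j => (1 : Matrix (Fin N) (Fin N) ℝ) i j) hsT hA
      (fun t ht => hCA t (hs.trans ht.1)) ?_ hCA0 (fun j => ?_) (fun t _ j => heq t i j) j
    · rw [Fintype.card_fin]
      refine le_trans (mul_le_mul_of_nonneg_left ?_ (by positivity)) hsmall
      linarith
    · rw [Matrix.one_apply]; split_ifs <;> simp
  exact ⟨fun i j => primOn_of_eq (hint i j) fun t _ => heq t i j, fun i j =>
    (continuousOn_primitive hsT (hint i j) _).congr fun t _ => heq t i j⟩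

theorem isTransition_self (hX : IsTransition A X) (s : ℝ) : X s s = 1 := by
  rw [hX s s]
  ext i j
  simp

/-- A transition matrix is determined by any solution of `Z' = -A Z`. -/
theorem isTransition_mul_eq (hX : IsTransition A X) (hA : ∀ i j, Measurable fun t => A t i j)
    (hCA : ∀ t, 0 ≤ t → ∀ i j, |A t i j| ≤ CA) (hCA0 : 0 ≤ CA) (hsmall : N * CA * T ≤ 1 / 2)
    {Z : ℝ → Matrix (Fin N) (Fin N) ℝ} {D : Matrix (Fin N) (Fin N) ℝ} (hT : 0 < T)
    (hZ : PrimM 0 T Z (fun t => -A t * Z t) D) (hZc : ∀ i j, Continuous (fun t => Z t i j))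
    {s τ : ℝ} (hs : 0 ≤ s) (hsτ : s ≤ τ) (hτ : τ ≤ T) : X τ s * Z τ = Z s := by
  obtain ⟨h1, h2⟩ := primM_of_isTransition hX hA hCA hCA0 hsmall hs (hsτ.trans hτ)
  have := PrimM.mul_eq_of_inverse (hsτ.trans hτ) h1 h2 (isTransition_self hX s) (D := Z s)
    (fun i j => (hZ i j).tail hT (hZc i j).continuousOn ⟨hs, hsτ.trans hτ⟩)
    (fun i j => (hZc i j).continuousOn) rfl τ ⟨hsτ, hτ⟩
  simpa using this

theorem isTransition_eq_expM {A₀ : Matrix (Fin N) (Fin N) ℝ} (hX : IsTransition (fun _ => A₀) X)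
    (hCA : ∀ i j, |A₀ i j| ≤ CA) (hCA0 : 0 ≤ CA) (hsmall : N * CA * T ≤ 1 / 2)
    (hT : 0 < T) {s τ : ℝ} (hs : 0 ≤ s) (hsτ : s ≤ τ) (hτ : τ ≤ T) :
    X τ s = expM A₀ (τ - s) := by
  have h := isTransition_mul_eq hX (fun _ _ => measurable_const) (fun _ _ => hCA) hCA0 hsmall hT
    (primM_expM_neg A₀ 0 T) (fun i j => (continuous_expM A₀ i j).comp continuous_neg)
    hs hsτ hτ
  rw [← Matrix.mul_one (X τ s), ← expM_neg_mul A₀ τ, ← Matrix.mul_assoc, h, ← expM_add]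
  congr 1
  ring

end Transition

/-! ### Weak derivatives of the switching functions -/

section Switching

open Matrix

variable {τ : ℝ} {f : ℝ → ℝ} {m i : ℕ}

theorem primOn_iteratedDerivWithin_of_absContOn (hτ : 0 < τ)
    (h : AbsContOn (iteratedDerivWithin i f (Set.Icc 0 τ)) 0 τ) :
    PrimOn 0 τ (iteratedDerivWithin i f (Set.Icc 0 τ)) (iteratedDerivWithin (i + 1) f (Set.Icc 0 τ))
      (iteratedDerivWithin i f (Set.Icc 0 τ) 0) := by
  obtain ⟨φ, hφ, he⟩ := h
  have h1 := primOn_of_eq hφ he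
  refine h1.congr_deriv hτ.le ?_
  rw [← restrict_Ioo_eq_restrict_Ioc, EventuallyEq, ae_restrict_iff' measurableSet_Ioo]
  filter_upwards [ae_hasDerivAt_primitive hφ (iteratedDerivWithin i f (Set.Icc 0 τ) 0)] with t ht ht'
  have hm : t ∈ Set.uIcc 0 τ := by
    rw [Set.uIcc_of_le hτ.le]; exact Set.Ioo_subset_Icc_self ht'
  rw [iteratedDerivWithin_succ, derivWithin_of_mem_nhds (Icc_mem_nhds ht'.1 ht'.2)]
  refine ((ht hm).congr_of_eventuallyEq ?_).deriv
  filter_upwards [Icc_mem_nhds ht'.1 ht'.2] with r hr using he r hr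

theorem primOn_iteratedDerivWithin_of_contDiffOn (hτ : 0 < τ)
    (h : ContDiffOn ℝ m f (Set.Icc 0 τ)) (hi : i < m) :
    PrimOn 0 τ (iteratedDerivWithin i f (Set.Icc 0 τ)) (iteratedDerivWithin (i + 1) f (Set.Icc 0 τ))
      (iteratedDerivWithin i f (Set.Icc 0 τ) 0) := by
  have hu := uniqueDiffOn_Icc hτ
  have hint : IntervalIntegrable (iteratedDerivWithin (i + 1) f (Set.Icc 0 τ)) volume 0 τ := by
    refine ContinuousOn.intervalIntegrable ?_
    rw [Set.uIcc_of_le hτ.le]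
    exact h.continuousOn_iteratedDerivWithin (by exact_mod_cast hi) hu
  refine primOn_of_eq hint fun t ht => ?_
  have hsub : Set.Icc 0 t ⊆ Set.Icc 0 τ := Set.Icc_subset_Icc_right ht.2
  rw [intervalIntegral.integral_eq_sub_of_hasDerivAt_of_le ht.1
    ((h.continuousOn_iteratedDerivWithin (by exact_mod_cast hi.le) hu).mono hsub)
    (fun r hr => ?_) (hint.mono_set (by rwa [Set.uIcc_of_le ht.1, Set.uIcc_of_le hτ.le]))]
  · ring
  · have hr' : Set.Icc 0 τ ∈ 𝓝 r := Icc_mem_nhds hr.1 (hr.2.trans_le ht.2)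
    have hd := (h.differentiableOn_iteratedDerivWithin (by exact_mod_cast hi) hu) r
      (mem_of_mem_nhds hr')
    rw [iteratedDerivWithin_succ]
    exact hd.hasDerivWithinAt.hasDerivAt hr'

/-- Two functions whose derivatives up to order `m + 1` agree up to `O(t)` differ by an element
of `Zk σ (m + 1)`. -/
theorem zk_sub_of_close {g : ℝ → ℝ} {σ K : ℝ} (hσ : 0 < σ) (hστ : σ ≤ τ)
    (hf : ContDiffOn ℝ m f (Set.Icc 0 τ))
    (hf' : AbsContOn (iteratedDerivWithin m f (Set.Icc 0 τ)) 0 τ)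
    (hg : ContDiffOn ℝ (m + 1 : ℕ) g (Set.Icc 0 τ))
    (hK : ∀ i < m + 2, ∀ t, 0 ≤ t → t ≤ σ → |iteratedDerivWithin i f (Set.Icc 0 τ) t
      - iteratedDerivWithin i g (Set.Icc 0 τ) t| ≤ K * t) :
    Zk σ (m + 1) fun t => f t - g t := by
  have hτ := hσ.trans_le hστ
  have hp : ∀ i ≤ m, PrimOn 0 σ (fun t => iteratedDerivWithin i f (Set.Icc 0 τ) t
      - iteratedDerivWithin i g (Set.Icc 0 τ) t) (fun t => iteratedDerivWithin (i + 1) f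
        (Set.Icc 0 τ) t - iteratedDerivWithin (i + 1) g (Set.Icc 0 τ) t) 0 := by
    intro i hi
    have h0 : iteratedDerivWithin i f (Set.Icc 0 τ) 0
      - iteratedDerivWithin i g (Set.Icc 0 τ) 0 = 0 := by
      simpa using hK i (by lia) 0 le_rfl hσ.le
    have hpf : PrimOn 0 τ (iteratedDerivWithin i f (Set.Icc 0 τ))
        (iteratedDerivWithin (i + 1) f (Set.Icc 0 τ)) (iteratedDerivWithin i f (Set.Icc 0 τ) 0) := by
      rcases hi.lt_or_eq with h | h
      · exact primOn_iteratedDerivWithin_of_contDiffOn hτ hf h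
      · subst h
        exact primOn_iteratedDerivWithin_of_absContOn hτ hf'
    have := (hpf.sub hτ.le (primOn_iteratedDerivWithin_of_contDiffOn hτ hg
      (Nat.lt_succ_of_le hi))).mono hσ.le hστ
    rwa [h0] at this
  have key : ∀ k ≤ m + 1, Zk σ k fun t => iteratedDerivWithin (m + 1 - k) f (Set.Icc 0 τ) t
      - iteratedDerivWithin (m + 1 - k) g (Set.Icc 0 τ) t := by
    intro k
    induction k with
    | zero =>
      intro _
      refine ⟨((intervalIntegrable_iff_integrableOn_Ioc_of_le hσ.le).1
        (hp m le_rfl).1).aestronglyMeasurable, K, ?_⟩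
      filter_upwards [ae_restrict_mem measurableSet_Ioc] with t ht
      exact hK (m + 1) (by lia) t ht.1.le ht.2
    | succ k ih =>
      intro hk
      refine ⟨_, ih (by lia), ?_⟩
      have h := hp (m + 1 - (k + 1)) (by lia)
      rwa [show m + 1 - (k + 1) + 1 = m + 1 - k by lia] at h
  simpa using key (m + 1) le_rfl

theorem contDiff_expM {n : Type*} [Fintype n] [DecidableEq n] (A : Matrix n n ℝ) (k : ℕ) :
    ∀ i j, ContDiff ℝ k fun t => expM A t i j := by
  induction k with
  | zero => exact fun i j => contDiff_zero.2 (continuous_expM A i j)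
  | succ k ih =>
    intro i j
    rw [Nat.cast_succ, contDiff_succ_iff_deriv]
    refine ⟨fun t => (hasDerivAt_expM A t i j).differentiableAt, by simp, ?_⟩
    rw [show deriv (fun t => expM A t i j) = fun t => (A * expM A t) i j from
      funext fun t => (hasDerivAt_expM A t i j).deriv]
    simp only [Matrix.mul_apply]
    exact ContDiff.sum fun l _ => contDiff_const.mul (ih l j)

theorem euNorm_single {N : ℕ} (i : Fin N) : euNorm (Pi.single i (1 : ℝ)) = 1 := by
  simp [euNorm, Pi.single_apply]

theorem euDot_single {N : ℕ} (i : Fin N) (x : Fin N → ℝ) :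
    euDot (Pi.single i (1 : ℝ)) x = x i := by
  simp [euDot, Pi.single_apply]

end Switching

/-! ### Regularity of the coefficients -/

section Regularity

open Matrix

variable {n : Type*} [Fintype n] [DecidableEq n]

/-- A fundamental system `Y' = Y A` with inverse `Yi`, together with a column `b` whose propagated
versions `Yi t * Y τ * b t` agree with those of the frozen system to order `m + 1`. -/
structure ColumnData (m : ℕ) (T₁ : ℝ) (A Y Yi : ℝ → Matrix n n ℝ) (b : ℝ → Matrix n Unit ℝ)
    (A₀ : Matrix n n ℝ) (b₀ : Matrix n Unit ℝ) : Prop where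
  pos : 0 < T₁
  coeff : WkM T₁ 0 A
  fund : WkM T₁ 0 Y
  inv : WkM T₁ 0 Yi
  fund_prim : PrimM 0 T₁ Y (fun t => Y t * A t) 1
  inv_prim : PrimM 0 T₁ Yi (fun t => -A t * Yi t) 1
  fund_zero : Y 0 = 1
  fund_cont : ∀ i j, ContinuousOn (fun t => Y t i j) (Set.Icc 0 T₁)
  mul_inv : ∀ t ∈ Set.Icc 0 T₁, Y t * Yi t = 1
  close : ∀ τ ∈ Set.Ioc 0 T₁, ∃ σ ∈ Set.Ioc 0 τ,
    ZkM σ (m + 1) fun t => Yi t * Y τ * b t - expM A₀ (τ - t) * b₀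
  fund_mul : ∀ τ ∈ Set.Ioc 0 T₁, Y τ * b₀ = expM A₀ τ * b₀
  kalman : ∀ f : Matrix n Unit ℝ →ₗ[ℝ] ℝ, (∀ i : ℕ, f (A₀ ^ i * b₀) = 0) → f = 0

theorem wkM_expM_neg (A : Matrix n n ℝ) {T : ℝ} (hT : 0 ≤ T) (k : ℕ) :
    WkM T k fun t => expM A (-t) := by
  simpa only [← expM_neg] using wkM_expM (-A) hT k

theorem primM_expM_sub (A : Matrix n n ℝ) (τ T : ℝ) :
    PrimM 0 T (fun t => expM A (τ - t)) (fun t => -A * expM A (τ - t)) (expM A τ) := by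
  intro i j
  have h : Continuous fun t => (-A * expM A (τ - t)) i j := by
    simp only [Matrix.mul_apply]
    exact continuous_finsetSum _ fun k _ =>
      ((continuous_expM A k j).comp (continuous_const.sub continuous_id)).const_mul _
  refine primOn_of_eq (h.intervalIntegrable _ _) fun t _ => ?_
  have hd : ∀ r ∈ Set.uIcc 0 t, HasDerivAt (fun t => expM A (τ - t) i j)
      ((-A * expM A (τ - r)) i j) r := fun r _ => by
    simpa using (hasDerivAt_expM A (τ - r) i j).comp_const_sub τ r
  rw [intervalIntegral.integral_eq_sub_of_hasDerivAt hd (h.intervalIntegrable _ _), sub_zero]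
  ring

theorem ZkM.exists_primM {l m : Type*} {T : ℝ} {k : ℕ} {F : ℝ → Matrix l m ℝ}
    (h : ZkM T (k + 1) F) : ∃ Φ, ZkM T k Φ ∧ PrimM 0 T F Φ 0 := by
  choose Φ h1 h2 using h
  exact ⟨fun t => Matrix.of fun i j => Φ i j t, h1, h2⟩

theorem WkM.exists_primM {l m : Type*} {T : ℝ} {k : ℕ} {F : ℝ → Matrix l m ℝ}
    (h : WkM T (k + 1) F) : ∃ Φ C, WkM T k Φ ∧ PrimM 0 T F Φ C := by
  choose Φ C h1 h2 using h
  exact ⟨fun t => Matrix.of fun i j => Φ i j t, Matrix.of C, h1, h2⟩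

namespace ColumnData

variable {m : ℕ} {T₁ : ℝ} {A Y Yi : ℝ → Matrix n n ℝ} {b : ℝ → Matrix n Unit ℝ}
  {A₀ : Matrix n n ℝ} {b₀ : Matrix n Unit ℝ}

theorem inv_mul (h : ColumnData m T₁ A Y Yi b A₀ b₀) {t : ℝ} (ht : t ∈ Set.Icc 0 T₁) :
    Yi t * Y t = 1 := mul_eq_one_comm.1 (h.mul_inv t ht)

theorem col_eq (h : ColumnData m T₁ A Y Yi b A₀ b₀) {τ t : ℝ} (hτ : τ ∈ Set.Ioc 0 T₁)
    (ht : t ∈ Set.Icc 0 T₁) : b t = Yi τ * (Y t * (expM A₀ (τ - t) * b₀ +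
      (Yi t * Y τ * b t - expM A₀ (τ - t) * b₀))) := by
  rw [add_sub_cancel, ← Matrix.mul_assoc, ← Matrix.mul_assoc, ← Matrix.mul_assoc,
    Matrix.mul_assoc (Yi τ), h.mul_inv t ht, Matrix.mul_one, h.inv_mul ⟨hτ.1.le, hτ.2⟩,
    Matrix.one_mul]

/-- The column `b` is as regular as the fundamental matrix. -/
theorem wkM_col (h : ColumnData m T₁ A Y Yi b A₀ b₀) : ∃ σ ∈ Set.Ioc 0 T₁, ∀ T ∈ Set.Ioc 0 σ,
    ∀ k ≤ m + 1, WkM T k Y → WkM T k b := by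
  have hτ : T₁ ∈ Set.Ioc 0 T₁ := ⟨h.pos, le_rfl⟩
  obtain ⟨σ, hσ, hZ⟩ := h.close T₁ hτ
  refine ⟨σ, hσ, fun T hT k hk hY => ?_⟩
  have h0 := hT.1.le
  have hE : WkM T k fun t => expM A₀ (T₁ - t) * b₀ := by
    simp only [sub_eq_add_neg, expM_add]
    exact ((wkM_const T k _).mul h0 (wkM_expM_neg A₀ h0 k)).mul h0 (wkM_const T k _)
  refine ((wkM_const T k (Yi T₁)).mul h0 (hY.mul h0 (hE.add h0
    ((hZ.mono h0 hT.2).le h0 hk).wkM))).congr ?_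
  filter_upwards [ae_restrict_mem measurableSet_Ioc] with t ht
  exact h.col_eq hτ ⟨ht.1.le, ht.2.trans (hT.2.trans hσ.2)⟩

theorem wkM_fund_succ (h : ColumnData m T₁ A Y Yi b A₀ b₀) {T : ℝ} (hT : T ∈ Set.Ioc 0 T₁) {k : ℕ}
    (hA : WkM T k A) : WkM T (k + 1) Y ∧ WkM T (k + 1) Yi := by
  have h0 := hT.1.le
  have key : ∀ l ≤ k + 1, WkM T l Y ∧ WkM T l Yi := by
    intro l
    induction l with
    | zero => exact fun _ => ⟨h.fund.mono h0 hT.2, h.inv.mono h0 hT.2⟩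
    | succ l ih =>
      intro hl
      obtain ⟨h1, h2⟩ := ih (by lia)
      have hA' := hA.le h0 (show l ≤ k by lia)
      exact ⟨(h.fund_prim.mono h0 hT.2).wkM_succ rfl (h1.mul h0 hA'),
        (h.inv_prim.mono h0 hT.2).wkM_succ rfl ((hA'.neg h0).mul h0 h2)⟩
  exact key _ le_rfl

theorem exists_col_deriv (h : ColumnData m T₁ A Y Yi b A₀ b₀) :
    ∃ σ ∈ Set.Ioc 0 T₁, ∃ β, WkM σ 0 β ∧ PrimM 0 σ b β b₀ := by
  have hτ : T₁ ∈ Set.Ioc 0 T₁ := ⟨h.pos, le_rfl⟩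
  obtain ⟨σ₁, hσ₁, hb⟩ := h.wkM_col
  obtain ⟨σ₂, hσ₂, hZ⟩ := h.close T₁ hτ
  set σ := min σ₁ σ₂
  have hσ : σ ∈ Set.Ioc 0 T₁ := ⟨lt_min hσ₁.1 hσ₂.1, (min_le_left _ _).trans hσ₁.2⟩
  have h0 := hσ.1.le
  have hA := h.coeff.mono h0 hσ.2
  obtain ⟨β, c, hβ, hp⟩ := (hb σ ⟨hσ.1, min_le_left _ _⟩ 1 (by lia)
    (h.wkM_fund_succ hσ hA).1).exists_primM
  refine ⟨σ, hσ, β, hβ, ?_⟩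
  obtain ⟨δ, -, hδ⟩ := (hZ.mono h0 (min_le_right _ _)).exists_primM
  have hE := (primM_expM_sub A₀ T₁ σ).mul h0 (primM_const 0 σ b₀)
  have h2 := (primM_const 0 σ (Yi T₁)).mul h0
    ((h.fund_prim.mono h0 hσ.2).mul h0 (hE.add h0 hδ))
  have h3 := (h2.congr (F' := b) (by
    filter_upwards [ae_restrict_mem measurableSet_Ioc] with t ht
    exact h.col_eq hτ ⟨ht.1.le, ht.2.trans hσ.2⟩)).unique hσ.1 hp
  rw [← h3.1, add_zero, Matrix.one_mul, ← h.fund_mul _ hτ, ← Matrix.mul_assoc,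
    h.inv_mul ⟨h.pos.le, le_rfl⟩, Matrix.one_mul] at hp
  exact hp

/-- The matrices `Q` for which `(A - A₀) Yi Q b - Yi Q b'` is small form a subspace. -/
def smallSubmodule (m : ℕ) (T₁ : ℝ) (A Yi : ℝ → Matrix n n ℝ) (b β : ℝ → Matrix n Unit ℝ)
    (A₀ : Matrix n n ℝ) (hT₁ : 0 < T₁) : Submodule ℝ (Matrix n n ℝ) where
  carrier := {Q | ∃ T ∈ Set.Ioc 0 T₁,
    ZkM T m fun t => (A t - A₀) * (Yi t * (Q * b t)) - Yi t * (Q * β t)}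
  zero_mem' := ⟨T₁, ⟨hT₁, le_rfl⟩, fun i j => by simpa using zk_zero m⟩
  add_mem' := by
    rintro Q R ⟨T, hT, hQ⟩ ⟨T', hT', hR⟩
    have h0 : 0 < min T T' := lt_min hT.1 hT'.1
    refine ⟨min T T', ⟨h0, (min_le_left _ _).trans hT.2⟩, ?_⟩
    have := (hQ.mono h0.le (min_le_left _ _)).add h0.le (hR.mono h0.le (min_le_right _ _))
    convert this using 2 with t
    simp only [Matrix.add_mul, Matrix.mul_add]
    abel
  smul_mem' := by
    rintro c Q ⟨T, hT, hQ⟩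
    refine ⟨T, hT, ?_⟩
    intro i j
    convert (hQ i j).const_mul hT.1.le c using 2 with t
    simp [Matrix.smul_mul, Matrix.mul_smul, mul_sub]

theorem fund_mem_smallSubmodule (h : ColumnData m T₁ A Y Yi b A₀ b₀) {σ : ℝ}
    (hσ : σ ∈ Set.Ioc 0 T₁) {β : ℝ → Matrix n Unit ℝ} (hβ : PrimM 0 σ b β b₀) {τ : ℝ}
    (hτ : τ ∈ Set.Ioc 0 T₁) : Y τ ∈ smallSubmodule m T₁ A Yi b β A₀ h.pos := by
  obtain ⟨σ', hσ', hZ⟩ := h.close τ hτ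
  have hT : min σ σ' ∈ Set.Ioc 0 T₁ := ⟨lt_min hσ.1 hσ'.1, (min_le_left _ _).trans hσ.2⟩
  set T := min σ σ'
  have h0 := hT.1.le
  have hZT := hZ.mono h0 (min_le_right _ _)
  obtain ⟨δ, hδ, hδ'⟩ := hZT.exists_primM
  have hL := ((h.inv_prim.mono h0 hT.2).mul h0 (primM_const 0 T (Y τ))).mul h0
    (hβ.mono h0 (min_le_left _ _))
  have hR := (hL.sub h0 ((primM_expM_sub A₀ τ T).mul h0 (primM_const 0 T b₀)))
  have he := (hR.unique hT.1 hδ').2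
  refine ⟨T, hT, (((ZkM.mul' h0 (wkM_const T m A₀) (hZT.le h0 (Nat.le_succ m))).add h0 hδ).neg
    h0).congr ?_⟩
  filter_upwards [he] with t ht
  rw [← ht]
  simp only [Matrix.mul_zero, add_zero, Matrix.neg_mul, Matrix.sub_mul, Matrix.mul_sub,
    Matrix.mul_assoc]
  abel

theorem one_mem_smallSubmodule (h : ColumnData m T₁ A Y Yi b A₀ b₀) {σ : ℝ}
    (hσ : σ ∈ Set.Ioc 0 T₁) {β : ℝ → Matrix n Unit ℝ} (hβ : PrimM 0 σ b β b₀) :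
    (1 : Matrix n n ℝ) ∈ smallSubmodule m T₁ A Yi b β A₀ h.pos := by
  have hc : IsClosed (smallSubmodule m T₁ A Yi b β A₀ h.pos : Set (Matrix n n ℝ)) :=
    Submodule.closed_of_finiteDimensional _
  have ht : Tendsto Y (𝓝[>] 0) (𝓝 1) := by
    rw [← h.fund_zero]
    refine tendsto_pi_nhds.2 fun i => tendsto_pi_nhds.2 fun j => ?_
    refine ((h.fund_cont i j) 0 (Set.left_mem_Icc.2 h.pos.le)).mono_left ?_
    rw [← nhdsWithin_Ioc_eq_nhdsGT h.pos]
    exact nhdsWithin_mono _ Set.Ioc_subset_Icc_self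
  refine hc.mem_of_tendsto ht ?_
  filter_upwards [Ioc_mem_nhdsGT h.pos] with τ hτ
  exact h.fund_mem_smallSubmodule hσ hβ hτ

theorem exists_mem_smallSubmodule (h : ColumnData m T₁ A Y Yi b A₀ b₀) {σ : ℝ}
    (hσ : σ ∈ Set.Ioc 0 T₁) {β : ℝ → Matrix n Unit ℝ} (hβ : PrimM 0 σ b β b₀)
    (v : Matrix n Unit ℝ) :
    ∃ Q ∈ smallSubmodule m T₁ A Yi b β A₀ h.pos, Q * b₀ = v := by
  let V : Submodule ℝ (Matrix n Unit ℝ) := (smallSubmodule m T₁ A Yi b β A₀ h.pos).map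
    (mulRightLinearMap n ℝ b₀)
  suffices hV : V = ⊤ by
    have : v ∈ V := hV ▸ Submodule.mem_top
    obtain ⟨Q, hQ, hQv⟩ := this
    exact ⟨Q, hQ, hQv⟩
  by_contra hV
  obtain ⟨f, hf, hVf⟩ := Submodule.exists_le_ker_of_lt_top V (lt_top_iff_ne_top.2 hV)
  refine hf (h.kalman f ?_)
  have hd : ∀ (i : ℕ) (t : ℝ), HasDerivAt (fun t => f (A₀ ^ i * expM A₀ t * b₀))
      (f (A₀ ^ (i + 1) * expM A₀ t * b₀)) t := by
    intro i t
    have he : ∀ M : Matrix n Unit ℝ, f M = ∑ k, M k () * f (Matrix.single k () 1) := by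
      intro M
      conv_lhs => rw [Matrix.matrix_eq_sum_single M]
      simp only [map_sum, Finset.univ_unique, Finset.sum_singleton]
      refine Finset.sum_congr rfl fun k _ => ?_
      rw [show Matrix.single k (default : Unit) (M k default) = M k () • Matrix.single k () 1 by
        simp [Matrix.smul_single], map_smul, smul_eq_mul]
    rw [funext fun t => he (A₀ ^ i * expM A₀ t * b₀), he]
    refine HasDerivAt.fun_sum fun k _ => HasDerivAt.mul_const ?_ _
    have h1 : ∀ l, HasDerivAt (fun t => (A₀ ^ i * expM A₀ t) k l)
        ((A₀ ^ (i + 1) * expM A₀ t) k l) t := fun l =>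
      ((HasDerivAt.fun_sum (u := Finset.univ) fun p _ =>
        (hasDerivAt_expM A₀ t p l).const_mul ((A₀ ^ i) k p)).congr_deriv
        (by rw [pow_succ, Matrix.mul_assoc, Matrix.mul_apply])).congr_of_eventuallyEq
        (Eventually.of_forall fun t => Matrix.mul_apply)
    exact ((HasDerivAt.fun_sum (u := Finset.univ) fun l _ => (h1 l).mul_const
      (b₀ l ())).congr_deriv (by rw [Matrix.mul_apply])).congr_of_eventuallyEq
        (Eventually.of_forall fun t => Matrix.mul_apply)
  have hz : ∀ i : ℕ, ∀ t ∈ Set.Ioo 0 T₁, f (A₀ ^ i * expM A₀ t * b₀) = 0 := by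
    intro i
    induction i with
    | zero =>
      intro t ht
      refine hVf ⟨Y t, h.fund_mem_smallSubmodule hσ hβ ⟨ht.1, ht.2.le⟩, ?_⟩
      simpa using h.fund_mul t ⟨ht.1, ht.2.le⟩
    | succ i ih =>
      intro t ht
      refine (hd i t).unique ((hasDerivAt_const t (0 : ℝ)).congr_of_eventuallyEq ?_)
      filter_upwards [Ioo_mem_nhds ht.1 ht.2] with r hr using ih r hr
  intro i
  have h1 : Tendsto (fun t => f (A₀ ^ i * expM A₀ t * b₀)) (𝓝[>] 0)
      (𝓝 (f (A₀ ^ i * expM A₀ 0 * b₀))) := (hd i 0).continuousAt.mono_left nhdsWithin_le_nhds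
  rw [expM_zero, Matrix.mul_one] at h1
  refine tendsto_nhds_unique h1 (tendsto_const_nhds.congr' ?_)
  filter_upwards [Ioo_mem_nhdsGT h.pos] with t ht using (hz i t ht).symm

end ColumnData
end Regularity

section Bootstrap

open Matrix

variable {n : Type*} [Fintype n] [DecidableEq n]

theorem ZkM.mul_sub_mul {l m p : Type*} [Fintype m] {T : ℝ} (h0 : 0 ≤ T)
    {F : ℝ → Matrix l m ℝ} {G : ℝ → Matrix m p ℝ} {C : Matrix l m ℝ} {D : Matrix m p ℝ}
    (hF : ZkM T 0 fun t => F t - C) (hG : ZkM T 0 fun t => G t - D) :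
    ZkM T 0 fun t => F t * G t - C * D := by
  have hGW : WkM T 0 G := by simpa using hG.wkM.add h0 (wkM_const T 0 D)
  convert (hF.mul h0 hGW).add h0 (ZkM.mul' h0 (wkM_const T 0 C) hG) using 2 with t
  simp only [Matrix.sub_mul, Matrix.mul_sub]
  abel

namespace ColumnData

variable {m : ℕ} {T₁ : ℝ} {A Y Yi : ℝ → Matrix n n ℝ} {b : ℝ → Matrix n Unit ℝ}
  {A₀ : Matrix n n ℝ} {b₀ : Matrix n Unit ℝ}

theorem fund_expM_prim (h : ColumnData m T₁ A Y Yi b A₀ b₀) {T : ℝ} (hT : T ∈ Set.Ioc 0 T₁) :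
    PrimM 0 T (fun t => Y t * expM A₀ (-t)) (fun t => Y t * (A t - A₀) * expM A₀ (-t)) 1 := by
  have h0 := hT.1.le
  have := (h.fund_prim.mono h0 hT.2).mul h0 (primM_expM_neg A₀ 0 T)
  rw [neg_zero, expM_zero, Matrix.mul_one] at this
  refine this.congr_deriv h0 (Eventually.of_forall fun t => ?_)
  simp only [Matrix.mul_sub, Matrix.sub_mul, Matrix.neg_mul, Matrix.mul_neg, Matrix.mul_assoc]
  abel

theorem sub_mul_col_eq (h : ColumnData m T₁ A Y Yi b A₀ b₀) {T : ℝ} (hT : T ∈ Set.Ioc 0 T₁) :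
    (fun t => (A t - A₀) * b₀) =ᵐ[volume.restrict (Set.Ioc 0 T)]
      fun t => -(Yi t) * ((Y t * expM A₀ (-t) - 1) * (expM A₀ t * (A₀ * b₀))) := by
  have h0 := hT.1.le
  have h1 := (h.fund_prim.mono h0 hT.2).mul h0 (primM_const 0 T b₀)
  have h2 := (primM_expM A₀ 0 T).mul h0 (primM_const 0 T b₀)
  have h3 := (h1.unique hT.1 (h2.congr (by
    filter_upwards [ae_restrict_mem measurableSet_Ioc] with t ht
    exact h.fund_mul t ⟨ht.1, ht.2.trans hT.2⟩))).2
  filter_upwards [h3, ae_restrict_mem measurableSet_Ioc] with t ht ht'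
  have hi := h.inv_mul (t := t) ⟨ht'.1.le, ht'.2.trans hT.2⟩
  simp only [Matrix.mul_zero, add_zero, ← expM_comm] at ht
  have h4 : A t * b₀ = Yi t * (expM A₀ t * (A₀ * b₀)) := by
    rw [← Matrix.mul_assoc (expM A₀ t), ← ht, ← Matrix.mul_assoc, ← Matrix.mul_assoc, hi,
      Matrix.one_mul]
  have h5 : A₀ * b₀ = Yi t * (Y t * (expM A₀ (-t) * (expM A₀ t * (A₀ * b₀)))) := by
    rw [← Matrix.mul_assoc (expM A₀ (-t)), expM_neg_mul, Matrix.one_mul, ← Matrix.mul_assoc, hi,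
      Matrix.one_mul]
  rw [Matrix.sub_mul, h4]
  conv_lhs => arg 2; rw [h5]
  simp only [Matrix.sub_mul, Matrix.neg_mul, Matrix.one_mul, Matrix.mul_sub, Matrix.mul_assoc]
  abel

theorem zkM_sub_mul_col (h : ColumnData m T₁ A Y Yi b A₀ b₀) {T : ℝ} (hT : T ∈ Set.Ioc 0 T₁)
    {k : ℕ} (hV : ZkM T k fun t => Y t * expM A₀ (-t) - 1) (hYi : WkM T k Yi) :
    ZkM T k fun t => (A t - A₀) * b₀ :=
  have h0 := hT.1.le
  ZkM.congr (ZkM.mul' h0 (hYi.neg h0) (hV.mul h0 ((wkM_expM A₀ h0 k).mul h0 (wkM_const T k _))))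
    (h.sub_mul_col_eq hT)

/-- One step of the bootstrap: the regularity of `Y`, `Yi`, `b` and of `(A - A₀) b₀` passes to
`A - A₀`. -/
theorem zkM_coeff_of_col (h : ColumnData m T₁ A Y Yi b A₀ b₀) {T : ℝ} (hT : T ∈ Set.Ioc 0 T₁)
    {k : ℕ} (hk : k ≤ m) {β : ℝ → Matrix n Unit ℝ} {Q : n → Matrix n n ℝ}
    (hQ : ∀ i, Q i * b₀ = Matrix.single i () 1)
    (hQs : ∀ i, ZkM T m fun t => (A t - A₀) * (Yi t * (Q i * b t)) - Yi t * (Q i * β t))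
    (h1s : ZkM T m fun t => (A t - A₀) * (Yi t * b t) - Yi t * β t)
    (hY : WkM T k Y) (hYi : WkM T k Yi) (hb : WkM T k b)
    (hY1 : ZkM T 0 fun t => Y t - 1) (hYi1 : ZkM T 0 fun t => Yi t - 1)
    (hb1 : ZkM T 0 fun t => b t - b₀)
    (ha : ZkM T k fun t => (A t - A₀) * b₀) :
    ∃ T' ∈ Set.Ioc 0 T, ZkM T' k fun t => A t - A₀ := by
  have h0 := hT.1.le
  have mulsum : ∀ (M a : Matrix n n ℝ) (v : Matrix n Unit ℝ) (p : n),
      (M * (a * v)) p () = ∑ r, ∑ s, M p r * v s () * a r s := by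
    intro M a v p
    simp only [Matrix.mul_apply, Finset.mul_sum]
    exact Finset.sum_congr rfl fun r _ => Finset.sum_congr rfl fun s _ => by ring
  let L : ℝ → Matrix (n × n) (n × n) ℝ := fun t => Matrix.of fun pi rs =>
    (1 : Matrix n n ℝ) pi.1 rs.1 * (Yi t * (Q pi.2 * b t)) rs.2 ()
      - (Yi t * (Q pi.2 * Y t)) pi.1 rs.1 * (Yi t * b t) rs.2 ()
      + Q pi.2 pi.1 rs.1 * b₀ rs.2 ()
  have hYiQb : ∀ i, WkM T k fun t => Yi t * (Q i * b t) := fun i =>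
    hYi.mul h0 ((wkM_const T k _).mul h0 hb)
  have hYiQY : ∀ i, WkM T k fun t => Yi t * (Q i * Y t) := fun i =>
    hYi.mul h0 ((wkM_const T k _).mul h0 hY)
  have hLW : WkM T k L := fun pi rs =>
    (((hYiQb pi.2 rs.2 ()).const_mul h0 _).sub h0
      ((hYiQY pi.2 pi.1 rs.1).mul h0 (hYi.mul h0 hb rs.2 ()))).add h0 (wk_const k _)
  have hcst : ∀ C : Matrix n n ℝ, ZkM T 0 fun _ : ℝ => C - C := fun C i j => by
    simpa using zk_zero 0
  have hYib1 : ZkM T 0 fun t => Yi t * b t - b₀ := by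
    simpa only [Matrix.one_mul] using ZkM.mul_sub_mul h0 hYi1 hb1
  have hYiQb1 : ∀ i, ZkM T 0 fun t => Yi t * (Q i * b t) - Q i * b₀ := fun i => by
    simpa only [Matrix.one_mul] using ZkM.mul_sub_mul h0 hYi1 (ZkM.mul_sub_mul h0 (hcst (Q i)) hb1)
  have hYiQY1 : ∀ i, ZkM T 0 fun t => Yi t * (Q i * Y t) - Q i := fun i => by
    simpa only [Matrix.one_mul, Matrix.mul_one] using
      ZkM.mul_sub_mul h0 hYi1 (ZkM.mul_sub_mul h0 (hcst (Q i)) hY1)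
  have hL1 : ZkM T 0 fun t => L t - 1 := by
    rintro ⟨p, i⟩ ⟨r, s⟩
    have h1 := ((hYiQb1 i s ()).const_mul h0 ((1 : Matrix n n ℝ) p r)).sub h0
      (((hYiQY1 i p r).mul h0 ((hYi.mul h0 hb s ()).le h0 k.zero_le)).add h0
        ((hYib1 s ()).const_mul h0 (Q i p r)))
    refine h1.congr (Eventually.of_forall fun t => ?_)
    have h2 : (1 : Matrix (n × n) (n × n) ℝ) (p, i) (r, s)
        = (1 : Matrix n n ℝ) p r * Matrix.single i () (1 : ℝ) s () := by
      simp only [Matrix.one_apply, Prod.mk.injEq, Matrix.single_apply, and_true]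
      split_ifs <;> simp_all
    simp only [L, Matrix.sub_apply, Matrix.of_apply, h2, hQ i]
    ring
  obtain ⟨T', hT', hle, hZ⟩ := zk_of_linear_system (f := fun t rs => (A t - A₀) rs.1 rs.2)
    hT.1 hLW hL1 fun ⟨p, i⟩ => by
    have hz := (((hQs i).le h0 hk).sub h0 (ZkM.mul' h0 (hYiQY i) (h1s.le h0 hk))).add h0
      (ZkM.mul' h0 (wkM_const T k (Q i)) ha)
    refine (hz p ()).congr ?_
    filter_upwards [ae_restrict_mem measurableSet_Ioc] with t ht
    have hYY := h.mul_inv t ⟨ht.1.le, ht.2.trans hT.2⟩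
    have hβ : Yi t * (Q i * Y t) * (Yi t * β t) = Yi t * (Q i * β t) := by
      rw [Matrix.mul_assoc, Matrix.mul_assoc, ← Matrix.mul_assoc (Y t), hYY, Matrix.one_mul]
    have h3 : (A t - A₀) * (Yi t * (Q i * b t)) - Yi t * (Q i * β t)
        - Yi t * (Q i * Y t) * ((A t - A₀) * (Yi t * b t) - Yi t * β t)
        + Q i * ((A t - A₀) * b₀)
        = (1 : Matrix n n ℝ) * ((A t - A₀) * (Yi t * (Q i * b t)))
          - Yi t * (Q i * Y t) * ((A t - A₀) * (Yi t * b t)) + Q i * ((A t - A₀) * b₀) := by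
      rw [Matrix.mul_sub _ ((A t - A₀) * (Yi t * b t)), hβ, Matrix.one_mul]
      abel
    rw [h3]
    simp only [Matrix.sub_apply, Matrix.add_apply, mulsum, Matrix.mulVec, dotProduct, L,
      Matrix.of_apply, Fintype.sum_prod_type, ← Finset.sum_sub_distrib, ← Finset.sum_add_distrib,
      add_mul, sub_mul]
  exact ⟨T', ⟨hT', hle⟩, fun i j => hZ (i, j)⟩

/-- The coefficient matrix is flat to order `m` and the column is flat to order `m + 1` at `0`. -/
theorem exists_zkM (h : ColumnData m T₁ A Y Yi b A₀ b₀) : ∃ T ∈ Set.Ioc 0 T₁,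
    (ZkM T m fun t => A t - A₀) ∧ ZkM T (m + 1) fun t => b t - b₀ := by
  obtain ⟨σ, hσ, β, hβ, hbβ⟩ := h.exists_col_deriv
  obtain ⟨σ₁, hσ₁, hbW⟩ := h.wkM_col
  choose Q hQm hQ using fun i : n => h.exists_mem_smallSubmodule hσ hbβ (Matrix.single i () 1)
  choose S hS hQs using hQm
  obtain ⟨S₁, hS₁, h1s⟩ := h.one_mem_smallSubmodule hσ hbβ
  obtain ⟨T₀, hT₀, hle⟩ : ∃ T₀ ∈ Set.Ioc 0 (min (min σ σ₁) S₁), ∀ i, T₀ ≤ S i := by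
    have h1 : ∀ᶠ T in 𝓝[>] (0 : ℝ), ∀ i, T ≤ S i :=
      eventually_all.2 fun i => (eventually_le_nhds (hS i).1).filter_mono nhdsWithin_le_nhds
    have h2 : ∀ᶠ T in 𝓝[>] (0 : ℝ), T ∈ Set.Ioc 0 (min (min σ σ₁) S₁) :=
      Ioc_mem_nhdsGT (lt_min (lt_min hσ.1 hσ₁.1) hS₁.1)
    exact (h2.and h1).exists
  have hle' := le_min_iff.1 hT₀.2
  have hle'' := le_min_iff.1 hle'.1
  have hT₀' : T₀ ≤ T₁ := hle''.1.trans hσ.2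
  simp only [Matrix.one_mul] at h1s
  have step : ∀ T ∈ Set.Ioc 0 T₀, ∀ k ≤ m, WkM T k Y → WkM T k Yi →
      (ZkM T k fun t => Y t * expM A₀ (-t) - 1) → ∃ T' ∈ Set.Ioc 0 T,
        ZkM T' k fun t => A t - A₀ := by
    intro T hT k hk hY hYi hV
    have h0 := hT.1.le
    have hT' : T ∈ Set.Ioc 0 T₁ := ⟨hT.1, hT.2.trans hT₀'⟩
    have hA := h.coeff.mono h0 hT'.2
    exact h.zkM_coeff_of_col hT' hk hQ
      (fun i => (hQs i).mono h0 (hT.2.trans (hle i)))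
      (h1s.mono h0 (hT.2.trans hle'.2)) hY hYi
      (hbW T ⟨hT.1, hT.2.trans hle''.2⟩ k (by lia) hY)
      ((h.fund_prim.mono h0 hT'.2).sub_zkM_zero h0 ((h.fund.mono h0 hT'.2).mul h0 hA))
      ((h.inv_prim.mono h0 hT'.2).sub_zkM_zero h0 ((hA.neg h0).mul h0 (h.inv.mono h0 hT'.2)))
      ((hbβ.mono h0 (hT.2.trans hle''.1)).sub_zkM_zero h0 (hβ.mono h0 (hT.2.trans hle''.1)))
      (h.zkM_sub_mul_col hT' hV hYi)
  have hAW : ∀ {T k}, T ∈ Set.Ioc 0 T₁ → (ZkM T k fun t => A t - A₀) → WkM T k A :=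
    fun {T k} hT hZ => by simpa using hZ.wkM.add hT.1.le (wkM_const T k A₀)
  have key : ∀ k ≤ m, ∃ T ∈ Set.Ioc 0 T₀, ZkM T k fun t => A t - A₀ := by
    intro k
    induction k with
    | zero =>
      intro _
      have hT : T₀ ∈ Set.Ioc 0 T₁ := ⟨hT₀.1, hT₀'⟩
      have h0 := hT.1.le
      have hY := h.fund.mono h0 hT.2
      have ha := (h.coeff.mono h0 hT.2).sub h0 (wkM_const T₀ 0 A₀)
      exact step T₀ ⟨hT₀.1, le_rfl⟩ 0 (zero_le) hY (h.inv.mono h0 hT.2)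
        ((h.fund_expM_prim hT).sub_zkM_zero h0 ((hY.mul h0 ha).mul h0 (wkM_expM_neg A₀ h0 0)))
    | succ k ih =>
      intro hk
      obtain ⟨T, hT, ha⟩ := ih (by lia)
      have h0 := hT.1.le
      have hT' : T ∈ Set.Ioc 0 T₁ := ⟨hT.1, hT.2.trans hT₀'⟩
      obtain ⟨hY, hYi⟩ := h.wkM_fund_succ hT' (hAW hT' ha)
      obtain ⟨T', hT'', hZ⟩ := step T hT (k + 1) hk hY hYi
        ((h.fund_expM_prim hT').sub_zkM_succ hT.1
          ((ZkM.mul' h0 (hY.le h0 k.le_succ) ha).mul h0 (wkM_expM_neg A₀ h0 k)))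
      exact ⟨T', ⟨hT''.1, hT''.2.trans hT.2⟩, hZ⟩
  obtain ⟨T, hT, ha⟩ := key m le_rfl
  have h0 := hT.1.le
  have hT' : T ∈ Set.Ioc 0 T₁ := ⟨hT.1, hT.2.trans hT₀'⟩
  obtain ⟨hY, hYi⟩ := h.wkM_fund_succ hT' (hAW hT' ha)
  have hb := hbW T ⟨hT.1, hT.2.trans hle''.2⟩ (m + 1) le_rfl hY
  refine ⟨T, hT', ha, (hbβ.mono h0 (hT.2.trans hle''.1)).sub_zkM_succ hT.1 ?_⟩
  refine (ZkM.mul' h0 (hY.le h0 m.le_succ) ((ha.mul h0 ((hYi.mul h0 hb).le h0 m.le_succ)).sub h0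
    (h1s.mono h0 (hT.2.trans hle'.2)))).congr ?_
  filter_upwards [ae_restrict_mem measurableSet_Ioc] with t ht
  rw [sub_sub_cancel, ← Matrix.mul_assoc, h.mul_inv t ⟨ht.1.le, ht.2.trans hT'.2⟩, Matrix.one_mul]

end ColumnData
end Bootstrap

/-! ### The data of a column of the control system -/

section Assembly

open Matrix

theorem wk_zero_of_continuousOn {T : ℝ} {f : ℝ → ℝ} (hf : ContinuousOn f (Set.Icc 0 T)) :
    Wk T 0 f := by
  obtain ⟨C, hC⟩ := isCompact_Icc.exists_bound_of_continuousOn hf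
  refine ⟨(hf.mono Set.Ioc_subset_Icc_self).aestronglyMeasurable measurableSet_Ioc, C, ?_⟩
  filter_upwards [ae_restrict_mem measurableSet_Ioc] with t ht
  exact hC t (Set.Ioc_subset_Icc_self ht)

theorem wk_zero_of_bound {T C : ℝ} {f : ℝ → ℝ} (hf : Measurable f)
    (hC : ∀ t, 0 ≤ t → |f t| ≤ C) : Wk T 0 f := by
  refine ⟨hf.aestronglyMeasurable, C, ?_⟩
  filter_upwards [ae_restrict_mem measurableSet_Ioc] with t ht
  exact hC t ht.1.le

theorem linearMap_eq_zero_of_kalman {N : ℕ} {A : Matrix (Fin N) (Fin N) ℝ} {b : Fin N → ℝ}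
    (h : (kalman A b).rank = N) (f : Matrix (Fin N) Unit ℝ →ₗ[ℝ] ℝ)
    (hf : ∀ i : ℕ, f (A ^ i * replicateCol Unit b) = 0) : f = 0 := by
  have hr : LinearMap.range (kalman A b).mulVecLin = ⊤ :=
    Submodule.eq_top_of_finrank_eq (by rw [← Matrix.rank, h, Module.finrank_fin_fun])
  refine LinearMap.ext fun M => ?_
  obtain ⟨c, hc⟩ := LinearMap.range_eq_top.1 hr fun i => M i ()
  have hM : M = ∑ k : Fin N, c k • (A ^ (k : ℕ) * replicateCol Unit b) := by
    ext i u
    rw [show M i u = (kalman A b).mulVecLin c i from (congrFun hc i).symm]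
    simp [Matrix.sum_apply, kalman, Matrix.mulVec, Matrix.mul_apply, dotProduct, mul_comm]
  rw [hM, map_sum]
  simp [hf]

theorem columnData_of_isTransition {m M : ℕ} {A : ℝ → Matrix (Fin (m + 2)) (Fin (m + 2)) ℝ}
    {B : ℝ → Matrix (Fin (m + 2)) (Fin M) ℝ} {CA T K 𝒯' : ℝ}
    {X X0 : ℝ → ℝ → Matrix (Fin (m + 2)) (Fin (m + 2)) ℝ}
    (hAmeas : ∀ i j, Measurable fun t => A t i j)
    (hAbd : ∀ t, 0 ≤ t → ∀ i j, |A t i j| ≤ CA) (hCA : 0 ≤ CA)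
    (hX : IsTransition A X) (hX0 : IsTransition (fun _ => A 0) X0) {j : Fin M}
    (hrank : (kalman (A 0) (fun i => B 0 i j)).rank = m + 2)
    (hsmooth : ∀ ζ : Fin (m + 2) → ℝ, euNorm ζ = 1 → ∀ τ : ℝ, 0 < τ →
      ContDiffOn ℝ m (swFun B X j ζ τ) (Set.Icc 0 τ) ∧
      AbsContOn (iteratedDerivWithin m (swFun B X j ζ τ) (Set.Icc 0 τ)) 0 τ)
    (h𝒯' : 0 < 𝒯')
    (hclose : ∀ ζ : Fin (m + 2) → ℝ, euNorm ζ = 1 → ∀ τ : ℝ, 0 < τ →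
      ∀ i < m + 2, ∀ t, 0 ≤ t → t ≤ min τ 𝒯' →
        |iteratedDerivWithin i (swFun B X j ζ τ) (Set.Icc 0 τ) t
          - iteratedDerivWithin i (swFun (fun _ => B 0) X0 j ζ τ) (Set.Icc 0 τ) t| ≤ K * t)
    (hT : 0 < T) (hsmall : (m + 2 : ℕ) * CA * T ≤ 1 / 2)
    {Yi : ℝ → Matrix (Fin (m + 2)) (Fin (m + 2)) ℝ}
    (hYic : ∀ i j, Continuous fun t => Yi t i j) (hYi0 : Yi 0 = 1)
    (hYi : PrimM 0 T Yi (fun t => -A t * Yi t) 1) :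
    ColumnData m T A (fun t => X t 0) Yi (fun t => replicateCol Unit fun i => B t i j) (A 0)
      (replicateCol Unit fun i => B 0 i j) := by
  obtain ⟨hp, hc⟩ := primM_of_isTransition hX hAmeas hAbd hCA hsmall le_rfl hT.le
  have hmul : ∀ {s τ : ℝ}, 0 ≤ s → s ≤ τ → τ ≤ T → X τ s * Yi τ = Yi s := fun hs hsτ hτ =>
    isTransition_mul_eq hX hAmeas hAbd hCA hsmall hT hYi hYic hs hsτ hτ
  have hinv : ∀ t ∈ Set.Icc 0 T, X t 0 * Yi t = 1 := fun t ht => by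
    rw [hmul le_rfl ht.1 ht.2, hYi0]
  have hfact : ∀ {s τ : ℝ}, 0 ≤ s → s ≤ τ → τ ≤ T → X τ s = Yi s * X τ 0 := by
    intro s τ hs hsτ hτ
    rw [← hmul hs hsτ hτ, Matrix.mul_assoc, mul_eq_one_comm.1 (hinv τ ⟨hs.trans hsτ, hτ⟩),
      Matrix.mul_one]
  have hexp : ∀ {s τ : ℝ}, 0 ≤ s → s ≤ τ → τ ≤ T → X0 τ s = expM (A 0) (τ - s) := fun hs hsτ hτ =>
    isTransition_eq_expM hX0 (hAbd 0 le_rfl) hCA hsmall hT hs hsτ hτ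
  have hsw : ∀ (i : Fin (m + 2)) (τ t : ℝ), swFun B X j (Pi.single i 1) τ t
      = (X τ t * replicateCol Unit fun i => B t i j) i () := fun i τ t => by
    rw [swFun, euDot_single, ← replicateCol_mulVec, replicateCol_apply]
  have hsw0 : ∀ (i : Fin (m + 2)) (τ t : ℝ), swFun (fun _ => B 0) X0 j (Pi.single i 1) τ t
      = (X0 τ t * replicateCol Unit fun i => B 0 i j) i () := fun i τ t => by
    rw [swFun, euDot_single, ← replicateCol_mulVec, replicateCol_apply]
  refine
    { pos := hT
      coeff := fun i j => wk_zero_of_bound (hAmeas i j) fun t ht => hAbd t ht i j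
      fund := fun i j => wk_zero_of_continuousOn (hc i j)
      inv := fun i j => wk_zero_of_continuousOn (hYic i j).continuousOn
      fund_prim := hp
      inv_prim := hYi
      fund_zero := isTransition_self hX 0
      fund_cont := hc
      mul_inv := hinv
      close := fun τ hτ => ⟨min τ 𝒯', ⟨lt_min hτ.1 h𝒯', min_le_left _ _⟩, fun i _ => ?_⟩
      fund_mul := fun τ hτ => ?_
      kalman := linearMap_eq_zero_of_kalman hrank }
  · have hg : ContDiffOn ℝ (m + 1 : ℕ) (swFun (fun _ => B 0) X0 j (Pi.single i 1) τ)
        (Set.Icc 0 τ) := by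
      refine ContDiffOn.congr (f := fun t =>
        (expM (A 0) (τ - t) * replicateCol Unit fun i => B 0 i j) i ()) ?_ fun t ht => ?_
      · simp only [Matrix.mul_apply]
        exact (ContDiff.sum fun k _ => ((contDiff_expM (A 0) (m + 1) i k).comp
          (contDiff_const.sub contDiff_id)).mul contDiff_const).contDiffOn
      · rw [hsw0, hexp ht.1 ht.2 hτ.2]
    obtain ⟨h1, h2⟩ := hsmooth _ (euNorm_single i) τ hτ.1
    refine (zk_sub_of_close (lt_min hτ.1 h𝒯') (min_le_left _ _) h1 h2 hg
      (hclose _ (euNorm_single i) τ hτ.1)).congr ?_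
    filter_upwards [ae_restrict_mem measurableSet_Ioc] with t ht
    have ht' : t ≤ τ := ht.2.trans (min_le_left _ _)
    rw [hsw, hsw0, hexp ht.1.le ht' hτ.2, ← hfact ht.1.le ht' hτ.2, Matrix.sub_apply]
  · ext i u
    have h1 := hclose _ (euNorm_single i) τ hτ.1 0 (by lia) 0 le_rfl (lt_min hτ.1 h𝒯').le
    rw [mul_zero, iteratedDerivWithin_zero, iteratedDerivWithin_zero, hsw, hsw0,
      hexp le_rfl hτ.1.le hτ.2, sub_zero] at h1
    exact sub_eq_zero.1 (abs_nonpos_iff.1 h1)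

end Assembly

/-! ### Columns propagated by the inverse of the state transition matrix -/

section Propagated

open Matrix

variable {n l : Type*} [Fintype n] [DecidableEq n] {A P : ℝ → Matrix n n ℝ} {A₀ : Matrix n n ℝ}
  {b : ℝ → Matrix n l ℝ} {b₀ : Matrix n l ℝ} {T : ℝ} {m : ℕ}

theorem zkM_propagated_column (hT : 0 < T) (hA : ZkM T m fun t => A t - A₀)
    (hb : ZkM T (m + 1) fun t => b t - b₀) (hP : PrimM 0 T P (fun t => P t * -A t) 1)
    (hP0 : WkM T 0 P) : ZkM T (m + 1) fun t => P t * b t - expM A₀ (-t) * b₀ := by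
  have h0 := hT.le
  have hAW : WkM T m A := by simpa using hA.wkM.add h0 (wkM_const T m A₀)
  have hbW : WkM T (m + 1) b := by simpa using hb.wkM.add h0 (wkM_const T (m + 1) b₀)
  have hPW : ∀ k ≤ m, WkM T k P := by
    intro k
    induction k with
    | zero => exact fun _ => hP0
    | succ k ih =>
      exact fun hk => hP.wkM_succ rfl ((ih (by lia)).mul h0 ((hAW.le h0 (by lia)).neg h0))
  have hW := hP.mul h0 (primM_expM A₀ 0 T)
  rw [expM_zero, Matrix.mul_one] at hW
  have hWZ : ZkM T (m + 1) fun t => P t * expM A₀ t - 1 := by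
    refine hW.sub_zkM_succ hT ((ZkM.mul' h0 (hPW m le_rfl) ((hA.neg h0).mul h0
      (wkM_expM A₀ h0 m))).congr (Eventually.of_forall fun t => ?_))
    simp only [Matrix.mul_sub, Matrix.sub_mul, Matrix.neg_mul, Matrix.mul_neg, Matrix.mul_assoc]
    abel
  have hE := wkM_expM_neg A₀ h0 (m + 1)
  refine ((hWZ.mul h0 (hE.mul h0 hbW)).add h0 (ZkM.mul' h0 hE hb)).congr
    (Eventually.of_forall fun t => ?_)
  have : P t * expM A₀ t * (expM A₀ (-t) * b t) = P t * b t := by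
    rw [Matrix.mul_assoc, ← Matrix.mul_assoc (expM A₀ t), expM_mul_neg, Matrix.one_mul]
  simp only [Matrix.mul_sub, Matrix.sub_mul, this, Matrix.one_mul]
  abel

end Propagated

section Fundamental

open Matrix

variable {n : Type*} [Fintype n] [DecidableEq n] {A : ℝ → Matrix n n ℝ} {C T : ℝ}

/-- Short-time existence of the state transition matrix of `A` and of its inverse. -/
theorem exists_fundamental_pair (hT : 0 ≤ T) (hA : ∀ i j, Measurable fun t => A t i j)
    (hAC : ∀ t ∈ Set.Icc 0 T, ∀ i j, |A t i j| ≤ C) (hC : 0 ≤ C)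
    (hsmall : Fintype.card n * C * T ≤ 1 / 2) :
    ∃ P Ψ : ℝ → Matrix n n ℝ, (∀ i j, Continuous fun t => P t i j) ∧
      (∀ i j, Continuous fun t => Ψ t i j) ∧ PrimM 0 T P (fun t => P t * -A t) 1 ∧
      ∀ t ∈ Set.Icc 0 T, P t * Ψ t = 1 := by
  obtain ⟨F, hFc, hF0, hF⟩ := exists_fundamental_matrix (L := fun t => -(A t)ᵀ) hT
    (fun i j => (hA j i).neg) (fun t ht i j => by simpa using hAC t ht j i) hC hsmall
  obtain ⟨Ψ, hΨc, hΨ0, hΨ⟩ := exists_fundamental_matrix hT hA hAC hC hsmall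
  have hP : PrimM 0 T (fun t => (F t)ᵀ) (fun t => (F t)ᵀ * -A t) 1 := by
    intro i j
    have h := hF j i
    have h1 : (fun t => (-(A t)ᵀ * F t) j i) = fun t => ((F t)ᵀ * -A t) i j := by
      ext t
      rw [← Matrix.transpose_apply (-(A t)ᵀ * F t), Matrix.transpose_mul, Matrix.transpose_neg,
        Matrix.transpose_transpose]
    rw [h1, ← Matrix.transpose_apply (1 : Matrix n n ℝ), Matrix.transpose_one] at h
    exact h
  refine ⟨fun t => (F t)ᵀ, Ψ, fun i j => hFc j i, hΨc, hP, ?_⟩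
  simpa using PrimM.mul_eq_of_inverse hT hP (fun i j => (hFc j i).continuousOn) (by simp [hF0])
    (Z := Ψ) (by simpa using hΨ) (fun i j => (hΨc i j).continuousOn) hΨ0

end Fundamental

/-! ### Sublevel sets of functions with a non-vanishing derivative -/

section Sublevel

/-- A set of large measure contains many well separated points. -/
theorem exists_separated_points {δ : ℝ} (hδ : 0 < δ) (n : ℕ) : ∀ E : Set ℝ, BddBelow E →
    ENNReal.ofReal (n * (2 * δ)) < volume E →
    ∃ t : ℕ → ℝ, (∀ j ≤ n, t j ∈ E) ∧ ∀ j < n, t j + δ ≤ t (j + 1) := by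
  have hne : ∀ {E : Set ℝ} {x : ENNReal}, x < volume E → E.Nonempty := fun {E x} h => by
    by_contra hE
    rw [Set.not_nonempty_iff_eq_empty.1 hE, measure_empty] at h
    exact not_lt_bot h
  induction n with
  | zero =>
    intro E _ hE
    obtain ⟨x, hx⟩ := hne hE
    exact ⟨fun _ => x, fun _ _ => hx, by simp⟩
  | succ n ih =>
    intro E hb hE
    obtain ⟨x, hxE, hx⟩ := exists_lt_of_csInf_lt (hne hE) (lt_add_of_pos_right (sInf E) hδ)
    have hsub : E ⊆ Set.Icc (sInf E) (x + δ) ∪ E ∩ Set.Ici (x + δ) := fun y hy => by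
      rcases le_total y (x + δ) with h | h
      · exact Or.inl ⟨csInf_le hb hy, h⟩
      · exact Or.inr ⟨hy, h⟩
    have hv : ENNReal.ofReal (n * (2 * δ)) < volume (E ∩ Set.Ici (x + δ)) := by
      by_contra! hcon
      refine hE.not_ge ((measure_mono hsub).trans ((measure_union_le _ _).trans ?_))
      rw [Real.volume_Icc]
      refine (add_le_add (ENNReal.ofReal_le_ofReal (by linarith : _ ≤ 2 * δ)) hcon).trans ?_
      rw [← ENNReal.ofReal_add (by positivity) (by positivity)]
      refine ENNReal.ofReal_le_ofReal (le_of_eq ?_)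
      push_cast
      ring
    obtain ⟨t, ht, hgap⟩ := ih _ (hb.mono Set.inter_subset_left) hv
    refine ⟨fun j => Nat.casesOn j x t, fun j hj => ?_, fun j hj => ?_⟩
    · cases j with
      | zero => exact hxE
      | succ j => exact (ht j (by lia)).1
    · cases j with
      | zero => exact (ht 0 n.zero_le).2
      | succ j => exact hgap j (by lia)

/-- `F 0, …, F k` are successive primitives, the ones of index less than `k` being genuine
continuous functions. -/
def PrimChain (T : ℝ) (k : ℕ) (F : ℕ → ℝ → ℝ) (c : ℕ → ℝ) : Prop :=
  ∀ i < k, IntervalIntegrable (F (i + 1)) volume 0 T ∧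
    ∀ t ∈ Set.Icc 0 T, F i t = c i + ∫ r in (0 : ℝ)..t, F (i + 1) r

variable {T : ℝ} {k : ℕ} {F : ℕ → ℝ → ℝ} {c : ℕ → ℝ}

theorem PrimChain.tail (h : PrimChain T (k + 1) F c) :
    PrimChain T k (fun i => F (i + 1)) fun i => c (i + 1) :=
  fun i hi => h (i + 1) (Nat.succ_lt_succ hi)

theorem PrimChain.continuousOn (h : PrimChain T (k + 1) F c) (hT : 0 ≤ T) :
    ContinuousOn (F 0) (Set.Icc 0 T) :=
  (continuousOn_primitive hT (h 0 k.succ_pos).1 (c 0)).congr (h 0 k.succ_pos).2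

theorem PrimChain.sub_eq (h : PrimChain T (k + 1) F c) {s t : ℝ} (hs : 0 ≤ s) (hst : s ≤ t)
    (ht : t ≤ T) : IntervalIntegrable (F 1) volume s t ∧ F 0 t - F 0 s = ∫ r in s..t, F 1 r := by
  obtain ⟨hi, he⟩ := h 0 k.succ_pos
  have hsub : ∀ {a b : ℝ}, 0 ≤ a → a ≤ b → b ≤ T → IntervalIntegrable (F 1) volume a b :=
    fun {a b} ha hab hb => hi.mono_set (by
      rw [Set.uIcc_of_le hab, Set.uIcc_of_le (ha.trans (hab.trans hb))]
      exact Set.Icc_subset_Icc ha hb)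
  refine ⟨hsub hs hst ht, ?_⟩
  rw [he t ⟨hs.trans hst, ht⟩, he s ⟨hs, hst.trans ht⟩, add_sub_add_left_eq_sub,
    intervalIntegral.integral_interval_sub_left (hsub le_rfl (hs.trans hst) ht)
      (hsub le_rfl hs (hst.trans ht))]

theorem PrimChain.not_separated {c₀ δ : ℝ} (hδ : 0 < δ) (hc₀ : 0 < c₀) : ∀ (k : ℕ) {ε : ℝ}
    {F : ℕ → ℝ → ℝ} {c : ℕ → ℝ}, ε ≤ c₀ * (δ / 2) ^ (k + 1) → PrimChain T (k + 1) F c →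
    (∀ᵐ t ∂(volume.restrict (Set.Ioc 0 T)), c₀ ≤ F (k + 1) t) →
    ∀ t : ℕ → ℝ, (∀ j < 2 ^ (k + 1), t j ∈ Set.Icc 0 T ∧ |F 0 (t j)| < ε) →
    (∀ j, j + 1 < 2 ^ (k + 1) → t j + δ ≤ t (j + 1)) → False := by
  intro k
  induction k with
  | zero =>
    intro ε F c hε h hF t ht hgap
    obtain ⟨h0, h0'⟩ := ht 0 (by norm_num)
    obtain ⟨h1, h1'⟩ := ht 1 (by norm_num)
    have hg := hgap 0 (by norm_num)
    rw [zero_add] at hg hε hF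
    have hle : t 0 ≤ t 1 := by linarith
    obtain ⟨hi, he⟩ := h.sub_eq h0.1 hle h1.2
    have hlow : ∫ _ in (t 0)..(t 1), c₀ ≤ ∫ r in (t 0)..(t 1), F 1 r := by
      refine intervalIntegral.integral_mono_ae_restrict hle (by simp) hi ?_
      rw [← restrict_Ioc_eq_restrict_Icc]
      exact ae_restrict_of_ae_restrict_of_subset (Set.Ioc_subset_Ioc h0.1 h1.2) hF
    rw [intervalIntegral.integral_const, smul_eq_mul, ← he] at hlow
    have h2 : δ * c₀ ≤ (t 1 - t 0) * c₀ := by gcongr; linarith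
    have h3 := (abs_lt.1 h0').1
    have h4 := (abs_lt.1 h1').2
    rw [pow_one] at hε
    linarith
  | succ k ih =>
    intro ε F c hε h hF t ht hgap
    have hex : ∀ j < 2 ^ (k + 1), ∃ s ∈ Set.Icc (t (2 * j)) (t (2 * j + 1)),
        |F 1 s| < 2 * ε / δ := by
      intro j hj
      have hp : 2 ^ (k + 1 + 1) = 2 * 2 ^ (k + 1) := by ring
      obtain ⟨h0, h0'⟩ := ht (2 * j) (by lia)
      obtain ⟨h1, h1'⟩ := ht (2 * j + 1) (by lia)
      have hg := hgap (2 * j) (by lia)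
      have hlt : t (2 * j) < t (2 * j + 1) := by linarith
      obtain ⟨hi, he⟩ := h.sub_eq h0.1 hlt.le h1.2
      obtain ⟨s, hs, hse⟩ := exists_eq_const_mul_intervalIntegral_of_nonneg (μ := volume)
        (f := F 1) (g := fun _ => (1 : ℝ)) (a := t (2 * j)) (b := t (2 * j + 1))
        (by
          rw [Set.uIcc_of_le hlt.le]
          exact (h.tail.continuousOn (h0.1.trans h0.2)).mono (Set.Icc_subset_Icc h0.1 h1.2))
        (by simp) (by simp)
      simp only [mul_one, intervalIntegral.integral_const, smul_eq_mul, ← he] at hse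
      rw [Set.uIcc_of_le hlt.le] at hs
      refine ⟨s, hs, ?_⟩
      rw [lt_div_iff₀ hδ]
      calc |F 1 s| * δ ≤ |F 1 s| * (t (2 * j + 1) - t (2 * j)) := by gcongr; linarith
        _ = |F 0 (t (2 * j + 1)) - F 0 (t (2 * j))| := by
          rw [hse, abs_mul, abs_of_pos (sub_pos.2 hlt)]
        _ < 2 * ε := by
          refine (abs_sub _ _).trans_lt ?_
          linarith
    choose! s hs hsF using hex
    have hp : 2 ^ (k + 1 + 1) = 2 * 2 ^ (k + 1) := by ring
    refine ih (ε := 2 * ε / δ) ?_ h.tail hF s (fun j hj => ⟨⟨?_, ?_⟩, hsF j hj⟩) fun j hj => ?_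
    · rw [div_le_iff₀ hδ]
      calc 2 * ε ≤ 2 * (c₀ * (δ / 2) ^ (k + 1 + 1)) := by gcongr
        _ = c₀ * (δ / 2) ^ (k + 1) * δ := by ring
    · exact (ht (2 * j) (by lia)).1.1.trans (hs j hj).1
    · exact (hs j hj).2.trans (ht (2 * j + 1) (by lia)).1.2
    · have h1 := hgap (2 * j + 1) (by lia)
      have h2 := (hs j (by lia)).2
      have h3 := (hs (j + 1) hj).1
      rw [show 2 * (j + 1) = 2 * j + 1 + 1 by ring] at h3
      linarith

theorem PrimChain.neg (h : PrimChain T k F c) :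
    PrimChain T k (fun i t => -F i t) fun i => -c i := fun i hi =>
  ⟨(h i hi).1.neg, fun t ht => by
    simp only [intervalIntegral.integral_neg, (h i hi).2 t ht, neg_add]⟩

theorem PrimChain.volume_sublevel_le (h : PrimChain T k F c) {δ c₀ : ℝ} (hδ : 0 < δ)
    (hc₀ : 0 < c₀) (hF : (∀ᵐ t ∂(volume.restrict (Set.Ioc 0 T)), c₀ ≤ F k t) ∨
      ∀ᵐ t ∂(volume.restrict (Set.Ioc 0 T)), F k t ≤ -c₀) :
    volume {t | t ∈ Set.Ioc 0 T ∧ |F 0 t| < c₀ * (δ / 2) ^ k}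
      ≤ ENNReal.ofReal (2 ^ k * (2 * δ)) := by
  wlog hF' : ∀ᵐ t ∂(volume.restrict (Set.Ioc 0 T)), c₀ ≤ F k t generalizing F c
  · have h' : ∀ᵐ t ∂(volume.restrict (Set.Ioc 0 T)), c₀ ≤ -F k t := by
      filter_upwards [hF.resolve_left hF'] with t ht using le_neg_of_le_neg ht
    simpa only [abs_neg] using this h.neg (Or.inl h') h'
  cases k with
  | zero =>
    rw [ae_restrict_iff' measurableSet_Ioc] at hF'
    refine (le_of_eq (measure_mono_null ?_ hF')).trans (zero_le)
    rintro t ⟨ht, hlt⟩ hcon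
    rw [pow_zero, mul_one] at hlt
    exact ((le_abs_self _).trans_lt hlt).not_ge (hcon ht)
  | succ k =>
    by_contra! hcon
    obtain ⟨t, ht, hgap⟩ := exists_separated_points hδ (2 ^ (k + 1))
      {t | t ∈ Set.Ioc 0 T ∧ |F 0 t| < c₀ * (δ / 2) ^ (k + 1)} ⟨0, fun t ht => ht.1.1.le⟩
      (by exact_mod_cast hcon)
    exact PrimChain.not_separated hδ hc₀ k le_rfl h hF' t
      (fun j hj => ⟨Set.Ioc_subset_Icc_self (ht j hj.le).1, (ht j hj.le).2⟩)
      fun j hj => hgap j (by lia)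

end Sublevel

/-! ### Lower bounds for integrals of switching functions -/

section LowerBound

open Matrix

variable {T : ℝ} {k m : ℕ}

theorem Zk.exists_chain (hT : 0 ≤ T) : ∀ {k : ℕ} {f : ℝ → ℝ}, Zk T k f → ∃ ρ : ℕ → ℝ → ℝ,
    f =ᵐ[volume.restrict (Set.Ioc 0 T)] ρ 0 ∧ PrimChain T k ρ 0 ∧ ∀ i ≤ k, Zk T 0 (ρ i)
  | 0, f, h => ⟨fun _ => f, .rfl, fun _ hi => absurd hi (Nat.not_lt_zero _), fun _ _ => h⟩
  | k + 1, f, h => by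
    obtain ⟨φ, hφ, hp⟩ := id h
    obtain ⟨ρ, hρ, hc, hz⟩ := hφ.exists_chain hT
    have hp' := hp.congr_deriv hT hρ.symm
    refine ⟨fun i => Nat.casesOn i (fun t => 0 + ∫ r in (0 : ℝ)..t, ρ 0 r) ρ, hp'.2, ?_, ?_⟩
    · rintro (_ | i) hi
      · exact ⟨hp'.1, fun t _ => rfl⟩
      · exact hc i (by lia)
    · rintro (_ | i) hi
      · exact (h.le hT (zero_le)).congr hp'.2.symm
      · exact hz i (by lia)

theorem PrimChain.sum {ι : Type*} [Fintype ι] {F : ι → ℕ → ℝ → ℝ} {c : ι → ℕ → ℝ} (η : ι → ℝ)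
    (h : ∀ p, PrimChain T k (F p) (c p)) :
    PrimChain T k (fun i t => ∑ p, η p * F p i t) fun i => ∑ p, η p * c p i := by
  intro i hi
  refine ⟨by
    simpa only [Finset.sum_apply, Finset.sum_fn] using IntervalIntegrable.sum Finset.univ
      (f := fun p t => η p * F p (i + 1) t) fun p _ => (h p i hi).1.const_mul (η p), fun t ht => ?_⟩
  simp only
  rw [intervalIntegral.integral_finsetSum fun p _ =>
    ((h p i hi).1.mono_set (by
      rw [Set.uIcc_of_le ht.1, Set.uIcc_of_le (ht.1.trans ht.2)]
      exact Set.Icc_subset_Icc_right ht.2)).const_mul (η p), ← Finset.sum_add_distrib]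
  refine Finset.sum_congr rfl fun p _ => ?_
  rw [(h p i hi).2 t ht, intervalIntegral.integral_const_mul, mul_add]

variable {n : Type*} [Fintype n] [DecidableEq n] {A₀ : Matrix n n ℝ} {q : ℝ → Matrix n Unit ℝ}
  {b₀ : Matrix n Unit ℝ}

theorem exists_jet (hT : 0 < T) (hq : ZkM T k fun t => q t - expM A₀ (-t) * b₀) (p : n) :
    ∃ G : ℕ → ℝ → ℝ, (fun t => q t p ()) =ᵐ[volume.restrict (Set.Ioc 0 T)] G 0 ∧
      PrimChain T k G (fun i => ((-A₀) ^ i * b₀) p ()) ∧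
      ∀ i ≤ k, ∃ C : ℝ, ∀ᵐ t ∂(volume.restrict (Set.Ioc 0 T)),
        |G i t - ((-A₀) ^ i * b₀) p ()| ≤ C * t := by
  have h0 := hT.le
  obtain ⟨ρ, hρ, hc, hz⟩ := (hq p ()).exists_chain h0
  have hE : ∀ i : ℕ, PrimM 0 T (fun t => (-A₀) ^ i * (expM A₀ (-t) * b₀))
      (fun t => (-A₀) ^ (i + 1) * (expM A₀ (-t) * b₀)) ((-A₀) ^ i * b₀) := by
    intro i
    have := (primM_const 0 T ((-A₀) ^ i)).mul h0
      ((primM_expM_neg A₀ 0 T).mul h0 (primM_const 0 T b₀))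
    simpa [pow_succ, Matrix.mul_assoc, expM_zero] using this
  have hEc : ∀ i : ℕ, Continuous fun t => ((-A₀) ^ i * (expM A₀ (-t) * b₀)) p () := by
    intro i
    simp only [Matrix.mul_apply]
    exact continuous_finsetSum _ fun r _ => (continuous_finsetSum _ fun s _ =>
      ((continuous_expM A₀ r s).comp continuous_neg).mul_const _).const_mul _
  refine ⟨fun i t => ((-A₀) ^ i * (expM A₀ (-t) * b₀)) p () + ρ i t, ?_, fun i hi => ⟨?_, ?_⟩, ?_⟩
  · filter_upwards [hρ] with t ht
    simp only [← ht, Matrix.sub_apply, pow_zero, Matrix.one_mul]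
    ring
  · exact (hEc _).intervalIntegrable _ _ |>.add (hc i hi).1
  · intro t ht
    have hsub : Set.uIcc 0 t ⊆ Set.uIcc 0 T := by
      rw [Set.uIcc_of_le ht.1, Set.uIcc_of_le h0]; exact Set.Icc_subset_Icc_right ht.2
    simp only
    rw [show ((-A₀) ^ i * (expM A₀ (-t) * b₀)) p () = _ from
      (hE i p ()).eq_on hT (hEc i).continuousOn t ht, (hc i hi).2 t ht,
      intervalIntegral.integral_add ((hEc _).intervalIntegrable _ _)
        ((hc i hi).1.mono_set hsub), Pi.zero_apply]
    ring
  · intro i hi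
    have hW : WkM T 0 fun t => (-A₀) ^ (i + 1) * (expM A₀ (-t) * b₀) :=
      (wkM_const T 0 _).mul h0 ((wkM_expM_neg A₀ h0 0).mul h0 (wkM_const T 0 b₀))
    obtain ⟨-, C, hC⟩ := (((hE i).sub_zkM_zero h0 hW) p ()).add h0 (hz i hi)
    refine ⟨C, ?_⟩
    filter_upwards [hC] with t ht
    rwa [Matrix.sub_apply, sub_add_eq_add_sub] at ht

/-- A quantitative form of the Kalman condition. -/
theorem exists_kalman_bound {N : ℕ} {A : Matrix (Fin N) (Fin N) ℝ} {b : Fin N → ℝ}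
    (h : (kalman A b).rank = N) : ∃ κ : ℝ, 0 < κ ∧ ∀ η : Fin N → ℝ, η ≠ 0 → ∃ i < N,
      κ * ‖η‖ ≤ |∑ p, η p * ((-A) ^ i * replicateCol Unit b) p ()| := by
  have hr : LinearMap.ker (kalman A b)ᵀ.mulVecLin = ⊥ := by
    have h1 := LinearMap.finrank_range_add_finrank_ker (kalman A b)ᵀ.mulVecLin
    rw [← Matrix.rank, Matrix.rank_transpose, h, Module.finrank_fin_fun] at h1
    exact Submodule.finrank_eq_zero.1 (by lia)
  obtain ⟨c, hc, hK⟩ := (kalman A b)ᵀ.mulVecLin.exists_antilipschitzWith hr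
  refine ⟨(c : ℝ)⁻¹, by positivity, fun η hη => ?_⟩
  have h1 : (c : ℝ)⁻¹ * ‖η‖ ≤ ‖(kalman A b)ᵀ *ᵥ η‖ := by
    have := hK.le_mul_dist η 0
    rw [inv_mul_le_iff₀ (by positivity)]
    rwa [dist_zero_right, map_zero, dist_zero_right] at this
  have hN : Nonempty (Fin N) := by
    by_contra hN
    rw [not_nonempty_iff] at hN
    exact hη (Subsingleton.elim _ _)
  obtain ⟨i, hi⟩ := Finite.exists_max fun i => ‖((kalman A b)ᵀ *ᵥ η) i‖
  refine ⟨i, i.2, h1.trans (((pi_norm_le_iff_of_nonneg (norm_nonneg _)).2 hi).trans ?_)⟩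
  have h2 : ((kalman A b)ᵀ *ᵥ η) i = ∑ p, η p * (A ^ (i : ℕ) * replicateCol Unit b) p () := by
    simp [Matrix.mulVec, dotProduct, kalman, Matrix.mul_apply, mul_comm]
  rw [h2, Real.norm_eq_abs, neg_pow, Matrix.mul_assoc]
  rcases neg_one_pow_eq_or (Matrix (Fin N) (Fin N) ℝ) (i : ℕ) with h | h <;> simp [h]

theorem PrimChain.mono {F : ℕ → ℝ → ℝ} {c : ℕ → ℝ} {T' : ℝ} (h : PrimChain T k F c) (h0 : 0 ≤ T')
    (hT : T' ≤ T) : PrimChain T' k F c := fun i hi =>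
  ⟨(h i hi).1.mono_set (by
    rw [Set.uIcc_of_le h0, Set.uIcc_of_le (h0.trans hT)]; exact Set.Icc_subset_Icc_right hT),
    fun t ht => (h i hi).2 t ⟨ht.1, ht.2.trans hT⟩⟩

theorem PrimChain.le {F : ℕ → ℝ → ℝ} {c : ℕ → ℝ} (h : PrimChain T k F c) {l : ℕ} (hl : l ≤ k) :
    PrimChain T l F c := fun i hi => h i (hi.trans_le hl)

/-- Sublevel sets of the switching functions are small, uniformly in the direction. -/
theorem exists_sublevel_bound (hT : 0 < T) (hq : ZkM T k fun t => q t - expM A₀ (-t) * b₀) {κ : ℝ}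
    (hκ : 0 < κ) (hK : ∀ η : n → ℝ, η ≠ 0 → ∃ i ≤ k,
      κ * ‖η‖ ≤ |∑ p, η p * ((-A₀) ^ i * b₀) p ()|) :
    ∃ T' ∈ Set.Ioc 0 T, ∀ η : n → ℝ, η ≠ 0 → ∃ i ≤ k, ∀ δ : ℝ, 0 < δ →
      volume {t | t ∈ Set.Ioc 0 T' ∧ |∑ p, η p * q t p ()| < κ / 2 * ‖η‖ * (δ / 2) ^ i}
        ≤ ENNReal.ofReal (2 ^ i * (2 * δ)) := by
  choose G hG0 hGc hGC using exists_jet hT hq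
  choose! C hC using hGC
  obtain ⟨D, hD⟩ := (Set.finite_range fun x : n × Fin (k + 1) => C x.1 x.2).bddAbove
  have hD' : ∀ p, ∀ i ≤ k, C p i ≤ |D| := fun p i hi =>
    (hD ⟨(p, ⟨i, Nat.lt_succ_of_le hi⟩), rfl⟩).trans (le_abs_self D)
  set T' := min T (κ / (2 * (Fintype.card n * |D| + 1)))
  have hT'0 : 0 < T' := lt_min hT (by positivity)
  have hT'T : T' ≤ T := min_le_left _ _
  have hT'κ : Fintype.card n * |D| * T' ≤ κ / 2 := by
    have h1 : T' ≤ κ / (2 * (Fintype.card n * |D| + 1)) := min_le_right _ _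
    rw [le_div_iff₀ (by positivity)] at h1
    linarith
  refine ⟨T', ⟨hT'0, hT'T⟩, fun η hη => ?_⟩
  obtain ⟨i, hi, hKi⟩ := hK η hη
  have hη0 : 0 < ‖η‖ := norm_pos_iff.2 hη
  refine ⟨i, hi, fun δ hδ => ?_⟩
  have hmono : ∀ {P : ℝ → Prop}, (∀ᵐ t ∂(volume.restrict (Set.Ioc 0 T)), P t) →
      ∀ᵐ t ∂(volume.restrict (Set.Ioc 0 T')), P t := fun h =>
    ae_restrict_of_ae_restrict_of_subset (Set.Ioc_subset_Ioc_right hT'T) h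
  have hclose : ∀ᵐ t ∂(volume.restrict (Set.Ioc 0 T')),
      |∑ p, η p * G p i t - ∑ p, η p * ((-A₀) ^ i * b₀) p ()| ≤ κ / 2 * ‖η‖ := by
    filter_upwards [hmono (ae_all_iff.2 fun p => hC p i hi), ae_restrict_mem measurableSet_Ioc]
      with t ht htm
    rw [← Finset.sum_sub_distrib]
    calc |∑ p, (η p * G p i t - η p * ((-A₀) ^ i * b₀) p ())|
        ≤ ∑ p, |η p * G p i t - η p * ((-A₀) ^ i * b₀) p ()| := Finset.abs_sum_le_sum_abs _ _
      _ ≤ ∑ _p : n, ‖η‖ * (|D| * T') := Finset.sum_le_sum fun p _ => by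
          rw [← mul_sub, abs_mul]
          refine mul_le_mul (norm_le_pi_norm η p) ((ht p).trans ?_) (abs_nonneg _) hη0.le
          exact mul_le_mul (hD' p i hi) htm.2 htm.1.le (abs_nonneg _)
      _ = Fintype.card n * |D| * T' * ‖η‖ := by
          rw [Finset.sum_const, Finset.card_univ, nsmul_eq_mul]; ring
      _ ≤ κ / 2 * ‖η‖ := by gcongr
  have hsign : (∀ᵐ t ∂(volume.restrict (Set.Ioc 0 T')), κ / 2 * ‖η‖ ≤ ∑ p, η p * G p i t) ∨
      ∀ᵐ t ∂(volume.restrict (Set.Ioc 0 T')), ∑ p, η p * G p i t ≤ -(κ / 2 * ‖η‖) := by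
    rcases le_abs.1 hKi with h | h
    · left
      filter_upwards [hclose] with t ht
      linarith [(abs_le.1 ht).1]
    · right
      filter_upwards [hclose] with t ht
      linarith [(abs_le.1 ht).2]
  refine (measure_mono_ae ?_).trans (((PrimChain.sum η hGc).mono hT'0.le hT'T |>.le
    hi).volume_sublevel_le hδ (by positivity) hsign)
  have h0 := (ae_restrict_iff' measurableSet_Ioc).1 (hmono (ae_all_iff.2 hG0))
  filter_upwards [h0] with t ht hmem
  refine ⟨hmem.1, ?_⟩
  simp only [← ht hmem.1]
  exact hmem.2

end LowerBound

/-! ### Weighted integrals of switching functions -/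

section WeightedIntegral

open Matrix

theorem le_integral_of_volume_sublevel_le {h w : ℝ → ℝ} {τ ε V : ℝ} (hτ : 0 ≤ τ) (hε : 0 ≤ ε)
    (hV : 0 ≤ V) (hh : Measurable h) (hi : IntervalIntegrable h volume 0 τ)
    (hw : Measurable w) (hw0 : ∀ t, w t ∈ Set.Icc (0 : ℝ) 2)
    (hE : volume {t | t ∈ Set.Ioc 0 τ ∧ |h t| < ε} ≤ ENNReal.ofReal V) :
    ε * (∫ t in (0 : ℝ)..τ, w t) - 2 * ε * V ≤ ∫ t in (0 : ℝ)..τ, |h t| * w t := by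
  rw [intervalIntegrable_iff_integrableOn_Ioc_of_le hτ] at hi
  have hwb : ∀ t, ‖w t‖ ≤ 2 := fun t => by
    rw [Real.norm_eq_abs, abs_of_nonneg (hw0 t).1]; exact (hw0 t).2
  have hwi : IntegrableOn w (Set.Ioc 0 τ) :=
    Integrable.of_bound hw.aestronglyMeasurable 2 (.of_forall hwb)
  set E := {t | |h t| < ε}
  have hEm : MeasurableSet E := measurableSet_lt hh.abs measurable_const
  have hEi : IntegrableOn (E.indicator fun _ => (2 * ε : ℝ)) (Set.Ioc 0 τ) :=
    (integrable_const _).indicator hEm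
  rw [intervalIntegral.integral_of_le hτ, intervalIntegral.integral_of_le hτ]
  have h1 : ∫ t in Set.Ioc 0 τ, E.indicator (fun _ => (2 * ε : ℝ)) t ≤ 2 * ε * V := by
    rw [integral_indicator_const _ hEm, smul_eq_mul, mul_comm]
    refine mul_le_mul_of_nonneg_left ?_ (by positivity)
    rw [measureReal_restrict_apply hEm, Set.inter_comm]
    exact ENNReal.toReal_le_of_le_ofReal hV hE
  have h2 : ∫ t in Set.Ioc 0 τ, (ε * w t - E.indicator (fun _ => (2 * ε : ℝ)) t) ≤
      ∫ t in Set.Ioc 0 τ, |h t| * w t := by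
    refine integral_mono ((hwi.const_mul ε).sub hEi)
      (hi.abs.mul_bdd (c := 2) hw.aestronglyMeasurable (.of_forall hwb)) fun t => ?_
    by_cases ht : t ∈ E
    · simp only [Set.indicator_of_mem ht]
      nlinarith [mul_nonneg (abs_nonneg (h t)) (hw0 t).1,
        mul_nonneg hε (sub_nonneg.2 (hw0 t).2)]
    · simp only [Set.indicator_of_notMem ht, sub_zero]
      exact mul_le_mul_of_nonneg_right (not_lt.1 ht) (hw0 t).1
  rw [integral_sub (hwi.const_mul ε) hEi, integral_const_mul] at h2
  linarith

variable {T κ : ℝ} {k : ℕ} {n : Type*} [Fintype n] [DecidableEq n] {A₀ : Matrix n n ℝ}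
  {q : ℝ → Matrix n Unit ℝ} {b₀ : Matrix n Unit ℝ}

theorem exists_integral_bound (hT : 0 < T) (hq : ZkM T k fun t => q t - expM A₀ (-t) * b₀)
    (hqm : ∀ p, Measurable fun t => q t p ()) (hqi : ∀ p, IntervalIntegrable (q · p ()) volume 0 T)
    (hκ : 0 < κ) (hK : ∀ η : n → ℝ, η ≠ 0 → ∃ i ≤ k,
      κ * ‖η‖ ≤ |∑ p, η p * ((-A₀) ^ i * b₀) p ()|) :
    ∃ c T' : ℝ, 0 < c ∧ 0 < T' ∧ ∀ τ ∈ Set.Ioc 0 T', ∀ (η : n → ℝ) (w : ℝ → ℝ), Measurable w →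
      (∀ t, w t ∈ Set.Icc (0 : ℝ) 2) → c * ‖η‖ * (∫ t in (0 : ℝ)..τ, w t) ^ (k + 1) ≤
        ∫ t in (0 : ℝ)..τ, |∑ p, η p * q t p ()| * w t := by
  obtain ⟨T', hT', hsub⟩ := exists_sublevel_bound hT hq hκ hK
  refine ⟨κ / 4 * (1 / 2 ^ (k + 4)) ^ k, min T' (1 / 2), by positivity,
    lt_min hT'.1 (by norm_num), fun τ hτ η w hw hw0 => ?_⟩
  have hτT' : τ ≤ T' := hτ.2.trans (min_le_left _ _)
  have hμ0 : 0 ≤ ∫ t in (0 : ℝ)..τ, w t :=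
    intervalIntegral.integral_nonneg_of_forall hτ.1.le fun t => (hw0 t).1
  have hr0 : 0 ≤ ∫ t in (0 : ℝ)..τ, |∑ p, η p * q t p ()| * w t :=
    intervalIntegral.integral_nonneg_of_forall hτ.1.le fun t => mul_nonneg (abs_nonneg _) (hw0 t).1
  rcases eq_or_ne η 0 with rfl | hη
  · simp
  rcases hμ0.eq_or_lt with hμ | hμ
  · simpa [← hμ] using hr0
  have hμ1 : ∫ t in (0 : ℝ)..τ, w t ≤ 1 := by
    have h1 := intervalIntegral.norm_integral_le_of_norm_le_const (a := 0) (b := τ) (C := 2)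
      (f := w) fun t _ => by
        rw [Real.norm_eq_abs, abs_of_nonneg (hw0 t).1]; exact (hw0 t).2
    rw [sub_zero, abs_of_pos hτ.1] at h1
    have h2 := hτ.2.trans (min_le_right _ _)
    linarith [Real.le_norm_self (∫ t in (0 : ℝ)..τ, w t)]
  set μ := ∫ t in (0 : ℝ)..τ, w t
  obtain ⟨i, hi, hs⟩ := hsub η hη
  have hle := le_integral_of_volume_sublevel_le hτ.1.le (h := fun t => ∑ p, η p * q t p ())
    (ε := κ / 2 * ‖η‖ * (μ / 2 ^ (i + 3) / 2) ^ i)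
    (by positivity) (by positivity) (Finset.measurable_fun_sum _ fun p _ => (hqm p).const_mul _)
    (by
      have := IntervalIntegrable.sum Finset.univ (f := fun p t => η p * q t p ())
        fun p _ => (hqi p).const_mul (η p)
      refine IntervalIntegrable.mono_set ?_ (?_ : Set.uIcc 0 τ ⊆ Set.uIcc 0 T)
      · simpa only [Finset.sum_apply, Finset.sum_fn] using this
      · rw [Set.uIcc_of_le hτ.1.le, Set.uIcc_of_le hT.le]
        exact Set.Icc_subset_Icc_right (hτT'.trans hT'.2))
    hw hw0 (le_trans (measure_mono (Set.ofPred_subset_ofPred.2 fun t ht =>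
      ⟨⟨ht.1.1, ht.1.2.trans hτT'⟩, ht.2⟩)) (hs (μ / 2 ^ (i + 3)) (by positivity)))
  refine le_trans ?_ hle
  have e1 : κ / 2 * ‖η‖ * (μ / 2 ^ (i + 3) / 2) ^ i * μ - 2 * (κ / 2 * ‖η‖ *
      (μ / 2 ^ (i + 3) / 2) ^ i) * (2 ^ i * (2 * (μ / 2 ^ (i + 3)))) =
      κ / 4 * ‖η‖ * ((1 / 2 ^ (i + 4)) ^ i * μ ^ (i + 1)) := by
    rw [div_div, ← pow_succ, div_pow, div_pow, pow_succ μ i, pow_add 2 i 3]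
    field_simp
    ring
  rw [e1]
  calc κ / 4 * (1 / 2 ^ (k + 4)) ^ k * ‖η‖ * μ ^ (k + 1)
      = κ / 4 * ‖η‖ * ((1 / 2 ^ (k + 4)) ^ k * μ ^ (k + 1)) := by ring
    _ ≤ κ / 4 * ‖η‖ * ((1 / 2 ^ (i + 4)) ^ i * μ ^ (i + 1)) := by
      refine mul_le_mul_of_nonneg_left (mul_le_mul ?_ ?_ (by positivity) (by positivity))
        (by positivity)
      · calc ((1 : ℝ) / 2 ^ (k + 4)) ^ k ≤ (1 / 2 ^ (k + 4)) ^ i :=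
              pow_le_pow_of_le_one (by positivity)
                ((div_le_one (by positivity)).2 (one_le_pow₀ (by norm_num))) hi
          _ ≤ (1 / 2 ^ (i + 4)) ^ i := by
              gcongr
              norm_num
      · exact pow_le_pow_of_le_one hμ.le hμ1 (by lia)

end WeightedIntegral

/-! ### Sets of weighted integrals of controls -/

section ControlIntegral

open Matrix

variable {N M : ℕ} {Q : ℝ → Matrix (Fin N) (Fin M) ℝ} {τ D c : ℝ} {u v : ℝ → Fin M → ℝ}

theorem intervalIntegrable_of_abs_le {f : ℝ → ℝ} {C : ℝ} (hτ : 0 ≤ τ) (hf : Measurable f)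
    (hC : ∀ t ∈ Set.Icc 0 τ, |f t| ≤ C) : IntervalIntegrable f volume 0 τ := by
  rw [intervalIntegrable_iff_integrableOn_Ioc_of_le hτ]
  refine Integrable.of_bound hf.aestronglyMeasurable C ?_
  filter_upwards [ae_restrict_mem measurableSet_Ioc] with t ht using hC t ⟨ht.1.le, ht.2⟩

/-- The integral `∫₀^τ Q(t) u(t) dt`. -/
def ctrlInt (Q : ℝ → Matrix (Fin N) (Fin M) ℝ) (τ : ℝ) (u : ℝ → Fin M → ℝ) : Fin N → ℝ :=
  fun p => ∫ t in (0 : ℝ)..τ, (Q t *ᵥ u t) p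

/-- The set of all integrals `∫₀^τ Q(t) u(t) dt` with `u` admissible. -/
def ctrlSet (Q : ℝ → Matrix (Fin N) (Fin M) ℝ) (τ : ℝ) : Set (Fin N → ℝ) :=
  ctrlInt Q τ '' {u | IsAdmissible M u}

theorem _root_.IsAdmissible.abs_le (hu : IsAdmissible M u) (t : ℝ) (j : Fin M) : |u t j| ≤ 1 :=
  _root_.abs_le.2 (hu.2 t j)

theorem _root_.IsAdmissible.measurable_apply (hu : IsAdmissible M u) (j : Fin M) :
    Measurable fun t => u t j :=
  (measurable_pi_apply j).comp hu.1

theorem abs_vecMul_le (hQb : ∀ t ∈ Set.Icc 0 τ, ∀ p j, |Q t p j| ≤ D) (η : Fin N → ℝ) {t : ℝ}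
    (ht : t ∈ Set.Icc 0 τ) (j : Fin M) : |(η ᵥ* Q t) j| ≤ ∑ p, |η p| * D := by
  simp only [vecMul, dotProduct]
  refine (Finset.abs_sum_le_sum_abs _ _).trans (Finset.sum_le_sum fun p _ => ?_)
  rw [abs_mul]
  exact mul_le_mul_of_nonneg_left (hQb t ht p j) (abs_nonneg _)

theorem measurable_vecMul (hQm : ∀ p j, Measurable fun t => Q t p j) (η : Fin N → ℝ) (j : Fin M) :
    Measurable fun t => (η ᵥ* Q t) j := by
  simp only [vecMul, dotProduct]
  exact Finset.measurable_fun_sum _ fun p _ => (hQm p j).const_mul _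

theorem intervalIntegrable_mul_of_abs_le {f w : ℝ → ℝ} {C E : ℝ} (hτ : 0 ≤ τ) (hf : Measurable f)
    (hC : ∀ t ∈ Set.Icc 0 τ, |f t| ≤ C) (hw : Measurable w) (hE : ∀ t, |w t| ≤ E) :
    IntervalIntegrable (fun t => f t * w t) volume 0 τ :=
  intervalIntegrable_of_abs_le hτ (hf.mul hw) (C := C * E) fun t ht => by
    rw [abs_mul]
    exact mul_le_mul (hC t ht) (hE t) (abs_nonneg _) ((abs_nonneg _).trans (hC t ht))

theorem ctrlInt_apply (hτ : 0 ≤ τ) (hQm : ∀ p j, Measurable fun t => Q t p j)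
    (hQb : ∀ t ∈ Set.Icc 0 τ, ∀ p j, |Q t p j| ≤ D) (hu : IsAdmissible M u) (p : Fin N) :
    ctrlInt Q τ u p = ∑ j, ∫ t in (0 : ℝ)..τ, Q t p j * u t j := by
  simp only [ctrlInt, mulVec, dotProduct]
  exact intervalIntegral.integral_finsetSum fun j _ => intervalIntegrable_mul_of_abs_le hτ
    (hQm p j) (fun t ht => hQb t ht p j) (hu.measurable_apply j) fun t => hu.abs_le t j

theorem dotProduct_ctrlInt (hτ : 0 ≤ τ) (hQm : ∀ p j, Measurable fun t => Q t p j)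
    (hQb : ∀ t ∈ Set.Icc 0 τ, ∀ p j, |Q t p j| ≤ D) (hu : IsAdmissible M u) (η : Fin N → ℝ) :
    η ⬝ᵥ ctrlInt Q τ u = ∑ j, ∫ t in (0 : ℝ)..τ, (η ᵥ* Q t) j * u t j := by
  simp only [dotProduct, ctrlInt_apply hτ hQm hQb hu, vecMul, Finset.mul_sum, Finset.sum_mul]
  rw [Finset.sum_comm]
  refine Finset.sum_congr rfl fun j _ => ?_
  rw [intervalIntegral.integral_finsetSum fun p _ => ?_]
  · simp only [mul_assoc, intervalIntegral.integral_const_mul]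
  · simp only [mul_assoc]
    exact (intervalIntegrable_mul_of_abs_le hτ (hQm p j) (fun t ht => hQb t ht p j)
      (hu.measurable_apply j) fun t => hu.abs_le t j).const_mul _

theorem convex_ctrlSet (hτ : 0 ≤ τ) (hQm : ∀ p j, Measurable fun t => Q t p j)
    (hQb : ∀ t ∈ Set.Icc 0 τ, ∀ p j, |Q t p j| ≤ D) : Convex ℝ (ctrlSet Q τ) := by
  rintro _ ⟨u, hu, rfl⟩ _ ⟨v, hv, rfl⟩ a b ha hb hab
  have huv : IsAdmissible M fun t => a • u t + b • v t :=
    ⟨(hu.1.const_smul a).add (hv.1.const_smul b), fun t j =>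
      convex_Icc (-1 : ℝ) 1 (hu.2 t j) (hv.2 t j) ha hb hab⟩
  refine ⟨_, huv, ?_⟩
  have hi : ∀ {u : ℝ → Fin M → ℝ}, IsAdmissible M u → ∀ p j,
      IntervalIntegrable (fun t => Q t p j * u t j) volume 0 τ := fun hu p j =>
    intervalIntegrable_mul_of_abs_le hτ (hQm p j) (fun t ht => hQb t ht p j)
      (hu.measurable_apply j) fun t => hu.abs_le t j
  ext p
  rw [ctrlInt_apply hτ hQm hQb huv, Pi.add_apply, Pi.smul_apply, Pi.smul_apply,
    ctrlInt_apply hτ hQm hQb hu, ctrlInt_apply hτ hQm hQb hv, Finset.smul_sum, Finset.smul_sum,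
    ← Finset.sum_add_distrib]
  refine Finset.sum_congr rfl fun j _ => ?_
  rw [smul_eq_mul, smul_eq_mul, ← intervalIntegral.integral_const_mul,
    ← intervalIntegral.integral_const_mul,
    ← intervalIntegral.integral_add ((hi hu p j).const_mul a) ((hi hv p j).const_mul b)]
  refine intervalIntegral.integral_congr fun t _ => ?_
  simp only [Pi.add_apply, Pi.smul_apply, smul_eq_mul]
  ring

/-- The support function of `ctrlSet Q τ`. -/
theorem exists_maximizer (hτ : 0 ≤ τ) (hQm : ∀ p j, Measurable fun t => Q t p j)
    (hQb : ∀ t ∈ Set.Icc 0 τ, ∀ p j, |Q t p j| ≤ D) (η : Fin N → ℝ) :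
    ∃ z ∈ ctrlSet Q τ, η ⬝ᵥ z = ∑ j, ∫ t in (0 : ℝ)..τ, |(η ᵥ* Q t) j| := by
  classical
  have hu : IsAdmissible M fun t j => if 0 ≤ (η ᵥ* Q t) j then 1 else -1 := by
    refine ⟨measurable_pi_lambda _ fun j => Measurable.ite
      (measurableSet_le measurable_const (measurable_vecMul hQm η j)) measurable_const
      measurable_const, fun t j => ?_⟩
    dsimp only
    split_ifs <;> simp
  refine ⟨_, ⟨_, hu, rfl⟩, ?_⟩
  rw [dotProduct_ctrlInt hτ hQm hQb hu]
  refine Finset.sum_congr rfl fun j _ => intervalIntegral.integral_congr fun t _ => ?_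
  split_ifs with h
  · rw [mul_one, abs_of_nonneg h]
  · rw [mul_neg_one, abs_of_neg (not_le.1 h)]

theorem dotProduct_sub_le (hτ : 0 ≤ τ) (hQm : ∀ p j, Measurable fun t => Q t p j)
    (hQb : ∀ t ∈ Set.Icc 0 τ, ∀ p j, |Q t p j| ≤ D) {η : Fin N → ℝ} (hu : IsAdmissible M u)
    (hv : IsAdmissible M v) (hη : ∀ z ∈ ctrlSet Q τ, η ⬝ᵥ z ≤ η ⬝ᵥ ctrlInt Q τ u) :
    η ⬝ᵥ (ctrlInt Q τ v - ctrlInt Q τ u) ≤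
      -∑ j, ∫ t in (0 : ℝ)..τ, |(η ᵥ* Q t) j| * |v t j - u t j| := by
  obtain ⟨z, hz, hzη⟩ := exists_maximizer hτ hQm hQb η
  have h1 := hη z hz
  rw [hzη] at h1
  have hm := measurable_vecMul hQm η
  have hb := fun (t : ℝ) (ht : t ∈ Set.Icc 0 τ) => abs_vecMul_le hQb η ht
  have hi : ∀ {u : ℝ → Fin M → ℝ}, IsAdmissible M u → ∀ j,
      IntervalIntegrable (fun t => (η ᵥ* Q t) j * u t j) volume 0 τ := fun hu j =>
    intervalIntegrable_mul_of_abs_le hτ (hm j) (fun t ht => hb t ht j)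
      (hu.measurable_apply j) fun t => hu.abs_le t j
  have ha : ∀ j, IntervalIntegrable (fun t => |(η ᵥ* Q t) j|) volume 0 τ := fun j =>
    (intervalIntegrable_of_abs_le hτ (hm j) fun t ht => hb t ht j).abs
  have hw : ∀ j, IntervalIntegrable (fun t => |(η ᵥ* Q t) j| * |v t j - u t j|) volume 0 τ := by
    intro j
    refine intervalIntegrable_mul_of_abs_le hτ (hm j).abs
      (fun t ht => (abs_abs _).le.trans (hb t ht j))
      ((hv.measurable_apply j).sub (hu.measurable_apply j)).abs (E := 2) fun t => ?_
    rw [abs_abs]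
    linarith [abs_sub (v t j) (u t j), hu.abs_le t j, hv.abs_le t j]
  have key : ∀ j, (∫ t in (0 : ℝ)..τ, (η ᵥ* Q t) j * v t j) -
      (∫ t in (0 : ℝ)..τ, (η ᵥ* Q t) j * u t j) +
      (∫ t in (0 : ℝ)..τ, |(η ᵥ* Q t) j| * |v t j - u t j|) ≤
      2 * ((∫ t in (0 : ℝ)..τ, |(η ᵥ* Q t) j|) - ∫ t in (0 : ℝ)..τ, (η ᵥ* Q t) j * u t j) := by
    intro j
    rw [← intervalIntegral.integral_sub (hi hv j) (hi hu j),
      ← intervalIntegral.integral_add ((hi hv j).sub (hi hu j)) (hw j),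
      ← intervalIntegral.integral_sub (ha j) (hi hu j), ← intervalIntegral.integral_const_mul]
    refine intervalIntegral.integral_mono_on hτ (((hi hv j).sub (hi hu j)).add (hw j))
      (((ha j).sub (hi hu j)).const_mul 2) fun t _ => ?_
    obtain ⟨hu1, hu2⟩ := hu.2 t j
    obtain ⟨hv1, hv2⟩ := hv.2 t j
    rcases abs_cases ((η ᵥ* Q t) j) with ⟨h, h'⟩ | ⟨h, h'⟩ <;>
      rcases abs_cases (v t j - u t j) with ⟨k, k'⟩ | ⟨k, k'⟩ <;> rw [h, k] <;> nlinarith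
  have hsum := Finset.sum_le_sum fun j (_ : j ∈ Finset.univ) => key j
  rw [Finset.sum_add_distrib, Finset.sum_sub_distrib, ← Finset.mul_sum,
    Finset.sum_sub_distrib] at hsum
  rw [dotProduct_ctrlInt hτ hQm hQb hu] at h1
  rw [dotProduct_sub, dotProduct_ctrlInt hτ hQm hQb hu, dotProduct_ctrlInt hτ hQm hQb hv]
  linarith

theorem norm_ctrlInt_sub_le (hτ : 0 ≤ τ) (hQm : ∀ p j, Measurable fun t => Q t p j)
    (hQb : ∀ t ∈ Set.Icc 0 τ, ∀ p j, |Q t p j| ≤ D) (hD : 0 ≤ D) (hu : IsAdmissible M u)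
    (hv : IsAdmissible M v) : ‖ctrlInt Q τ v - ctrlInt Q τ u‖ ≤
      D * ∑ j, ∫ t in (0 : ℝ)..τ, |v t j - u t j| := by
  have hn : ∀ j, 0 ≤ ∫ t in (0 : ℝ)..τ, |v t j - u t j| := fun j =>
    intervalIntegral.integral_nonneg_of_forall hτ fun _ => abs_nonneg _
  refine (pi_norm_le_iff_of_nonneg (mul_nonneg hD (Finset.sum_nonneg fun j _ => hn j))).2 fun p => ?_
  have hi : ∀ {u : ℝ → Fin M → ℝ}, IsAdmissible M u → ∀ j,
      IntervalIntegrable (fun t => Q t p j * u t j) volume 0 τ := fun hu j =>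
    intervalIntegrable_mul_of_abs_le hτ (hQm p j) (fun t ht => hQb t ht p j)
      (hu.measurable_apply j) fun t => hu.abs_le t j
  rw [Pi.sub_apply, ctrlInt_apply hτ hQm hQb hu, ctrlInt_apply hτ hQm hQb hv,
    ← Finset.sum_sub_distrib, Finset.mul_sum]
  refine (norm_sum_le _ _).trans (Finset.sum_le_sum fun j _ => ?_)
  rw [← intervalIntegral.integral_sub (hi hv j) (hi hu j), ← intervalIntegral.integral_const_mul]
  refine intervalIntegral.norm_integral_le_of_norm_le hτ (.of_forall fun t ht => ?_) ?_
  · rw [← mul_sub, norm_mul]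
    exact mul_le_mul_of_nonneg_right (hQb t ⟨ht.1.le, ht.2⟩ p j) (norm_nonneg _)
  · refine (intervalIntegrable_of_abs_le hτ ((hv.measurable_apply j).sub
      (hu.measurable_apply j)).abs (C := 2) fun t _ => ?_).const_mul D
    rw [abs_abs]
    change |v t j - u t j| ≤ 2
    linarith [abs_sub (v t j) (u t j), hu.abs_le t j, hv.abs_le t j]

/-- Strict convexity of `ctrlSet Q τ`. -/
theorem ctrlSet_strictConvex {k : ℕ} (hτ : 0 ≤ τ) (hQm : ∀ p j, Measurable fun t => Q t p j)
    (hQb : ∀ t ∈ Set.Icc 0 τ, ∀ p j, |Q t p j| ≤ D) (hD : 0 < D) (hM : 1 ≤ M) (hc : 0 ≤ c)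
    (hQ : ∀ (j : Fin M) (η : Fin N → ℝ) (w : ℝ → ℝ), Measurable w →
      (∀ t, w t ∈ Set.Icc (0 : ℝ) 2) → c * ‖η‖ * (∫ t in (0 : ℝ)..τ, w t) ^ k ≤
        ∫ t in (0 : ℝ)..τ, |(η ᵥ* Q t) j| * w t)
    {η z z' : Fin N → ℝ} (hz : z ∈ ctrlSet Q τ) (hz' : z' ∈ ctrlSet Q τ)
    (hη : ∀ y ∈ ctrlSet Q τ, η ⬝ᵥ y ≤ η ⬝ᵥ z) :
    η ⬝ᵥ (z' - z) ≤ -(c / (D * M) ^ k) * ‖η‖ * ‖z' - z‖ ^ k := by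
  obtain ⟨u, hu, rfl⟩ := hz
  obtain ⟨v, hv, rfl⟩ := hz'
  refine (dotProduct_sub_le hτ hQm hQb hu hv hη).trans ?_
  have hM0 : (0 : ℝ) < M := by exact_mod_cast hM
  have hn : ∀ j, 0 ≤ ∫ t in (0 : ℝ)..τ, |v t j - u t j| := fun j =>
    intervalIntegral.integral_nonneg_of_forall hτ fun _ => abs_nonneg _
  have hn' : ∀ j, 0 ≤ ∫ t in (0 : ℝ)..τ, |(η ᵥ* Q t) j| * |v t j - u t j| := fun j =>
    intervalIntegral.integral_nonneg_of_forall hτ fun _ => by positivity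
  have : Nonempty (Fin M) := ⟨⟨0, hM⟩⟩
  obtain ⟨i, hi⟩ := Finite.exists_max fun j => ∫ t in (0 : ℝ)..τ, |v t j - u t j|
  have h1 : ‖ctrlInt Q τ v - ctrlInt Q τ u‖ ≤ D * M * ∫ t in (0 : ℝ)..τ, |v t i - u t i| := by
    refine (norm_ctrlInt_sub_le hτ hQm hQb hD.le hu hv).trans ?_
    rw [mul_assoc]
    refine mul_le_mul_of_nonneg_left ((Finset.sum_le_sum fun j _ => hi j).trans ?_) hD.le
    simp
  have h2 := pow_le_pow_left₀ (norm_nonneg _) h1 k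
  rw [mul_pow] at h2
  have h3 := hQ i η (fun t => |v t i - u t i|)
    ((hv.measurable_apply i).sub (hu.measurable_apply i)).abs fun t => ⟨abs_nonneg _, by
      linarith [abs_sub (v t i) (u t i), hu.abs_le t i, hv.abs_le t i]⟩
  have h4 := Finset.single_le_sum (fun j _ => hn' j) (Finset.mem_univ i)
  have h5 : c / (D * M) ^ k * ‖η‖ * ‖ctrlInt Q τ v - ctrlInt Q τ u‖ ^ k ≤
      c * ‖η‖ * (∫ t in (0 : ℝ)..τ, |v t i - u t i|) ^ k := by
    calc c / (D * M) ^ k * ‖η‖ * ‖ctrlInt Q τ v - ctrlInt Q τ u‖ ^ k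
        ≤ c / (D * M) ^ k * ‖η‖ * ((D * M) ^ k * (∫ t in (0 : ℝ)..τ, |v t i - u t i|) ^ k) := by
          gcongr
      _ = _ := by field_simp
  linarith

/-- A convex subset of `ℝ^N` whose support function dominates that of a ball contains the open
ball. -/
theorem ball_subset_of_support {S : Set (Fin N → ℝ)} (hS : Convex ℝ S) {r : ℝ} (hr : 0 < r)
    (h : ∀ η : Fin N → ℝ, ∃ s ∈ S, N * ‖η‖ * r ≤ η ⬝ᵥ s) : Metric.ball 0 r ⊆ S := by
  classical
  have h1 : Metric.ball 0 r ⊆ closure S := by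
    intro z hz
    by_contra hzS
    obtain ⟨f, a, hf, ha⟩ := geometric_hahn_banach_closed_point hS.closure isClosed_closure hzS
    have hfη : ∀ x, f x = (fun i => f (Pi.single i 1)) ⬝ᵥ x := fun x => by
      conv_lhs => rw [pi_eq_sum_univ' x]
      simp [dotProduct, mul_comm]
    obtain ⟨s, hs, hsη⟩ := h fun i => f (Pi.single i 1)
    rw [← hfη] at hsη
    have h2 := hf s (subset_closure hs)
    have h3 : f z ≤ N * ‖fun i => f (Pi.single i 1)‖ * ‖z‖ := by
      rw [hfη]
      refine (Finset.sum_le_sum fun i _ => (le_abs_self _).trans ?_).trans (b := ∑ _i : Fin N,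
        ‖fun i => f (Pi.single i 1)‖ * ‖z‖) ?_
      · rw [abs_mul]
        exact mul_le_mul (norm_le_pi_norm (fun i => f (Pi.single i 1)) i) (norm_le_pi_norm z i)
          (abs_nonneg _) (norm_nonneg _)
      · simp [mul_assoc]
    rw [mem_ball_zero_iff] at hz
    have h4 : N * ‖fun i => f (Pi.single i 1)‖ * ‖z‖ ≤ N * ‖fun i => f (Pi.single i 1)‖ * r := by
      gcongr
    linarith
  have hspan : affineSpan ℝ S = ⊤ := by
    have h2 : Metric.ball 0 r ⊆ (affineSpan ℝ S : Set (Fin N → ℝ)) :=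
      h1.trans (closure_minimal (subset_affineSpan ℝ S)
        (AffineSubspace.closed_of_finiteDimensional _))
    rw [eq_top_iff, ← Metric.isOpen_ball.affineSpan_eq_top
      ⟨(0 : Fin N → ℝ), Metric.mem_ball_self hr⟩]
    exact affineSpan_le.2 h2
  have h2 := interior_maximal h1 Metric.isOpen_ball
  rw [hS.interior_closure_eq_interior_of_nonempty_interior
    (hS.interior_nonempty_iff_affineSpan_eq_top.2 hspan)] at h2
  exact h2.trans interior_subset

/-- Interior ball property of `ctrlSet Q τ`. -/
theorem ball_subset_ctrlSet {k : ℕ} (hτ : 0 < τ) (hQm : ∀ p j, Measurable fun t => Q t p j)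
    (hQb : ∀ t ∈ Set.Icc 0 τ, ∀ p j, |Q t p j| ≤ D) (hM : 1 ≤ M) (hN : 1 ≤ N) (hc : 0 < c)
    (hQ : ∀ (j : Fin M) (η : Fin N → ℝ) (w : ℝ → ℝ), Measurable w →
      (∀ t, w t ∈ Set.Icc (0 : ℝ) 2) → c * ‖η‖ * (∫ t in (0 : ℝ)..τ, w t) ^ k ≤
        ∫ t in (0 : ℝ)..τ, |(η ᵥ* Q t) j| * w t) :
    Metric.ball 0 (c / N * τ ^ k) ⊆ ctrlSet Q τ := by
  have hN0 : (0 : ℝ) < N := by exact_mod_cast hN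
  refine ball_subset_of_support (convex_ctrlSet hτ.le hQm hQb) (by positivity) fun η => ?_
  obtain ⟨z, hz, hzη⟩ := exists_maximizer hτ.le hQm hQb η
  refine ⟨z, hz, ?_⟩
  have h1 := hQ ⟨0, hM⟩ η (fun _ => 1) measurable_const fun _ => by norm_num
  have h2 := Finset.single_le_sum (f := fun j => ∫ t in (0 : ℝ)..τ, |(η ᵥ* Q t) j|) (fun j _ =>
    intervalIntegral.integral_nonneg_of_forall hτ.le fun _ => abs_nonneg _)
    (Finset.mem_univ (⟨0, hM⟩ : Fin M))
  simp only [mul_one, intervalIntegral.integral_const, smul_eq_mul, sub_zero] at h1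
  rw [hzη, show N * ‖η‖ * (c / N * τ ^ k) = c * ‖η‖ * τ ^ k by field_simp]
  exact h1.trans h2

end ControlIntegral

/-! ### The reachable set as a set of control integrals -/

section Reach

open Matrix

variable {N M : ℕ} {A : ℝ → Matrix (Fin N) (Fin N) ℝ} {B : ℝ → Matrix (Fin N) (Fin M) ℝ}
  {P : ℝ → Matrix (Fin N) (Fin N) ℝ} {T τ CA CB : ℝ} {u : ℝ → Fin M → ℝ} {x : ℝ → Fin N → ℝ}

theorem intervalIntegrable_mulVec_control (hτ : 0 ≤ τ) (hB : ∀ i j, Measurable fun t => B t i j)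
    (hCB : ∀ t, 0 ≤ t → ∀ i j, |B t i j| ≤ CB) (hu : IsAdmissible M u) (i : Fin N) :
    IntervalIntegrable (fun t => (B t *ᵥ u t) i) volume 0 τ := by
  simp only [mulVec, dotProduct]
  simpa only [Finset.sum_apply, Finset.sum_fn] using IntervalIntegrable.sum Finset.univ
    (f := fun j t => B t i j * u t j) fun j _ => intervalIntegrable_mul_of_abs_le hτ (hB i j)
      (fun t ht => hCB t ht.1 i j) (hu.measurable_apply j) fun t => hu.abs_le t j

theorem intervalIntegrable_mulVec_of_continuous (hτ : 0 ≤ τ) (hA : ∀ i j, Measurable fun t => A t i j)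
    (hCA : ∀ t, 0 ≤ t → ∀ i j, |A t i j| ≤ CA) (hx : Continuous x) (i : Fin N) :
    IntervalIntegrable (fun t => (A t *ᵥ x t) i) volume 0 τ := by
  simp only [mulVec, dotProduct]
  simpa only [Finset.sum_apply, Finset.sum_fn] using IntervalIntegrable.sum Finset.univ
    (f := fun j t => A t i j * x t j) fun j _ => (intervalIntegrable_of_abs_le hτ (hA i j)
      fun t ht => hCA t ht.1 i j).mul_continuousOn ((continuous_apply j).comp hx).continuousOn

theorem isLinNATraj_iff (hA : ∀ i j, Measurable fun t => A t i j)
    (hCA : ∀ t, 0 ≤ t → ∀ i j, |A t i j| ≤ CA) (hB : ∀ i j, Measurable fun t => B t i j)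
    (hCB : ∀ t, 0 ≤ t → ∀ i j, |B t i j| ≤ CB) (hu : IsAdmissible M u) :
    IsLinNATraj N M A B τ u x ↔ Continuous x ∧ ∀ t ∈ Set.Icc 0 τ, ∀ i,
      x t i = ∫ r in (0 : ℝ)..t, ((A r *ᵥ x r) i + (B r *ᵥ u r) i) := by
  refine and_congr_right fun hx => forall₂_congr fun t ht => ?_
  have hi : ∀ i, IntervalIntegrable (fun r => (A r *ᵥ x r + B r *ᵥ u r) i) volume 0 t := fun i =>
    (intervalIntegrable_mulVec_of_continuous ht.1 hA hCA hx i).add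
      (intervalIntegrable_mulVec_control ht.1 hB hCB hu i)
  rw [funext_iff]
  refine forall_congr' fun i => ?_
  rw [intervalIntegral.integral_of_le ht.1, eval_integral fun i =>
    (intervalIntegrable_iff_integrableOn_Ioc_of_le ht.1).1 (hi i),
    intervalIntegral.integral_of_le ht.1]
  rfl

theorem mulVec_eq_ctrlInt (hτ : 0 < τ) (hA : ∀ i j, Measurable fun t => A t i j)
    (hCA : ∀ t, 0 ≤ t → ∀ i j, |A t i j| ≤ CA) (hB : ∀ i j, Measurable fun t => B t i j)
    (hCB : ∀ t, 0 ≤ t → ∀ i j, |B t i j| ≤ CB) (hPc : ∀ i j, Continuous fun t => P t i j)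
    (hP : PrimM 0 τ P (fun t => P t * -A t) 1) (hu : IsAdmissible M u)
    (hx : IsLinNATraj N M A B τ u x) : P τ *ᵥ x τ = ctrlInt (fun t => P t * B t) τ u := by
  obtain ⟨hxc, hxe⟩ := (isLinNATraj_iff hA hCA hB hCB hu).1 hx
  have h1 : PrimM 0 τ (fun t => replicateCol Unit (x t))
      (fun t => A t * replicateCol Unit (x t) + replicateCol Unit (B t *ᵥ u t)) 0 := fun i _ =>
    primOn_of_eq ((intervalIntegrable_mulVec_of_continuous hτ.le hA hCA hxc i).add
      (intervalIntegrable_mulVec_control hτ.le hB hCB hu i)) fun t ht => by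
        simpa [mul_apply, mulVec, dotProduct] using hxe t ht i
  have h2 := hP.mul hτ.le h1
  ext i
  have h3 := (h2 i ()).eq_on hτ (by
    simp only [mul_apply, replicateCol_apply]
    exact (continuous_finsetSum _ fun j _ => (hPc i j).mul
      ((continuous_apply j).comp hxc)).continuousOn) τ ⟨hτ.le, le_rfl⟩
  simp only [Matrix.mul_zero, Matrix.zero_apply, zero_add] at h3
  refine Eq.trans h3 ?_
  rw [ctrlInt]
  refine intervalIntegral.integral_congr fun t _ => ?_
  rw [Matrix.mul_add, ← Matrix.mul_assoc, Matrix.mul_neg, Matrix.neg_mul, neg_add_cancel_left,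
    ← mulVec_mulVec]
  simp [mul_apply, mulVec, dotProduct]

theorem linNAReach_eq_preimage (hτ : 0 < τ) (hA : ∀ i j, Measurable fun t => A t i j)
    (hCA : ∀ t, 0 ≤ t → ∀ i j, |A t i j| ≤ CA) (hCA0 : 0 ≤ CA) (hsmall : N * CA * τ ≤ 1 / 2)
    (hB : ∀ i j, Measurable fun t => B t i j) (hCB : ∀ t, 0 ≤ t → ∀ i j, |B t i j| ≤ CB)
    (hPc : ∀ i j, Continuous fun t => P t i j) (hP : PrimM 0 τ P (fun t => P t * -A t) 1)
    {Ψ : Matrix (Fin N) (Fin N) ℝ} (hΨ : Ψ * P τ = 1) :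
    linNAReach N M A B τ = (P τ *ᵥ ·) ⁻¹' ctrlSet (fun t => P t * B t) τ := by
  ext y
  constructor
  · rintro ⟨u, x, hu, hx, rfl⟩
    exact ⟨u, hu, (mulVec_eq_ctrlInt hτ hA hCA hB hCB hPc hP hu hx).symm⟩
  · rintro ⟨u, hu, hy⟩
    obtain ⟨x, hxc, -, hxe⟩ := exists_linear_solution hτ.le hA (fun t ht => hCA t ht.1) hCA0
      (by rwa [Fintype.card_fin]) (intervalIntegrable_mulVec_control hτ.le hB hCB hu) 0
    have hx : IsLinNATraj N M A B τ u x :=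
      (isLinNATraj_iff hA hCA hB hCB hu).2 ⟨hxc, by simpa using hxe⟩
    refine ⟨u, x, hu, hx, ?_⟩
    have h := (mulVec_eq_ctrlInt hτ hA hCA hB hCB hPc hP hu hx).trans hy
    have h' := congrArg (Ψ *ᵥ ·) h
    simpa [hΨ] using h'.symm

theorem euDot_eq (x y : Fin N → ℝ) : euDot x y = x ⬝ᵥ y := rfl

theorem euNorm_nonneg (x : Fin N → ℝ) : 0 ≤ euNorm x := Real.sqrt_nonneg _

theorem norm_le_euNorm (x : Fin N → ℝ) : ‖x‖ ≤ euNorm x := by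
  refine (pi_norm_le_iff_of_nonneg (euNorm_nonneg x)).2 fun i => Real.abs_le_sqrt ?_
  exact Finset.single_le_sum (f := fun i => x i ^ 2) (fun i _ => sq_nonneg (x i))
    (Finset.mem_univ i)

theorem euNorm_le (x : Fin N → ℝ) : euNorm x ≤ N * ‖x‖ := by
  refine Real.sqrt_le_iff.2 ⟨by positivity, ?_⟩
  calc ∑ i, x i ^ 2 ≤ ∑ _i : Fin N, ‖x‖ ^ 2 := Finset.sum_le_sum fun i _ => by
        rw [← sq_abs]; exact pow_le_pow_left₀ (abs_nonneg _) (norm_le_pi_norm x i) 2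
    _ = N * ‖x‖ ^ 2 := by simp
    _ ≤ (N * ‖x‖) ^ 2 := by
        rw [mul_pow]
        refine mul_le_mul_of_nonneg_right ?_ (sq_nonneg _)
        exact_mod_cast Nat.le_self_pow two_ne_zero N

theorem norm_mulVec_le {L : Matrix (Fin N) (Fin N) ℝ} {D : ℝ} (hD : 0 ≤ D)
    (hL : ∀ i j, |L i j| ≤ D) (x : Fin N → ℝ) : ‖L *ᵥ x‖ ≤ N * D * ‖x‖ := by
  refine (pi_norm_le_iff_of_nonneg (by positivity)).2 fun i => ?_
  refine (norm_sum_le _ _).trans ((Finset.sum_le_sum fun j _ => ?_).trans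
    (b := ∑ _j : Fin N, D * ‖x‖) (by simp [mul_assoc]))
  rw [norm_mul]
  exact mul_le_mul (hL i j) (norm_le_pi_norm x j) (norm_nonneg _) hD

/-- A proximal normal to a convex set is a normal in the sense of convex analysis. -/
theorem euDot_nonpos_of_mem_proxNormalCone {R : Set (Fin N → ℝ)} (hR : Convex ℝ R)
    {x y ζ : Fin N → ℝ} (hx : x ∈ R) (hy : y ∈ R) (hζ : ζ ∈ proxNormalCone R x) :
    euDot ζ (y - x) ≤ 0 := by
  obtain ⟨σ, hσ, h⟩ := hζ
  have hnn : ∀ x : Fin N → ℝ, euNorm x ^ 2 = ∑ i, x i ^ 2 := fun x =>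
    Real.sq_sqrt (Finset.sum_nonneg fun i _ => sq_nonneg _)
  have key : ∀ s ∈ Set.Ioc (0 : ℝ) 1, euDot ζ (y - x) ≤ s * (σ * euNorm (y - x) ^ 2) := by
    intro s hs
    have h1 := h _ (hR.add_smul_sub_mem hx hy ⟨hs.1.le, hs.2⟩)
    rw [add_sub_cancel_left, euDot_eq, dotProduct_smul, ← euDot_eq, hnn] at h1
    simp only [Pi.smul_apply, smul_eq_mul, mul_pow, ← Finset.mul_sum] at h1
    rw [← hnn] at h1
    refine le_of_mul_le_mul_left (h1.trans_eq ?_) hs.1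
    ring
  refine ge_of_tendsto (x := 𝓝[>] (0 : ℝ)) (f := fun s => s * (σ * euNorm (y - x) ^ 2)) ?_ ?_
  · have : Tendsto (fun s => s * (σ * euNorm (y - x) ^ 2)) (𝓝 0) (𝓝 (0 * _)) :=
      tendsto_id.mul_const _
    rw [zero_mul] at this
    exact this.mono_left nhdsWithin_le_nhds
  · filter_upwards [Ioc_mem_nhdsGT one_pos] with s hs using key s hs

/-- Strict convexity and the interior ball property for a linear preimage of a set of control
integrals. -/
theorem strictConvex_and_ball_subset_preimage {Q : ℝ → Matrix (Fin N) (Fin M) ℝ} {D c : ℝ} {k : ℕ}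
    {L Ψ : Matrix (Fin N) (Fin N) ℝ} (hτ : 0 < τ) (hQm : ∀ p j, Measurable fun t => Q t p j)
    (hQb : ∀ t ∈ Set.Icc 0 τ, ∀ p j, |Q t p j| ≤ D) (hD : 0 < D) (hM : 1 ≤ M) (hN : 1 ≤ N)
    (hc : 0 < c) (hQ : ∀ (j : Fin M) (η : Fin N → ℝ) (w : ℝ → ℝ), Measurable w →
      (∀ t, w t ∈ Set.Icc (0 : ℝ) 2) → c * ‖η‖ * (∫ t in (0 : ℝ)..τ, w t) ^ k ≤
        ∫ t in (0 : ℝ)..τ, |(η ᵥ* Q t) j| * w t)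
    (hLΨ : L * Ψ = 1) (hL : ∀ i j, |L i j| ≤ D) (hΨ : ∀ i j, |Ψ i j| ≤ D) :
    (∀ x ∈ (L *ᵥ ·) ⁻¹' ctrlSet Q τ, ∀ y ∈ (L *ᵥ ·) ⁻¹' ctrlSet Q τ,
      ∀ ζ ∈ proxNormalCone ((L *ᵥ ·) ⁻¹' ctrlSet Q τ) x, euDot ζ (y - x) ≤
        -(c / (D * M) ^ k / (N * (N * D)) / (N * (N * D)) ^ k) * euNorm ζ * euNorm (y - x) ^ k) ∧
    {x : Fin N → ℝ | euNorm x ≤ c / N / (2 * (N * D)) * τ ^ k} ⊆ (L *ᵥ ·) ⁻¹' ctrlSet Q τ := by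
  have hΨL : Ψ * L = 1 := mul_eq_one_comm.1 hLΨ
  have hN0 : (0 : ℝ) < N := by exact_mod_cast hN
  have hM0 : (0 : ℝ) < M := by exact_mod_cast hM
  have hR : Convex ℝ ((L *ᵥ ·) ⁻¹' ctrlSet Q τ) :=
    (convex_ctrlSet hτ.le hQm hQb).linear_preimage L.mulVecLin
  refine ⟨fun x hx y hy ζ hζ => ?_, fun x hx => ?_⟩
  · have hη : ∀ z, (ζ ᵥ* Ψ) ⬝ᵥ z = ζ ⬝ᵥ (Ψ *ᵥ z) := fun z => (dotProduct_mulVec ζ Ψ z).symm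
    have hcancel : ∀ z, Ψ *ᵥ (L *ᵥ z) = z := fun z => by rw [mulVec_mulVec, hΨL, one_mulVec]
    have hcancel' : ∀ z, L *ᵥ (Ψ *ᵥ z) = z := fun z => by rw [mulVec_mulVec, hLΨ, one_mulVec]
    have h1 := ctrlSet_strictConvex hτ.le hQm hQb hD hM hc.le hQ (η := ζ ᵥ* Ψ) hx hy
      fun z hz => by
        have := euDot_nonpos_of_mem_proxNormalCone hR hx (y := Ψ *ᵥ z)
          (by rwa [Set.mem_preimage, hcancel']) hζ
        rw [euDot_eq, dotProduct_sub] at this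
        rw [hη, hη, hcancel]
        linarith
    dsimp only at h1
    rw [← mulVec_sub, hη, hcancel] at h1
    rw [euDot_eq]
    refine h1.trans ?_
    have h2 : euNorm ζ ≤ N * (N * D) * ‖ζ ᵥ* Ψ‖ := by
      have : ζ = Lᵀ *ᵥ (ζ ᵥ* Ψ) := by rw [mulVec_transpose, vecMul_vecMul, hΨL, vecMul_one]
      calc euNorm ζ ≤ N * ‖ζ‖ := euNorm_le ζ
        _ = N * ‖Lᵀ *ᵥ (ζ ᵥ* Ψ)‖ := by rw [← this]
        _ ≤ N * (N * D * ‖ζ ᵥ* Ψ‖) := by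
          gcongr; exact norm_mulVec_le hD.le (fun i j => hL j i) _
        _ = _ := by ring
    have h3 : euNorm (y - x) ≤ N * (N * D) * ‖L *ᵥ (y - x)‖ := by
      calc euNorm (y - x) ≤ N * ‖y - x‖ := euNorm_le _
        _ = N * ‖Ψ *ᵥ (L *ᵥ (y - x))‖ := by rw [hcancel]
        _ ≤ N * (N * D * ‖L *ᵥ (y - x)‖) := by gcongr; exact norm_mulVec_le hD.le hΨ _
        _ = _ := by ring
    have h4 := pow_le_pow_left₀ (euNorm_nonneg _) h3 k
    rw [mul_pow] at h4
    have h5 : c / (D * M) ^ k / (N * (N * D)) / (N * (N * D)) ^ k * euNorm ζ *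
        euNorm (y - x) ^ k ≤ c / (D * M) ^ k * ‖ζ ᵥ* Ψ‖ * ‖L *ᵥ (y - x)‖ ^ k := by
      calc c / (D * M) ^ k / (N * (N * D)) / (N * (N * D)) ^ k * euNorm ζ * euNorm (y - x) ^ k
          ≤ c / (D * M) ^ k / (N * (N * D)) / (N * (N * D)) ^ k * (N * (N * D) * ‖ζ ᵥ* Ψ‖) *
            ((N * (N * D)) ^ k * ‖L *ᵥ (y - x)‖ ^ k) := by
              gcongr
              exact pow_nonneg (euNorm_nonneg _) _
        _ = _ := by field_simp
    linarith
  · refine ball_subset_ctrlSet hτ hQm hQb hM hN hc hQ (mem_ball_zero_iff.2 ?_)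
    have h1 := (norm_mulVec_le hD.le hL x).trans
      (mul_le_mul_of_nonneg_left ((norm_le_euNorm x).trans hx) (by positivity))
    refine h1.trans_lt ?_
    have h2 : N * D * (c / N / (2 * (N * D)) * τ ^ k) = c / N * τ ^ k / 2 := by field_simp
    rw [h2]
    exact half_lt_self (by positivity)

end Reach

/-! ### Uniform bounds for all columns -/

section Columns

open Matrix

/-- Weighted integrals of the switching functions of one column dominate a power of the integral of
the weight. -/
theorem ColumnData.exists_integral_bound {m M : ℕ} {T CB : ℝ} {j : Fin M}
    {A Y Yi P : ℝ → Matrix (Fin (m + 2)) (Fin (m + 2)) ℝ} {B : ℝ → Matrix (Fin (m + 2)) (Fin M) ℝ}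
    (h : ColumnData m T A Y Yi (fun t => replicateCol Unit fun i => B t i j) (A 0)
      (replicateCol Unit fun i => B 0 i j))
    (hrank : (_root_.kalman (A 0) (fun i => B 0 i j)).rank = m + 2)
    (hB : ∀ i j, Measurable fun t => B t i j) (hCB : ∀ t, 0 ≤ t → ∀ i j, |B t i j| ≤ CB)
    (hPc : ∀ i j, Continuous fun t => P t i j) (hP : PrimM 0 T P (fun t => P t * -A t) 1) :
    ∃ c T' : ℝ, 0 < c ∧ 0 < T' ∧ ∀ τ ∈ Set.Ioc 0 T', ∀ (η : Fin (m + 2) → ℝ) (w : ℝ → ℝ),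
      Measurable w → (∀ t, w t ∈ Set.Icc (0 : ℝ) 2) →
        c * ‖η‖ * (∫ t in (0 : ℝ)..τ, w t) ^ (m + 2) ≤
          ∫ t in (0 : ℝ)..τ, |(η ᵥ* (P t * B t)) j| * w t := by
  obtain ⟨T', hT', hA, hb⟩ := h.exists_zkM
  obtain ⟨κ, hκ, hK⟩ := exists_kalman_bound hrank
  have hq := zkM_propagated_column hT'.1 hA hb (fun i j => (hP i j).mono hT'.1.le hT'.2) fun i j =>
    wk_zero_of_continuousOn (hPc i j).continuousOn
  obtain ⟨c, T'', hc, hT'', hbound⟩ := ReachableSet.exists_integral_bound hT'.1 hq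
    (fun p => by
      simp only [mul_apply, replicateCol_apply]
      exact Finset.measurable_fun_sum _ fun r _ => (hPc p r).measurable.mul (hB r j))
    (fun p => by
      simp only [mul_apply, replicateCol_apply]
      simpa only [Finset.sum_apply, Finset.sum_fn] using IntervalIntegrable.sum Finset.univ
        (f := fun r t => P t p r * B t r j) fun r _ =>
          (intervalIntegrable_of_abs_le hT'.1.le (hB r j) fun t ht =>
            hCB t ht.1 r j).continuousOn_mul (hPc p r).continuousOn)
    hκ fun η hη => (hK η hη).imp fun i hi => ⟨Nat.lt_succ_iff.1 hi.1, hi.2⟩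
  refine ⟨c, T'', hc, hT'', fun τ hτ η w hw hw0 => ?_⟩
  simpa [vecMul, dotProduct, mul_apply] using hbound τ hτ η w hw hw0

theorem exists_abs_le_of_continuous {l n : Type*} [Finite l] [Finite n] {F : ℝ → Matrix l n ℝ}
    (hF : ∀ i j, Continuous fun t => F t i j) (T : ℝ) :
    ∃ C : ℝ, ∀ t ∈ Set.Icc 0 T, ∀ i j, |F t i j| ≤ C := by
  choose C hC using fun i j =>
    (isCompact_Icc (a := 0) (b := T)).exists_bound_of_continuousOn (hF i j).continuousOn
  obtain ⟨D, hD⟩ := (Set.finite_range fun x : l × n => C x.1 x.2).bddAbove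
  exact ⟨D, fun t ht i j => (hC i j t ht).trans (hD ⟨(i, j), rfl⟩)⟩

end Columns

end ReachableSet

/-- quantitative strict convexity and interior ball property of
small-time reachable sets of a nonautonomous linear system whose switching
functions are close to those of the frozen-at-`0` autonomous system. -/
theorem nonautonomous_reachable_set_strict_convexity
    (N M : ℕ) (hN : 2 ≤ N) (hM1 : 1 ≤ M) (hMN : M ≤ N)
    (A : ℝ → Matrix (Fin N) (Fin N) ℝ) (B : ℝ → Matrix (Fin N) (Fin M) ℝ)
    (hAmeas : ∀ i j, Measurable fun t => A t i j)
    (hBmeas : ∀ i j, Measurable fun t => B t i j)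
    (CA : ℝ) (hAbd : ∀ t, 0 ≤ t → ∀ i j, |A t i j| ≤ CA)
    (CB : ℝ) (hBbd : ∀ t, 0 ≤ t → ∀ i j, |B t i j| ≤ CB)
    (X X0 : ℝ → ℝ → Matrix (Fin N) (Fin N) ℝ)
    (hX : IsTransition A X) (hX0 : IsTransition (fun _ => A 0) X0)
    -- (i) the rank (normality) condition at time 0, for every column of B
    (hrank : ∀ j : Fin M, (kalman (A 0) (fun i => B 0 i j)).rank = N)
    -- (ii) smoothness of the switching functions
    (hsmooth : ∀ j : Fin M, ∀ ζ : Fin N → ℝ, euNorm ζ = 1 → ∀ τ : ℝ, 0 < τ →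
      ContDiffOn ℝ (N - 2 : ℕ) (swFun B X j ζ τ) (Set.Icc 0 τ) ∧
      AbsContOn (iteratedDerivWithin (N - 2) (swFun B X j ζ τ) (Set.Icc 0 τ)) 0 τ)
    -- (iii) closeness to the autonomous switching functions, uniformly in ζ and τ
    (K 𝒯' : ℝ) (h𝒯' : 0 < 𝒯')
    (hclose : ∀ j : Fin M, ∀ ζ : Fin N → ℝ, euNorm ζ = 1 → ∀ τ : ℝ, 0 < τ →
      ∀ i < N, ∀ t, 0 ≤ t → t ≤ min τ 𝒯' →
        |iteratedDerivWithin i (swFun B X j ζ τ) (Set.Icc 0 τ) t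
          - iteratedDerivWithin i (swFun (fun _ => B 0) X0 j ζ τ) (Set.Icc 0 τ) t|
          ≤ K * t) :
    ∃ 𝒯 γ γ' : ℝ, 0 < 𝒯 ∧ 0 < γ ∧ 0 < γ' ∧
      ∀ τ : ℝ, 0 < τ → τ ≤ 𝒯 →
        (∀ x ∈ linNAReach N M A B τ, ∀ y ∈ linNAReach N M A B τ,
          ∀ ζ ∈ proxNormalCone (linNAReach N M A B τ) x,
            euDot ζ (y - x) ≤ -γ * euNorm ζ * euNorm (y - x) ^ N) ∧
        {x : Fin N → ℝ | euNorm x ≤ γ' * τ ^ N} ⊆ linNAReach N M A B τ := by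
  obtain ⟨m, rfl⟩ := Nat.exists_eq_add_of_le' hN
  rw [Nat.add_sub_cancel] at hsmooth
  have hCA : 0 ≤ CA := (abs_nonneg _).trans (hAbd 0 le_rfl 0 0)
  obtain ⟨T, hT, hsmall⟩ : ∃ T : ℝ, 0 < T ∧ (m + 2 : ℕ) * CA * T ≤ 1 / 2 := by
    refine ⟨1 / (2 * ((m + 2 : ℕ) * CA + 1)), by positivity, ?_⟩
    rw [mul_one_div, div_le_div_iff₀ (by positivity) (by positivity)]
    linarith
  have hcard : Fintype.card (Fin (m + 2)) * CA * T ≤ 1 / 2 := by rwa [Fintype.card_fin]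
  obtain ⟨Yi, hYic, hYi0, hYi⟩ := ReachableSet.exists_fundamental_matrix hT.le (L := fun t => -A t)
    (fun i j => (hAmeas i j).neg) (fun t ht i j => by simpa using hAbd t ht.1 i j) hCA hcard
  obtain ⟨P, Ψ, hPc, hΨc, hP, hPΨ⟩ :=
    ReachableSet.exists_fundamental_pair hT.le hAmeas (fun t ht => hAbd t ht.1) hCA hcard
  choose c T' hc hT' hbound using fun j => (ReachableSet.columnData_of_isTransition hAmeas hAbd hCA hX hX0
    (hrank j) (hsmooth j) h𝒯' (hclose j) hT hsmall hYic hYi0 hYi).exists_integral_bound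
    (hrank j) hBmeas hBbd hPc hP
  have : Nonempty (Fin M) := ⟨⟨0, hM1⟩⟩
  obtain ⟨j₁, hj₁⟩ := Finite.exists_min c
  obtain ⟨j₂, hj₂⟩ := Finite.exists_min T'
  obtain ⟨D₁, hD₁⟩ := ReachableSet.exists_abs_le_of_continuous hPc T
  obtain ⟨D₂, hD₂⟩ := ReachableSet.exists_abs_le_of_continuous hΨc T
  set D := |D₁| + |D₂| + (m + 2 : ℕ) * (|D₁| * |CB|) + 1
  have hD : 0 < D := by positivity
  have hE : 0 ≤ (m + 2 : ℕ) * (|D₁| * |CB|) := by positivity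
  have hM0 : (0 : ℝ) < M := by exact_mod_cast hM1
  have := hc j₁
  refine ⟨min T (T' j₂), c j₁ / (D * M) ^ (m + 2) / ((m + 2 : ℕ) * ((m + 2 : ℕ) * D)) /
    ((m + 2 : ℕ) * ((m + 2 : ℕ) * D)) ^ (m + 2), c j₁ / (m + 2 : ℕ) / (2 * ((m + 2 : ℕ) * D)),
    lt_min hT (hT' j₂), by positivity, by positivity, fun τ hτ hτT => ?_⟩
  have hτ1 : τ ≤ T := hτT.trans (min_le_left _ _)
  have hτ2 : τ ∈ Set.Icc 0 T := ⟨hτ.le, hτ1⟩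
  have hτ3 : ∀ j, τ ∈ Set.Ioc 0 (T' j) := fun j =>
    ⟨hτ, (hτT.trans (min_le_right _ _)).trans (hj₂ j)⟩
  rw [ReachableSet.linNAReach_eq_preimage hτ hAmeas hAbd hCA
    ((mul_le_mul_of_nonneg_left hτ1 (by positivity)).trans hsmall) hBmeas hBbd hPc
    (fun i j => (hP i j).mono hτ.le hτ1) (mul_eq_one_comm.1 (hPΨ τ hτ2))]
  refine ReachableSet.strictConvex_and_ball_subset_preimage hτ (fun p j => ?_) (fun t ht p j => ?_) hD hM1
    (by lia) (hc j₁) (fun j η w hw hw0 => ?_) (hPΨ τ hτ2) (fun i j => ?_) fun i j => ?_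
  · simp only [Matrix.mul_apply]
    exact Finset.measurable_fun_sum _ fun r _ => (hPc p r).measurable.mul (hBmeas r j)
  · have h1 : |(P t * B t) p j| ≤ ∑ _r : Fin (m + 2), |D₁| * |CB| := by
      rw [Matrix.mul_apply]
      refine (Finset.abs_sum_le_sum_abs _ _).trans (Finset.sum_le_sum fun r _ => ?_)
      rw [abs_mul]
      exact mul_le_mul ((hD₁ t ⟨ht.1, ht.2.trans hτ1⟩ p r).trans (le_abs_self _))
        ((hBbd t ht.1 r j).trans (le_abs_self _)) (abs_nonneg _) (abs_nonneg _)
    rw [Finset.sum_const, Finset.card_univ, Fintype.card_fin, nsmul_eq_mul] at h1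
    linarith [abs_nonneg D₁, abs_nonneg D₂]
  · refine le_trans ?_ (hbound j τ (hτ3 j) η w hw hw0)
    have : 0 ≤ ∫ t in (0 : ℝ)..τ, w t :=
      intervalIntegral.integral_nonneg_of_forall hτ.le fun t => (hw0 t).1
    gcongr
    exact hj₁ j
  · linarith [hD₁ τ hτ2 i j, le_abs_self D₁, abs_nonneg D₂]
  · linarith [hD₂ τ hτ2 i j, le_abs_self D₂, abs_nonneg D₁]
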